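/- Let α and β be π-terms over a finite alphabet Σ and let m ∈ ℕ. Then: [α]_{ω+ω*} ≡_m^X [β]_{ω+ω*} iff the equation α = β holds in every finite monoid in R_m; [α]_{ω+ω*} ≡_m^Y [β]_{ω+ω*} iff α = β holds in every finite monoid in L_m; [α]_{ω+ω*} ≡_m^{XY} [β]_{ω+ω*} iff α = β holds in every finite monoid in R_m and in every finite monoid in L_m (equivalently, in every finite monoid of the join R_m ∨ L_m); and [α]_{ω+ω*} ≡_m^{WI} [β]_{ω+ω*} iff α = β holds in every finite monoid in R_{m+1} ∩ L_{m+1}. -/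

import Mathlib

open scoped Classical

/-! ## Generalized words -/

structure GWord (A : Type) : Type 1 where
  P : Type
  ord : LinearOrder P
  w : P → A

namespace GWord

variable {A : Type}

instance (u : GWord A) : LinearOrder u.P := u.ord

/-- The set of letters occurring in a generalized word. -/
def alph (u : GWord A) : Set A := Set.range u.w

/-- Restriction of a generalized word to a set of positions. -/
def restrict (u : GWord A) (s : Set u.P) : GWord A :=
  ⟨{ p // p ∈ s }, inferInstance, fun p => u.w p.1⟩

/-- `p` is the first `a`-labelled position of `u`. -/
def IsFirst (u : GWord A) (a : A) (p : u.P) : Prop :=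
  u.w p = a ∧ ∀ q : u.P, u.w q = a → p ≤ q

/-- `p` is the last `a`-labelled position of `u`. -/
def IsLast (u : GWord A) (a : A) (p : u.P) : Prop :=
  u.w p = a ∧ ∀ q : u.P, u.w q = a → q ≤ p

/-- The factor strictly before the first occurrence of `a`. -/
noncomputable def XL (u : GWord A) (a : A) : GWord A :=
  if h : ∃ p, u.IsFirst a p then u.restrict {q | q < h.choose} else u

/-- The factor strictly after the first occurrence of `a`. -/
noncomputable def XR (u : GWord A) (a : A) : GWord A :=
  if h : ∃ p, u.IsFirst a p then u.restrict {q | h.choose < q} else u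

/-- The factor strictly before the last occurrence of `a`. -/
noncomputable def YL (u : GWord A) (a : A) : GWord A :=
  if h : ∃ p, u.IsLast a p then u.restrict {q | q < h.choose} else u

/-- The factor strictly after the last occurrence of `a`. -/
noncomputable def YR (u : GWord A) (a : A) : GWord A :=
  if h : ∃ p, u.IsLast a p then u.restrict {q | h.choose < q} else u

/-- `C_{a,b}` is defined iff the first `a` is strictly to the right of the last `b`. -/
def CDefined (u : GWord A) (a b : A) : Prop :=
  ∃ p q, u.IsFirst a p ∧ u.IsLast b q ∧ q < p

/-- The factor strictly between the last `b` and the first `a` (junk value if undefined). -/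
noncomputable def Cab (u : GWord A) (a b : A) : GWord A :=
  if h : u.CDefined a b then
    u.restrict {r | h.choose_spec.choose < r ∧ r < h.choose}
  else u

/-- Accessibility: first/last occurrences of letters after/before every position exist. -/
def Accessible (u : GWord A) : Prop :=
  (∀ a : A, (∃ p, u.w p = a) → ∃ p, u.IsFirst a p) ∧
  (∀ a : A, (∃ p, u.w p = a) → ∃ p, u.IsLast a p) ∧
  (∀ (p : u.P) (a : A), (∃ q, p < q ∧ u.w q = a) →
    ∃ q, p < q ∧ u.w q = a ∧ ∀ r, p < r → u.w r = a → q ≤ r) ∧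
  (∀ (p : u.P) (a : A), (∃ q, q < p ∧ u.w q = a) →
    ∃ q, q < p ∧ u.w q = a ∧ ∀ r, r < p → u.w r = a → r ≤ q)

/-- Concatenation of generalized words. -/
def append (u v : GWord A) : GWord A :=
  ⟨u.P ⊕ₗ v.P, inferInstance, fun x => Sum.elim u.w v.w (ofLex x)⟩

/-- The power of a generalized word by an arbitrary linear order type `ν`
(positions ordered with the exponent component dominant). -/
def gpow (u : GWord A) (ν : Type) [LinearOrder ν] : GWord A :=
  ⟨ν ×ₗ u.P, inferInstance, fun x => u.w (ofLex x).2⟩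

/-- A finite word as a generalized word. -/
def ofList (l : List A) : GWord A :=
  ⟨Fin l.length, inferInstance, fun i => l.get i⟩

end GWord

/-- The order type `ω + ω*`: a copy of `ℕ` followed by a reversed copy of `ℕ`. -/
abbrev OO : Type := ℕ ⊕ₗ ℕᵒᵈ

/-! ## The relations `≡_{m,n}^Z` -/

inductive ZK : Type
  | X | Y | WI

inductive ZKind : Type
  | X | Y | XY | WI

/-- The relations `≡_{m,n}^X`, `≡_{m,n}^Y`, `≡_{m,n}^{WI}` (first argument is `n`). -/
def eqvAux {A : Type} : ℕ → ZK → ℕ → GWord A → GWord A → Prop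
  | 0, _, _, _, _ => True
  | _ + 1, _, 0, _, _ => True
  | n + 1, ZK.X, m + 1, u, v =>
      u.alph = v.alph ∧ eqvAux n ZK.Y m u v ∧
      ∀ a ∈ u.alph, eqvAux n ZK.Y m (u.XL a) (v.XL a) ∧
        eqvAux n ZK.X (m + 1) (u.XR a) (v.XR a)
  | n + 1, ZK.Y, m + 1, u, v =>
      u.alph = v.alph ∧ eqvAux n ZK.X m u v ∧
      ∀ a ∈ u.alph, eqvAux n ZK.Y (m + 1) (u.YL a) (v.YL a) ∧
        eqvAux n ZK.X m (u.YR a) (v.YR a)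
  | n + 1, ZK.WI, m + 1, u, v =>
      u.alph = v.alph ∧
      (∀ a ∈ u.alph,
        eqvAux n ZK.WI m (u.XL a) (v.XL a) ∧ eqvAux n ZK.WI (m + 1) (u.XR a) (v.XR a) ∧
        eqvAux n ZK.WI (m + 1) (u.YL a) (v.YL a) ∧ eqvAux n ZK.WI m (u.YR a) (v.YR a)) ∧
      ∀ a ∈ u.alph, ∀ b ∈ u.alph,
        (u.CDefined a b ↔ v.CDefined a b) ∧
        (u.CDefined a b → v.CDefined a b → eqvAux n ZK.WI m (u.Cab a b) (v.Cab a b))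

/-- `wEquiv Z m n u v` is `u ≡_{m,n}^Z v`. -/
def wEquiv {A : Type} (Z : ZKind) (m n : ℕ) (u v : GWord A) : Prop :=
  match Z with
  | ZKind.X => eqvAux n ZK.X m u v
  | ZKind.Y => eqvAux n ZK.Y m u v
  | ZKind.XY => eqvAux n ZK.X m u v ∧ eqvAux n ZK.Y m u v
  | ZKind.WI => eqvAux n ZK.WI m u v

/-! ## π-terms -/

inductive PiTerm (A : Type) : Type
  | eps : PiTerm A
  | letter : A → PiTerm A
  | mul : PiTerm A → PiTerm A → PiTerm A
  | pi : PiTerm A → PiTerm A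

def listNPow {A : Type} (l : List A) : ℕ → List A
  | 0 => []
  | k + 1 => l ++ listNPow l k

/-- `[γ]_k`: substitute the natural number `k` for the formal power `π`. -/
def PiTerm.substNat {A : Type} : PiTerm A → ℕ → List A
  | .eps, _ => []
  | .letter a, _ => [a]
  | .mul α β, k => α.substNat k ++ β.substNat k
  | .pi γ, k => listNPow (γ.substNat k) k

/-- `[γ]_{ω+ω*}`: substitute the order type `ω + ω*` for the formal power `π`. -/
def PiTerm.substOO {A : Type} : PiTerm A → GWord A
  | .eps => GWord.ofList []
  | .letter a => GWord.ofList [a]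
  | .mul α β => α.substOO.append β.substOO
  | .pi γ => γ.substOO.gpow OO

/-! ## Finite monoids, equations, the Trotter–Weil hierarchy -/

/-- `M!`: the exponent of a finite monoid, the least `n ≥ 1` such that all `x^n` are
idempotent. -/
noncomputable def monoidExp (M : Type) [Monoid M] : ℕ :=
  sInf {n : ℕ | 1 ≤ n ∧ ∀ x : M, IsIdempotentElem (x ^ n)}

/-- The equation `α = β` of π-terms holds in the finite monoid `M`. -/
def EqHoldsIn {A : Type} (α β : PiTerm A) (M : Type) [Monoid M] : Prop :=
  ∀ σ : FreeMonoid A →* M,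
    σ (FreeMonoid.ofList (α.substNat (monoidExp M))) =
      σ (FreeMonoid.ofList (β.substNat (monoidExp M)))

/-- Green's relation `R`: `x R y` iff `xM = yM`. -/
def rGreen {M : Type} [Monoid M] (x y : M) : Prop :=
  Set.range (fun z => x * z) = Set.range (fun z => y * z)

/-- Green's relation `L`: `x L y` iff `Mx = My`. -/
def lGreen {M : Type} [Monoid M] (x y : M) : Prop :=
  Set.range (fun z => z * x) = Set.range (fun z => z * y)

/-- `J`-triviality: `MxM = MyM` implies `x = y`. -/
def IsJTrivial (M : Type) [Monoid M] : Prop :=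
  ∀ x y : M, {z | ∃ a b, z = a * x * b} = {z | ∃ a b, z = a * y * b} → x = y

/-- The relation `∼_K`. -/
def simK {M : Type} [Monoid M] (x y : M) : Prop :=
  ∀ e : M, IsIdempotentElem e → (rGreen (e * x) e ∨ rGreen (e * y) e) → e * x = e * y

/-- The relation `∼_D`. -/
def simD {M : Type} [Monoid M] (x y : M) : Prop :=
  ∀ e : M, IsIdempotentElem e → (lGreen (x * e) e ∨ lGreen (y * e) e) → x * e = y * e

/-- `∼_K` as a congruence (it is a congruence, so `conGen` does not change it). -/
def KCon (M : Type) [Monoid M] : Con M := conGen simK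

/-- `∼_D` as a congruence. -/
def DCon (M : Type) [Monoid M] : Con M := conGen simD

/-- `InRLAux k true M _ = (M ∈ R_{k+1})` and `InRLAux k false M _ = (M ∈ L_{k+1})`. -/
def InRLAux : ℕ → Bool → (M : Type) → Monoid M → Prop
  | 0, _, M, i => letI := i; IsJTrivial M
  | k + 1, true, M, i => letI := i; InRLAux k false (KCon M).Quotient inferInstance
  | k + 1, false, M, i => letI := i; InRLAux k true (DCon M).Quotient inferInstance

/-- `M ∈ R_m` (for `m ≥ 1`). -/
def InRm (m : ℕ) (M : Type) [i : Monoid M] : Prop := InRLAux (m - 1) true M i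

/-- `M ∈ L_m` (for `m ≥ 1`). -/
def InLm (m : ℕ) (M : Type) [i : Monoid M] : Prop := InRLAux (m - 1) false M i

/-- `N` divides `M`: `N` is a homomorphic image of a submonoid of `M`. -/
def MDivides (N M : Type) [Monoid N] [Monoid M] : Prop :=
  ∃ (S : Submonoid M) (f : S →* N), Function.Surjective f

/-- `N ∈ R_m ∨ L_m`: `N` divides a direct product `M₁ × M₂` with `M₁ ∈ R_m`, `M₂ ∈ L_m`. -/
def InJoin (m : ℕ) (N : Type) [Monoid N] : Prop :=
  ∃ (M₁ M₂ : Type) (i₁ : Monoid M₁) (i₂ : Monoid M₂),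
    letI := i₁; letI := i₂;
    Finite M₁ ∧ Finite M₂ ∧ InRm m M₁ ∧ InLm m M₂ ∧ MDivides N (M₁ × M₂)

/-- `M ∈ DA`, via the equation `(xyz)^{M!} y (xyz)^{M!} = (xyz)^{M!}`. -/
def InDA (M : Type) [Monoid M] : Prop :=
  ∀ x y z : M,
    (x * y * z) ^ monoidExp M * y * (x * y * z) ^ monoidExp M = (x * y * z) ^ monoidExp M

/-! ## The π-terms `U_m`, `V_m` -/

inductive UVLetter : Type
  | s | t | x (i : ℕ) | y (i : ℕ)

/-- `U_m` (indexed from 1; `Uterm 0` is a junk value). -/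
def Uterm : ℕ → PiTerm UVLetter
  | 0 => PiTerm.eps
  | 1 =>
      PiTerm.mul
        (PiTerm.pi (PiTerm.mul (PiTerm.letter UVLetter.s) (PiTerm.letter (UVLetter.x 1))))
        (PiTerm.mul (PiTerm.letter UVLetter.s)
          (PiTerm.pi (PiTerm.mul (PiTerm.letter (UVLetter.y 1)) (PiTerm.letter UVLetter.t))))
  | m + 2 =>
      PiTerm.mul
        (PiTerm.pi (PiTerm.mul (Uterm (m + 1)) (PiTerm.letter (UVLetter.x (m + 2)))))
        (PiTerm.mul (Uterm (m + 1))
          (PiTerm.pi (PiTerm.mul (PiTerm.letter (UVLetter.y (m + 2))) (Uterm (m + 1)))))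

/-- `V_m` (indexed from 1; `Vterm 0` is a junk value). -/
def Vterm : ℕ → PiTerm UVLetter
  | 0 => PiTerm.eps
  | 1 =>
      PiTerm.mul
        (PiTerm.pi (PiTerm.mul (PiTerm.letter UVLetter.s) (PiTerm.letter (UVLetter.x 1))))
        (PiTerm.mul (PiTerm.letter UVLetter.t)
          (PiTerm.pi (PiTerm.mul (PiTerm.letter (UVLetter.y 1)) (PiTerm.letter UVLetter.t))))
  | m + 2 =>
      PiTerm.mul
        (PiTerm.pi (PiTerm.mul (Uterm (m + 1)) (PiTerm.letter (UVLetter.x (m + 2)))))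
        (PiTerm.mul (Vterm (m + 1))
          (PiTerm.pi (PiTerm.mul (PiTerm.letter (UVLetter.y (m + 2))) (Uterm (m + 1)))))

/-- The relation `≡_{m,n}^Z` on the free monoid `Σ*`, as a congruence
(it is a congruence, so `conGen` does not change it). -/
def eqvCon (A : Type) (Z : ZKind) (m n : ℕ) : Con (FreeMonoid A) :=
  conGen (fun u v => wEquiv Z m n (GWord.ofList u.toList) (GWord.ofList v.toList))

namespace GWord

variable {A : Type}

/-- Label-preserving order isomorphism of generalized words. -/
def Iso (u v : GWord A) : Prop := ∃ f : u.P ≃o v.P, ∀ p, v.w (f p) = u.w p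

theorem Iso.refl (u : GWord A) : Iso u u := ⟨OrderIso.refl _, fun _ => rfl⟩

theorem Iso.symm {u v : GWord A} : Iso u v → Iso v u := fun ⟨f, hf⟩ =>
  ⟨f.symm, fun p => by rw [← hf, f.apply_symm_apply]⟩

theorem Iso.trans {u v w : GWord A} : Iso u v → Iso v w → Iso u w := fun ⟨f, hf⟩ ⟨g, hg⟩ =>
  ⟨f.trans g, fun p => by rw [OrderIso.trans_apply, hg, hf]⟩

theorem Iso.of_strictMono {u v : GWord A} (f : u.P → v.P) (hf : StrictMono f)
    (hs : Function.Surjective f) (hl : ∀ p, v.w (f p) = u.w p) : Iso u v :=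
  ⟨hf.orderIsoOfSurjective f hs, hl⟩

instance isoSetoid (A : Type) : Setoid (GWord A) := ⟨Iso, Iso.refl, Iso.symm, Iso.trans⟩

/-- The first summand of a concatenation. -/
def inl (u v : GWord A) (p : u.P) : (u.append v).P := toLex (Sum.inl p)

/-- The second summand of a concatenation. -/
def inr (u v : GWord A) (p : v.P) : (u.append v).P := toLex (Sum.inr p)

section append
variable (u v : GWord A)

theorem append_cases {motive : (u.append v).P → Prop} (p : (u.append v).P)
    (hl : ∀ p, motive (u.inl v p)) (hr : ∀ p, motive (u.inr v p)) : motive p := by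
  rcases h : ofLex p with q | q
  · exact (show p = u.inl v q from h) ▸ hl q
  · exact (show p = u.inr v q from h) ▸ hr q

@[simp] theorem append_w_inl (p : u.P) : (u.append v).w (u.inl v p) = u.w p := rfl
@[simp] theorem append_w_inr (p : v.P) : (u.append v).w (u.inr v p) = v.w p := rfl
@[simp] theorem inl_lt_inl {p q : u.P} : u.inl v p < u.inl v q ↔ p < q :=
  Sum.Lex.inl_lt_inl_iff
@[simp] theorem inr_lt_inr {p q : v.P} : u.inr v p < u.inr v q ↔ p < q :=
  Sum.Lex.inr_lt_inr_iff
@[simp] theorem inl_lt_inr {p : u.P} {q : v.P} : u.inl v p < u.inr v q :=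
  Sum.Lex.inl_lt_inr _ _
@[simp] theorem not_inr_lt_inl {p : u.P} {q : v.P} : ¬ u.inr v q < u.inl v p :=
  Sum.Lex.not_inr_lt_inl

end append

theorem Iso.append {u u' v v' : GWord A} : Iso u u' → Iso v v' →
    Iso (u.append v) (u'.append v') := by
  rintro ⟨f, hf⟩ ⟨g, hg⟩
  refine ⟨OrderIso.sumLexCongr f g, fun p => ?_⟩
  induction p using append_cases with
  | hl p => exact hf p
  | hr p => exact hg p

theorem append_assoc (u v w : GWord A) :
    Iso ((u.append v).append w) (u.append (v.append w)) := by
  refine ⟨OrderIso.sumLexAssoc _ _ _, fun p => ?_⟩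
  induction p using append_cases with
  | hr p => rfl
  | hl p => induction p using append_cases <;> rfl

instance : IsEmpty (ofList ([] : List A)).P := inferInstanceAs (IsEmpty (Fin 0))

theorem append_empty (u v : GWord A) [IsEmpty v.P] : Iso (u.append v) u :=
  Iso.symm <| Iso.of_strictMono (u.inl v) (fun _ _ h => (inl_lt_inl u v).2 h)
    (fun q => by
      induction q using append_cases with
      | hl p => exact ⟨p, rfl⟩
      | hr p => exact isEmptyElim p) (fun _ => rfl)

theorem empty_append (u v : GWord A) [IsEmpty u.P] : Iso (u.append v) v :=
  Iso.symm <| Iso.of_strictMono (u.inr v) (fun _ _ h => (inr_lt_inr u v).2 h)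
    (fun q => by
      induction q using append_cases with
      | hr p => exact ⟨p, rfl⟩
      | hl p => exact isEmptyElim p) (fun _ => rfl)

/-- The reversal of a generalized word. -/
def rev (u : GWord A) : GWord A := ⟨u.Pᵒᵈ, inferInstance, fun p => u.w (OrderDual.ofDual p)⟩

theorem Iso.rev {u v : GWord A} : Iso u v → Iso u.rev v.rev := fun ⟨f, hf⟩ => ⟨f.dual, hf⟩

theorem rev_append (u v : GWord A) : Iso (u.append v).rev (v.rev.append u.rev) := by
  refine ⟨OrderIso.sumLexDualAntidistrib _ _, fun p => ?_⟩
  induction p using OrderDual.rec with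
  | toDual p => induction p using append_cases <;> rfl

theorem alph_iso {u v : GWord A} : Iso u v → u.alph = v.alph := by
  rintro ⟨f, hf⟩
  ext a
  constructor
  · rintro ⟨p, rfl⟩; exact ⟨f p, hf p⟩
  · rintro ⟨p, rfl⟩; exact ⟨f.symm p, by rw [← hf, f.apply_symm_apply]⟩

theorem restrict_iso {u v : GWord A} (f : u.P ≃o v.P) (hf : ∀ p, v.w (f p) = u.w p)
    (S : Set v.P) : Iso (u.restrict (f ⁻¹' S)) (v.restrict S) :=
  Iso.of_strictMono (fun p => ⟨f p.1, p.2⟩) (fun _ _ h => f.lt_iff_lt.2 h)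
    (fun q => ⟨⟨f.symm q.1, by simp [q.2]⟩, Subtype.ext (f.apply_symm_apply _)⟩)
    (fun p => hf p.1)

theorem restrict_append (u v : GWord A) (S : Set (u.append v).P) :
    Iso ((u.restrict (u.inl v ⁻¹' S)).append (v.restrict (u.inr v ⁻¹' S)))
      ((u.append v).restrict S) := by
  refine Iso.of_strictMono (fun p => Sum.elim
    (fun p => ⟨u.inl v p.1, p.2⟩) (fun p => ⟨u.inr v p.1, p.2⟩) (ofLex p)) ?_ ?_ ?_
  · intro p q
    induction p using append_cases <;> induction q using append_cases
    · rw [inl_lt_inl]; exact fun h => (inl_lt_inl u v).2 h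
    · exact fun _ => inl_lt_inr u v
    · exact fun h => absurd h (not_inr_lt_inl _ _)
    · rw [inr_lt_inr]; exact fun h => (inr_lt_inr u v).2 h
  · rintro ⟨p, hp⟩
    induction p using append_cases with
    | hl p => exact ⟨inl _ _ ⟨p, hp⟩, rfl⟩
    | hr p => exact ⟨inr _ _ ⟨p, hp⟩, rfl⟩
  · intro p
    induction p using append_cases <;> rfl

theorem restrict_univ (u : GWord A) {S : Set u.P} (hS : ∀ p, p ∈ S) : Iso (u.restrict S) u :=
  Iso.of_strictMono Subtype.val (fun _ _ h => h) (fun p => ⟨⟨p, hS p⟩, rfl⟩) (fun _ => rfl)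

theorem restrict_empty (u : GWord A) {S : Set u.P} (hS : ∀ p, p ∉ S) :
    Iso (u.restrict S) (ofList []) :=
  Iso.of_strictMono (fun p => (hS p.1 p.2).elim) (fun p => (hS p.1 p.2).elim)
    (fun q => isEmptyElim q) (fun p => (hS p.1 p.2).elim)

theorem ofList_cons (a : A) (l : List A) :
    Iso ((ofList [a]).append (ofList l)) (ofList (a :: l)) := by
  refine Iso.of_strictMono (fun p => Sum.elim
    (fun _ => (0 : Fin (l.length + 1))) (fun p : Fin l.length => p.succ) (ofLex p)) ?_ ?_ ?_
  · intro p q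
    induction p using append_cases with
    | hl p =>
      induction q using append_cases with
      | hl q =>
        rw [inl_lt_inl]
        intro h
        exact absurd h (by have : p = q := Subsingleton.elim (α := Fin 1) p q
                           simp [this])
      | hr q => exact fun _ => Fin.succ_pos (n := l.length) q
    | hr p =>
      induction q using append_cases with
      | hl q => exact fun h => absurd h (not_inr_lt_inl _ _)
      | hr q => rw [inr_lt_inr]; exact fun h => Fin.succ_lt_succ_iff.2 h
  · intro q
    obtain h | ⟨i, h⟩ := Fin.eq_zero_or_eq_succ (n := l.length) q
    · exact ⟨inl _ _ (0 : Fin 1), h.symm⟩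
    · exact ⟨inr _ _ i, h.symm⟩
  · intro p
    induction p using append_cases with
    | hl p => have : p = (0 : Fin 1) := Subsingleton.elim (α := Fin 1) _ _
              subst this; rfl
    | hr p => rfl

end GWord

/-- Generalized words up to isomorphism. -/
def GW (A : Type) : Type 1 := Quotient (GWord.isoSetoid A)

namespace GW

variable {A : Type}

/-- The isomorphism class of a generalized word. -/
def mk (u : GWord A) : GW A := Quotient.mk _ u

theorem mk_eq {u v : GWord A} : mk u = mk v ↔ GWord.Iso u v := Quotient.eq (r := GWord.isoSetoid A)

theorem ind {motive : GW A → Prop} (h : ∀ u, motive (mk u)) (u : GW A) : motive u :=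
  Quotient.ind h u

instance : Monoid (GW A) where
  mul := Quotient.map₂ GWord.append (fun _ _ h _ _ h' => GWord.Iso.append h h')
  one := mk (GWord.ofList [])
  mul_assoc := by
    intro u v w
    induction u using ind; induction v using ind; induction w using ind
    exact mk_eq.2 (GWord.append_assoc _ _ _)
  one_mul := by
    intro u
    induction u using ind
    exact mk_eq.2 (GWord.empty_append _ _)
  mul_one := by
    intro u
    induction u using ind
    exact mk_eq.2 (GWord.append_empty _ _)

/-- A letter as a generalized word. -/
def letter (a : A) : GW A := mk (GWord.ofList [a])

/-- The letters occurring in a generalized word. -/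
def al : GW A → Set A := Quotient.lift GWord.alph (fun _ _ h => GWord.alph_iso h)

@[simp] theorem al_mul (u v : GW A) : al (u * v) = al u ∪ al v := by
  induction u using ind with | h u => ?_
  induction v using ind with | h v => ?_
  ext a
  constructor
  · rintro ⟨p, rfl⟩
    induction p using GWord.append_cases with
    | hl p => exact Or.inl ⟨p, rfl⟩
    | hr p => exact Or.inr ⟨p, rfl⟩
  · rintro (⟨p, rfl⟩ | ⟨p, rfl⟩)
    · exact ⟨u.inl v p, rfl⟩
    · exact ⟨u.inr v p, rfl⟩

@[simp] theorem al_letter (a : A) : al (letter a) = {a} := by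
  ext b
  constructor
  · rintro ⟨p, rfl⟩; have : p = (0 : Fin 1) := Subsingleton.elim (α := Fin 1) _ _
    subst this; rfl
  · rintro rfl; exact ⟨(0 : Fin 1), rfl⟩

@[simp] theorem al_one : al (1 : GW A) = ∅ := by
  ext b
  simp only [Set.mem_empty_iff_false, iff_false]
  rintro ⟨p, rfl⟩
  exact isEmptyElim p

theorem mk_restrict_append (u v : GWord A) (S : Set (u.append v).P) :
    mk ((u.append v).restrict S) =
      mk (u.restrict (u.inl v ⁻¹' S)) * mk (v.restrict (u.inr v ⁻¹' S)) :=
  (mk_eq.2 (GWord.restrict_append u v S)).symm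

theorem mk_restrict_univ (u : GWord A) {S : Set u.P} (hS : ∀ p, p ∈ S) :
    mk (u.restrict S) = mk u := mk_eq.2 (u.restrict_univ hS)

theorem mk_restrict_empty (u : GWord A) {S : Set u.P} (hS : ∀ p, p ∉ S) :
    mk (u.restrict S) = 1 := mk_eq.2 (u.restrict_empty hS)

theorem mk_eq_split (u : GWord A) (p : u.P) :
    mk u = mk (u.restrict {q | q < p}) * letter (u.w p) * mk (u.restrict {q | p < q}) := by
  symm
  refine mk_eq.2 ?_
  refine GWord.Iso.of_strictMono (fun q => Sum.elim
    (fun q => Sum.elim (fun q => q.1) (fun _ => p) (ofLex q)) (fun q => q.1) (ofLex q)) ?_ ?_ ?_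
  · intro q r
    induction q using GWord.append_cases with
    | hl q =>
      induction q using GWord.append_cases with
      | hl q =>
        induction r using GWord.append_cases with
        | hl r =>
          induction r using GWord.append_cases with
          | hl r => rw [GWord.inl_lt_inl, GWord.inl_lt_inl]; exact fun h => h
          | hr r => exact fun _ => q.2
        | hr r => exact fun _ => lt_trans q.2 r.2
      | hr q =>
        induction r using GWord.append_cases with
        | hl r =>
          induction r using GWord.append_cases with
          | hl r =>
            rw [GWord.inl_lt_inl]; exact fun h => absurd h (GWord.not_inr_lt_inl _ _)
          | hr r =>
            rw [GWord.inl_lt_inl, GWord.inr_lt_inr, Subsingleton.elim (α := Fin 1) q r]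
            exact fun h => absurd h (lt_irrefl _)
        | hr r => exact fun _ => r.2
    | hr q =>
      induction r using GWord.append_cases with
      | hl r => exact fun h => absurd h (GWord.not_inr_lt_inl _ _)
      | hr r => rw [GWord.inr_lt_inr]; exact fun h => h
  · intro q
    rcases lt_trichotomy q p with h | h | h
    · exact ⟨GWord.inl _ _ (GWord.inl _ _ ⟨q, h⟩), rfl⟩
    · exact ⟨GWord.inl _ _ (GWord.inr _ _ (0 : Fin 1)), h.symm⟩
    · exact ⟨GWord.inr _ _ ⟨q, h⟩, rfl⟩
  · intro q
    induction q using GWord.append_cases with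
    | hl q =>
      induction q using GWord.append_cases with
      | hl q => rfl
      | hr q =>
        have : q = (0 : Fin 1) := Subsingleton.elim (α := Fin 1) _ _
        subst this; rfl
    | hr q => rfl

theorem exists_of_mk_eq {u : GWord A} {x y : GW A} {a : A} (h : mk u = x * letter a * y) :
    ∃ p, u.w p = a ∧ mk (u.restrict {q | q < p}) = x ∧ mk (u.restrict {q | p < q}) = y := by
  induction x using ind with | h x => ?_
  induction y using ind with | h y => ?_
  obtain ⟨f, hf⟩ : GWord.Iso u ((x.append (GWord.ofList [a])).append y) := mk_eq.1 h
  obtain ⟨z, hz, hza⟩ : ∃ z : (GWord.ofList [a]).P, (∀ q, q = z) ∧ (GWord.ofList [a]).w z = a :=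
    ⟨(0 : Fin 1), fun q => Subsingleton.elim (α := Fin 1) _ _, rfl⟩
  set c : ((x.append (GWord.ofList [a])).append y).P := GWord.inl _ _ (GWord.inr _ _ z) with hc
  refine ⟨f.symm c, by rw [← hf, f.apply_symm_apply]; exact hza, ?_, ?_⟩
  · have : {q | q < f.symm c} = f ⁻¹' {q | q < c} := by ext q; simp [f.lt_symm_apply]
    rw [this, mk_eq.2 (GWord.restrict_iso f hf _), mk_restrict_append, mk_restrict_append,
      mk_restrict_univ x, mk_restrict_empty (GWord.ofList [a]), mk_restrict_empty y, mul_one,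
      mul_one]
    · intro p; simp [hc]
    · intro p; simp [hc, hz p]
    · intro p; simp [hc]
  · have : {q | f.symm c < q} = f ⁻¹' {q | c < q} := by ext q; simp [f.symm_apply_lt]
    rw [this, mk_eq.2 (GWord.restrict_iso f hf _), mk_restrict_append, mk_restrict_append,
      mk_restrict_empty x, mk_restrict_empty (GWord.ofList [a]), mk_restrict_univ y, one_mul,
      one_mul]
    · intro p; simp [hc]
    · intro p; simp [hc, hz p]
    · intro p; simp [hc]

theorem mul_eq_split {u v x y : GW A} {a : A} (h : u * v = x * letter a * y) :
    (∃ y', u = x * letter a * y' ∧ y = y' * v) ∨ (∃ x', x = u * x' ∧ v = x' * letter a * y) := by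
  induction u using ind with | h u => ?_
  induction v using ind with | h v => ?_
  obtain ⟨p, rfl, rfl, rfl⟩ := exists_of_mk_eq (u := u.append v) h
  induction p using GWord.append_cases with
  | hl p =>
    refine Or.inl ⟨mk (u.restrict {q | p < q}), ?_, ?_⟩
    · rw [mk_restrict_append, mk_restrict_empty v, mul_one, GWord.append_w_inl]
      · rw [mk_eq_split u p]; simp [Set.preimage]
      · simp
    · rw [mk_restrict_append, mk_restrict_univ v]
      · simp [Set.preimage]
      · simp
  | hr p =>
    refine Or.inr ⟨mk (v.restrict {q | q < p}), ?_, ?_⟩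
    · rw [mk_restrict_append, mk_restrict_univ u]
      · simp [Set.preimage]
      · simp
    · rw [mk_restrict_append, mk_restrict_empty u, one_mul, GWord.append_w_inr]
      · rw [mk_eq_split v p]; simp [Set.preimage]
      · simp

theorem exists_split {u : GW A} {a : A} (h : a ∈ al u) : ∃ x y, u = x * letter a * y := by
  induction u using ind with | h u => ?_
  obtain ⟨p, rfl⟩ := h
  exact ⟨_, _, mk_eq_split u p⟩

/-- Reversal. -/
def rev : GW A → GW A := Quotient.map GWord.rev (fun _ _ h => GWord.Iso.rev h)

@[simp] theorem rev_mul (u v : GW A) : rev (u * v) = rev v * rev u := by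
  induction u using ind; induction v using ind
  exact mk_eq.2 (GWord.rev_append _ _)

@[simp] theorem rev_rev (u : GW A) : rev (rev u) = u := by
  induction u using ind; rfl

@[simp] theorem al_rev (u : GW A) : al (rev u) = al u := by
  induction u using ind; rfl

@[simp] theorem rev_one : rev (1 : GW A) = 1 := by
  have h := rev_mul (1 : GW A) (rev 1)
  rwa [one_mul, rev_rev, one_mul, eq_comm] at h

@[simp] theorem rev_letter (a : A) : rev (letter a) = letter a :=
  mk_eq.2 ⟨OrderIso.ofUnique (Fin 1)ᵒᵈ (Fin 1), fun p => by
    have : p = OrderDual.toDual (0 : Fin 1) := Subsingleton.elim (α := (Fin 1)ᵒᵈ) _ _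
    subst this; rfl⟩

/-- `u = x a y` where `a` is the first occurrence of this letter. -/
def FS (u : GW A) (a : A) (x y : GW A) : Prop := u = x * letter a * y ∧ a ∉ al x

/-- `u = x a y` where `a` is the last occurrence of this letter. -/
def LS (u : GW A) (a : A) (x y : GW A) : Prop := u = x * letter a * y ∧ a ∉ al y

theorem LS_iff_rev {u : GW A} {a : A} {x y : GW A} : LS u a x y ↔ FS (rev u) a (rev y) (rev x) := by
  unfold LS FS
  constructor
  · rintro ⟨rfl, h⟩; exact ⟨by simp [mul_assoc], by simpa⟩
  · rintro ⟨h, h'⟩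
    refine ⟨?_, by simpa using h'⟩
    rw [← rev_rev u, h]; simp [mul_assoc]

theorem FS_iff_rev {u : GW A} {a : A} {x y : GW A} : FS u a x y ↔ LS (rev u) a (rev y) (rev x) := by
  rw [LS_iff_rev]; simp

theorem isFirst_of_not_mem {u : GWord A} {a : A} {p : u.P} (hp : u.w p = a)
    (h : a ∉ al (mk (u.restrict {q | q < p}))) : u.IsFirst a p := by
  refine ⟨hp, fun q hq => ?_⟩
  by_contra hlt
  exact h ⟨⟨q, not_le.1 hlt⟩, hq⟩

theorem not_mem_of_isFirst {u : GWord A} {a : A} {p : u.P} (h : u.IsFirst a p) :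
    a ∉ al (mk (u.restrict {q | q < p})) := by
  rintro ⟨⟨q, hq⟩, hqa⟩
  exact absurd (h.2 q hqa) (not_le.2 hq)

theorem not_mem_of_isLast {u : GWord A} {a : A} {p : u.P} (h : u.IsLast a p) :
    a ∉ al (mk (u.restrict {q | p < q})) := by
  rintro ⟨⟨q, hq⟩, hqa⟩
  exact absurd (h.2 q hqa) (not_le.2 hq)

theorem FS.unique {u : GW A} {a : A} {x y x' y' : GW A} (h : FS u a x y) (h' : FS u a x' y') :
    x = x' ∧ y = y' := by
  induction u using ind with | h u => ?_
  obtain ⟨h, ha⟩ := h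
  obtain ⟨h', ha'⟩ := h'
  obtain ⟨p, hp, rfl, rfl⟩ := exists_of_mk_eq h
  obtain ⟨p', hp', rfl, rfl⟩ := exists_of_mk_eq h'
  have := isFirst_of_not_mem hp ha
  have := isFirst_of_not_mem hp' ha'
  have : p = p' := le_antisymm (by grind [GWord.IsFirst]) (by grind [GWord.IsFirst])
  subst this; simp

theorem LS.unique {u : GW A} {a : A} {x y x' y' : GW A} (h : LS u a x y) (h' : LS u a x' y') :
    x = x' ∧ y = y' := by
  rw [LS_iff_rev] at h h'
  obtain ⟨h1, h2⟩ := h.unique h'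
  exact ⟨by simpa using congrArg rev h2, by simpa using congrArg rev h1⟩

theorem FS.mem {u : GW A} {a : A} {x y : GW A} (h : FS u a x y) : a ∈ al u := by
  rw [h.1]; simp

theorem LS.mem {u : GW A} {a : A} {x y : GW A} (h : LS u a x y) : a ∈ al u := by
  rw [h.1]; simp

theorem FS.of_mul_left {u v x y : GW A} {a : A} (h : FS (u * v) a x y) (ha : a ∈ al u) :
    ∃ y', FS u a x y' ∧ y = y' * v := by
  obtain ⟨y', h1, h2⟩ | ⟨x', h1, h2⟩ := mul_eq_split h.1
  · exact ⟨y', ⟨h1, h.2⟩, h2⟩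
  · exact absurd h.2 (by simp [h1, ha])

theorem FS.of_mul_right {u v x y : GW A} {a : A} (h : FS (u * v) a x y) (ha : a ∉ al u) :
    ∃ x', FS v a x' y ∧ x = u * x' := by
  obtain ⟨y', h1, h2⟩ | ⟨x', h1, h2⟩ := mul_eq_split h.1
  · exact absurd ha (by simp [h1])
  · exact ⟨x', ⟨h2, fun h' => h.2 (by simp [h1, h'])⟩, h1⟩

theorem LS.of_mul_right {u v x y : GW A} {a : A} (h : LS (u * v) a x y) (ha : a ∈ al v) :
    ∃ x', LS v a x' y ∧ x = u * x' := by
  obtain ⟨y', h1, h2⟩ | ⟨x', h1, h2⟩ := mul_eq_split h.1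
  · exact absurd h.2 (by simp [h2, ha])
  · exact ⟨x', ⟨h2, h.2⟩, h1⟩

theorem LS.of_mul_left {u v x y : GW A} {a : A} (h : LS (u * v) a x y) (ha : a ∉ al v) :
    ∃ y', LS u a x y' ∧ y = y' * v := by
  obtain ⟨y', h1, h2⟩ | ⟨x', h1, h2⟩ := mul_eq_split h.1
  · exact ⟨y', ⟨h1, fun h' => h.2 (by simp [h2, h'])⟩, h2⟩
  · exact absurd ha (by simp [h2])

/-- `a b` is a (scattered) subword. -/
def Sub2 (u : GW A) (a b : A) : Prop := ∃ x y, u = x * letter a * y ∧ b ∈ al y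

theorem Sub2_mul {u v : GW A} {a b : A} :
    Sub2 (u * v) a b ↔ Sub2 u a b ∨ Sub2 v a b ∨ (a ∈ al u ∧ b ∈ al v) := by
  constructor
  · rintro ⟨x, y, h, hb⟩
    obtain ⟨y', h1, rfl⟩ | ⟨x', rfl, h2⟩ := mul_eq_split h
    · rw [al_mul] at hb
      rcases hb with hb | hb
      · exact Or.inl ⟨x, y', h1, hb⟩
      · exact Or.inr (Or.inr ⟨by simp [h1], hb⟩)
    · exact Or.inr (Or.inl ⟨x', y, h2, hb⟩)
  · rintro (⟨x, y, rfl, hb⟩ | ⟨x, y, rfl, hb⟩ | ⟨ha, hb⟩)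
    · exact ⟨x, y * v, by rw [mul_assoc], by simp [hb]⟩
    · exact ⟨u * x, y, by simp only [mul_assoc], hb⟩
    · obtain ⟨x, y, rfl⟩ := exists_split ha
      exact ⟨x, y * v, by rw [mul_assoc], by simp [hb]⟩

@[simp] theorem not_Sub2_letter {a b c : A} : ¬ Sub2 (letter c) a b := by
  rintro ⟨x, y, h, hb⟩
  obtain ⟨z, w, rfl⟩ := exists_split hb
  obtain ⟨p, -, -, h2⟩ := exists_of_mk_eq (u := GWord.ofList [c]) h
  obtain ⟨⟨q, hq⟩, -⟩ : b ∈ al (mk ((GWord.ofList [c]).restrict {q | p < q})) := by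
    rw [h2]; exact hb
  rw [Set.mem_ofPred_eq, Subsingleton.elim (α := Fin 1) p q] at hq
  exact absurd hq (lt_irrefl _)

theorem Sub2_rev {u : GW A} {a b : A} : Sub2 (rev u) a b ↔ Sub2 u b a := by
  have key : ∀ {u : GW A} {a b : A}, Sub2 u b a → Sub2 (rev u) a b := by
    rintro u a b ⟨x, y, rfl, h⟩
    obtain ⟨z, w, rfl⟩ := exists_split h
    exact ⟨rev w, rev z * letter b * rev x, by simp [mul_assoc], by simp⟩
  exact ⟨fun h => by simpa using key h, key⟩

theorem FS.Sub2_iff {u : GW A} {a b : A} {x y : GW A} (h : FS u a x y) : Sub2 u a b ↔ b ∈ al y := by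
  refine ⟨?_, fun hb => ⟨x, y, h.1, hb⟩⟩
  rintro ⟨x', y', h', hb⟩
  rw [h.1] at h'
  obtain ⟨z, h1, rfl⟩ | ⟨z, rfl, h2⟩ := mul_eq_split h'
  · obtain ⟨w, h3, rfl⟩ | ⟨w, rfl, h4⟩ := mul_eq_split h1
    · exact absurd h.2 (by simp [h3])
    · rw [al_mul] at hb
      rcases hb with hb | hb
      · exact absurd (show Sub2 (letter a) a b from ⟨w, z, h4, hb⟩) not_Sub2_letter
      · exact hb
  · rw [h2]; simp [hb]

/-- `c` is the factor strictly between the last `b` and the first `a`. -/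
def CS (u : GW A) (a b : A) (c : GW A) : Prop :=
  ∃ x y, FS u a (x * letter b * c) y ∧ LS u b x (c * letter a * y)

theorem CS.unique {u : GW A} {a b : A} {c c' : GW A} (h : CS u a b c) (h' : CS u a b c') :
    c = c' := by
  obtain ⟨x, y, h1, h2⟩ := h
  obtain ⟨x', y', h1', h2'⟩ := h'
  have h3 := (h1.unique h1').1
  have hb : b ∉ al c := fun hb => h2.2 (by simp [hb])
  have hb' : b ∉ al c' := fun hb => h2'.2 (by simp [hb])
  exact (LS.unique ⟨rfl, hb⟩ ⟨h3, hb'⟩).2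

theorem CS_rev {u : GW A} {a b : A} {c : GW A} : CS (rev u) b a (rev c) ↔ CS u a b c := by
  have key : ∀ {u : GW A} {a b : A} {c : GW A}, CS u a b c → CS (rev u) b a (rev c) := by
    rintro u a b c ⟨x, y, h1, h2⟩
    rw [FS_iff_rev] at h1
    rw [LS_iff_rev] at h2
    exact ⟨rev y, rev x, by simpa [mul_assoc] using h2, by simpa [mul_assoc] using h1⟩
  exact ⟨fun h => by simpa using key h, key⟩

end GW

/-- Left-right duality on the kinds of relations. -/
def ZK.dual : ZK → ZK
  | .X => .Y
  | .Y => .X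
  | .WI => .WI

@[simp] theorem ZK.dual_X : ZK.X.dual = ZK.Y := rfl

@[simp] theorem ZK.dual_Y : ZK.Y.dual = ZK.X := rfl

@[simp] theorem ZK.dual_WI : ZK.WI.dual = ZK.WI := rfl

namespace GW

variable {A : Type}

/-- The relations `eqvAux`, phrased through factorizations at first and last occurrences. -/
def E : ℕ → ZK → ℕ → GW A → GW A → Prop
  | 0, _, _, _, _ => True
  | _ + 1, _, 0, _, _ => True
  | n + 1, ZK.X, m + 1, u, v =>
      al u = al v ∧ E n ZK.Y m u v ∧
      ∀ a x y x' y', FS u a x y → FS v a x' y' → E n ZK.Y m x x' ∧ E n ZK.X (m + 1) y y'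
  | n + 1, ZK.Y, m + 1, u, v =>
      al u = al v ∧ E n ZK.X m u v ∧
      ∀ a x y x' y', LS u a x y → LS v a x' y' → E n ZK.Y (m + 1) x x' ∧ E n ZK.X m y y'
  | n + 1, ZK.WI, m + 1, u, v =>
      al u = al v ∧
      (∀ a x y x' y', FS u a x y → FS v a x' y' → E n ZK.WI m x x' ∧ E n ZK.WI (m + 1) y y') ∧
      (∀ a x y x' y', LS u a x y → LS v a x' y' → E n ZK.WI (m + 1) x x' ∧ E n ZK.WI m y y') ∧
      (∀ a b, a ≠ b → (Sub2 u a b ↔ Sub2 v a b)) ∧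
      ∀ a b c c', CS u a b c → CS v a b c' → E n ZK.WI m c c'

@[simp] theorem E_zero {k : ZK} {m : ℕ} {u v : GW A} : E 0 k m u v := by simp [E]

@[simp] theorem E_zero' {k : ZK} {n : ℕ} {u v : GW A} : E n k 0 u v := by cases n <;> simp [E]

theorem E_X_iff {n m : ℕ} {u v : GW A} : E (n + 1) ZK.X (m + 1) u v ↔
    al u = al v ∧ E n ZK.Y m u v ∧
      ∀ a x y x' y', FS u a x y → FS v a x' y' →
        E n ZK.Y m x x' ∧ E n ZK.X (m + 1) y y' := Iff.rfl

theorem E_WI_iff {n m : ℕ} {u v : GW A} : E (n + 1) ZK.WI (m + 1) u v ↔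
    al u = al v ∧
      (∀ a x y x' y', FS u a x y → FS v a x' y' → E n ZK.WI m x x' ∧ E n ZK.WI (m + 1) y y') ∧
      (∀ a x y x' y', LS u a x y → LS v a x' y' → E n ZK.WI (m + 1) x x' ∧ E n ZK.WI m y y') ∧
      (∀ a b, a ≠ b → (Sub2 u a b ↔ Sub2 v a b)) ∧
      ∀ a b c c', CS u a b c → CS v a b c' → E n ZK.WI m c c' := Iff.rfl

theorem E.rev {n : ℕ} {k : ZK} {m : ℕ} {u v : GW A} (h : E n k m u v) :
    E n k.dual m (rev u) (rev v) := by
  induction n generalizing k m u v with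
  | zero => simp
  | succ n ih =>
    rcases m with _ | m
    · simp
    cases k with
    | X =>
      refine ⟨by simpa using h.1, ih h.2.1, fun a x y x' y' h1 h2 => ?_⟩
      rw [LS_iff_rev, rev_rev] at h1 h2
      obtain ⟨h3, h4⟩ := h.2.2 _ _ _ _ _ h1 h2
      exact ⟨by simpa using ih h4, by simpa using ih h3⟩
    | Y =>
      refine ⟨by simpa using h.1, ih h.2.1, fun a x y x' y' h1 h2 => ?_⟩
      rw [FS_iff_rev, rev_rev] at h1 h2
      obtain ⟨h3, h4⟩ := h.2.2 _ _ _ _ _ h1 h2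
      exact ⟨by simpa using ih h4, by simpa using ih h3⟩
    | WI =>
      refine ⟨by simpa using h.1, fun a x y x' y' h1 h2 => ?_, fun a x y x' y' h1 h2 => ?_,
        fun a b hab => ?_, fun a b c c' h1 h2 => ?_⟩
      · rw [FS_iff_rev, rev_rev] at h1 h2
        obtain ⟨h3, h4⟩ := h.2.2.1 _ _ _ _ _ h1 h2
        exact ⟨by simpa using ih h4, by simpa using ih h3⟩
      · rw [LS_iff_rev, rev_rev] at h1 h2
        obtain ⟨h3, h4⟩ := h.2.1 _ _ _ _ _ h1 h2
        exact ⟨by simpa using ih h4, by simpa using ih h3⟩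
      · rw [Sub2_rev, Sub2_rev]; exact h.2.2.2.1 b a hab.symm
      · rw [← CS_rev, rev_rev] at h1 h2
        simpa using ih (h.2.2.2.2 _ _ _ _ h1 h2)

theorem E_rev_iff {n : ℕ} {k : ZK} {m : ℕ} {u v : GW A} :
    E n k m (rev u) (rev v) ↔ E n k.dual m u v :=
  ⟨fun h => by simpa using h.rev, fun h => by cases k <;> simpa using h.rev⟩

theorem E.mono {n : ℕ} {k : ZK} {m : ℕ} {u v : GW A} (h : E (n + 1) k m u v) : E n k m u v := by
  induction n generalizing k m u v with
  | zero => simp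
  | succ n ih =>
    rcases m with _ | m
    · simp
    cases k with
    | X =>
      exact ⟨h.1, ih h.2.1, fun a x y x' y' h1 h2 =>
        ⟨ih (h.2.2 _ _ _ _ _ h1 h2).1, ih (h.2.2 _ _ _ _ _ h1 h2).2⟩⟩
    | Y =>
      exact ⟨h.1, ih h.2.1, fun a x y x' y' h1 h2 =>
        ⟨ih (h.2.2 _ _ _ _ _ h1 h2).1, ih (h.2.2 _ _ _ _ _ h1 h2).2⟩⟩
    | WI =>
      exact ⟨h.1, fun a x y x' y' h1 h2 =>
        ⟨ih (h.2.1 _ _ _ _ _ h1 h2).1, ih (h.2.1 _ _ _ _ _ h1 h2).2⟩,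
        fun a x y x' y' h1 h2 =>
        ⟨ih (h.2.2.1 _ _ _ _ _ h1 h2).1, ih (h.2.2.1 _ _ _ _ _ h1 h2).2⟩,
        h.2.2.2.1, fun a b c c' h1 h2 => ih (h.2.2.2.2 _ _ _ _ h1 h2)⟩

theorem E.mono_le {n n' : ℕ} {k : ZK} {m : ℕ} {u v : GW A} (h : E n' k m u v) (hn : n ≤ n') :
    E n k m u v := by
  induction hn with
  | refl => exact h
  | step _ ih => exact ih h.mono

theorem E.pred {n m : ℕ} {u v : GW A} (h : E n ZK.WI (m + 1) u v) : E n ZK.WI m u v := by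
  induction n generalizing m u v with
  | zero => simp
  | succ n ih =>
    rcases m with _ | m
    · simp
    · exact ⟨h.1, fun a x y x' y' h1 h2 =>
        ⟨ih (h.2.1 _ _ _ _ _ h1 h2).1, ih (h.2.1 _ _ _ _ _ h1 h2).2⟩,
        fun a x y x' y' h1 h2 =>
        ⟨ih (h.2.2.1 _ _ _ _ _ h1 h2).1, ih (h.2.2.1 _ _ _ _ _ h1 h2).2⟩,
        h.2.2.2.1, fun a b c c' h1 h2 => ih (h.2.2.2.2 _ _ _ _ h1 h2)⟩

theorem E.refl (n : ℕ) (k : ZK) (m : ℕ) (u : GW A) : E n k m u u := by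
  induction n generalizing k m u with
  | zero => simp
  | succ n ih =>
    have key : ∀ {k k' m m'} {x y x' y' : GW A}, x = x' ∧ y = y' → E n k m x x' ∧ E n k' m' y y' := by
      rintro _ _ _ _ _ _ _ _ ⟨rfl, rfl⟩; exact ⟨ih _ _ _, ih _ _ _⟩
    rcases m with _ | m
    · simp
    cases k with
    | X => exact ⟨rfl, ih _ _ _, fun a x y x' y' h1 h2 => key (h1.unique h2)⟩
    | Y => exact ⟨rfl, ih _ _ _, fun a x y x' y' h1 h2 => key (h1.unique h2)⟩
    | WI =>
      exact ⟨rfl, fun a x y x' y' h1 h2 => key (h1.unique h2),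
        fun a x y x' y' h1 h2 => key (h1.unique h2), fun _ _ _ => Iff.rfl,
        fun a b c c' h1 h2 => h1.unique h2 ▸ ih _ _ _⟩

theorem CS.of_mul {u v : GW A} {a b : A} {c : GW A} (h : CS (u * v) a b c) :
    (a ∈ al u ∧ b ∉ al v ∧ CS u a b c) ∨ (a ∉ al u ∧ b ∈ al v ∧ CS v a b c) ∨
      (a ∉ al u ∧ b ∉ al v ∧ ∃ x c₀ p y, c = c₀ * p ∧ LS u b x c₀ ∧ FS v a p y) := by
  obtain ⟨x, y, h1, h2⟩ := h
  have hbc : b ∉ al (c * letter a * y) := h2.2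
  by_cases ha : a ∈ al u
  · obtain ⟨y', h3, rfl⟩ := h1.of_mul_left ha
    have hb : b ∉ al v := fun hb => hbc (by simp [hb])
    refine Or.inl ⟨ha, hb, x, y', h3, ⟨by rw [h3.1]; simp only [mul_assoc], ?_⟩⟩
    intro hb; apply hbc
    simp only [al_mul, Set.mem_union] at hb ⊢; tauto
  · obtain ⟨p, h3, h4⟩ := h1.of_mul_right ha
    have hbc' : b ∉ al c := fun hb => hbc (by simp [hb])
    have h5 : LS (u * p) b x c := ⟨h4.symm, hbc'⟩
    by_cases hb : b ∈ al v
    · have hbp : b ∈ al p := by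
        rw [h3.1] at hb
        simp only [al_mul, Set.mem_union] at hb hbc; tauto
      obtain ⟨x', h6, h7⟩ := h5.of_mul_right hbp
      refine Or.inr (Or.inl ⟨ha, hb, x', y, ?_, ?_, hbc⟩)
      · rw [← h6.1]; exact h3
      · rw [h3.1, h6.1]; simp only [mul_assoc]
    · have hbp : b ∉ al p := fun h => hb (by simp [h3.1, h])
      obtain ⟨c₀, h6, h7⟩ := h5.of_mul_left hbp
      exact Or.inr (Or.inr ⟨ha, hb, x, c₀, p, y, h7, h6, h3⟩)

theorem E.mul {n : ℕ} {k : ZK} {m : ℕ} {u u' v v' : GW A} (hu : E n k m u u')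
    (hv : E n k m v v') : E n k m (u * v) (u' * v') := by
  induction n generalizing k m u u' v v' with
  | zero => simp
  | succ n ih =>
    rcases m with _ | m
    · simp
    have hX : ∀ {u u' v v' : GW A}, E (n + 1) ZK.X (m + 1) u u' → E (n + 1) ZK.X (m + 1) v v' →
        E (n + 1) ZK.X (m + 1) (u * v) (u' * v') := by
      intro u u' v v' hu hv
      refine ⟨by simp [hu.1, hv.1], ih hu.2.1 hv.2.1, fun a x y x' y' h1 h2 => ?_⟩
      by_cases ha : a ∈ al u
      · obtain ⟨y, h3, rfl⟩ := h1.of_mul_left ha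
        obtain ⟨y', h4, rfl⟩ := h2.of_mul_left (hu.1 ▸ ha)
        obtain ⟨h5, h6⟩ := hu.2.2 _ _ _ _ _ h3 h4
        exact ⟨h5, ih h6 hv.mono⟩
      · obtain ⟨x, h3, rfl⟩ := h1.of_mul_right ha
        obtain ⟨x', h4, rfl⟩ := h2.of_mul_right (hu.1 ▸ ha)
        obtain ⟨h5, h6⟩ := hv.2.2 _ _ _ _ _ h3 h4
        exact ⟨ih hu.2.1 h5, h6⟩
    cases k with
    | X => exact hX hu hv
    | Y => simpa using (hX hv.rev hu.rev).rev
    | WI =>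
      refine ⟨by simp [hu.1, hv.1], fun a x y x' y' h1 h2 => ?_, fun a x y x' y' h1 h2 => ?_,
        fun a b hab => ?_, fun a b c c' h1 h2 => ?_⟩
      · by_cases ha : a ∈ al u
        · obtain ⟨y, h3, rfl⟩ := h1.of_mul_left ha
          obtain ⟨y', h4, rfl⟩ := h2.of_mul_left (hu.1 ▸ ha)
          obtain ⟨h5, h6⟩ := hu.2.1 _ _ _ _ _ h3 h4
          exact ⟨h5, ih h6 hv.mono⟩
        · obtain ⟨x, h3, rfl⟩ := h1.of_mul_right ha
          obtain ⟨x', h4, rfl⟩ := h2.of_mul_right (hu.1 ▸ ha)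
          obtain ⟨h5, h6⟩ := hv.2.1 _ _ _ _ _ h3 h4
          exact ⟨ih hu.mono.pred h5, h6⟩
      · by_cases ha : a ∈ al v
        · obtain ⟨y, h3, rfl⟩ := h1.of_mul_right ha
          obtain ⟨y', h4, rfl⟩ := h2.of_mul_right (hv.1 ▸ ha)
          obtain ⟨h5, h6⟩ := hv.2.2.1 _ _ _ _ _ h3 h4
          exact ⟨ih hu.mono h5, h6⟩
        · obtain ⟨x, h3, rfl⟩ := h1.of_mul_left ha
          obtain ⟨x', h4, rfl⟩ := h2.of_mul_left (hv.1 ▸ ha)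
          obtain ⟨h5, h6⟩ := hu.2.2.1 _ _ _ _ _ h3 h4
          exact ⟨h5, ih h6 hv.mono.pred⟩
      · rw [Sub2_mul, Sub2_mul, hu.2.2.2.1 a b hab, hv.2.2.2.1 a b hab, hu.1, hv.1]
      · have hu1 := hu.1
        have hv1 := hv.1
        obtain ⟨ha, hb, h3⟩ | ⟨ha, hb, h3⟩ | ⟨ha, hb, x, c, p, y, rfl, h3, h4⟩ := h1.of_mul <;>
        obtain ⟨ha', hb', h3'⟩ | ⟨ha', hb', h3'⟩ | ⟨ha', hb', x', c', p', y', rfl, h3', h4'⟩ :=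
          h2.of_mul <;> first | (exfalso; rw [hu1] at ha; rw [hv1] at hb; tauto) | skip
        · exact hu.2.2.2.2 _ _ _ _ h3 h3'
        · exact hv.2.2.2.2 _ _ _ _ h3 h3'
        · exact ih (hu.2.2.1 _ _ _ _ _ h3 h3').2 (hv.2.1 _ _ _ _ _ h4 h4').1

end GW

namespace GWord

variable {A : Type}

theorem Accessible.next {u : GWord A} (hu : u.Accessible) (lo : Option u.P) (a : A)
    (h : ∃ q, (∀ l ∈ lo, l < q) ∧ u.w q = a) :
    ∃ q, (∀ l ∈ lo, l < q) ∧ u.w q = a ∧ ∀ r, (∀ l ∈ lo, l < r) → u.w r = a → q ≤ r := by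
  cases lo with
  | none =>
    obtain ⟨q, -, h⟩ := h
    obtain ⟨p, hp, hp'⟩ := hu.1 a ⟨q, h⟩
    exact ⟨p, by simp, hp, fun r _ => hp' r⟩
  | some l =>
    obtain ⟨q, h⟩ := h
    obtain ⟨p, hp, hp', hp''⟩ := hu.2.2.1 l a ⟨q, by simpa using h⟩
    exact ⟨p, by simpa using hp, hp', fun r hr => hp'' r (by simpa using hr)⟩

theorem Accessible.prev {u : GWord A} (hu : u.Accessible) (hi : Option u.P) (a : A)
    (h : ∃ q, (∀ l ∈ hi, q < l) ∧ u.w q = a) :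
    ∃ q, (∀ l ∈ hi, q < l) ∧ u.w q = a ∧ ∀ r, (∀ l ∈ hi, r < l) → u.w r = a → r ≤ q := by
  cases hi with
  | none =>
    obtain ⟨q, -, h⟩ := h
    obtain ⟨p, hp, hp'⟩ := hu.2.1 a ⟨q, h⟩
    exact ⟨p, by simp, hp, fun r _ => hp' r⟩
  | some l =>
    obtain ⟨q, h⟩ := h
    obtain ⟨p, hp, hp', hp''⟩ := hu.2.2.2 l a ⟨q, by simpa using h⟩
    exact ⟨p, by simpa using hp, hp', fun r hr => hp'' r (by simpa using hr)⟩

theorem Accessible.restrict {u : GWord A} (hu : u.Accessible) {S : Set u.P}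
    (lo hi : Option u.P) (hS : ∀ r, r ∈ S ↔ (∀ l ∈ lo, l < r) ∧ ∀ l ∈ hi, r < l) :
    (u.restrict S).Accessible := by
  refine ⟨?_, ?_, ?_, ?_⟩
  · rintro a ⟨⟨p, hp⟩, h⟩
    obtain ⟨q, h1, h2, h3⟩ := hu.next lo a ⟨p, ((hS p).1 hp).1, h⟩
    have hq : q ∈ S := (hS q).2 ⟨h1, fun l hl =>
      lt_of_le_of_lt (h3 p ((hS p).1 hp).1 h) (((hS p).1 hp).2 l hl)⟩
    exact ⟨⟨q, hq⟩, h2, fun r hr => h3 r.1 ((hS _).1 r.2).1 hr⟩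
  · rintro a ⟨⟨p, hp⟩, h⟩
    obtain ⟨q, h1, h2, h3⟩ := hu.prev hi a ⟨p, ((hS p).1 hp).2, h⟩
    have hq : q ∈ S := (hS q).2 ⟨fun l hl =>
      lt_of_lt_of_le (((hS p).1 hp).1 l hl) (h3 p ((hS p).1 hp).2 h), h1⟩
    exact ⟨⟨q, hq⟩, h2, fun r hr => h3 r.1 ((hS _).1 r.2).2 hr⟩
  · rintro ⟨p, hp⟩ a ⟨⟨q, hq⟩, hpq, h⟩
    obtain ⟨s, h1, h2, h3⟩ := hu.2.2.1 p a ⟨q, hpq, h⟩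
    have hs : s ∈ S := (hS s).2 ⟨fun l hl => lt_trans (((hS p).1 hp).1 l hl) h1, fun l hl =>
      lt_of_le_of_lt (h3 q hpq h) (((hS q).1 hq).2 l hl)⟩
    exact ⟨⟨s, hs⟩, h1, h2, fun r hr => h3 r.1 hr⟩
  · rintro ⟨p, hp⟩ a ⟨⟨q, hq⟩, hpq, h⟩
    obtain ⟨s, h1, h2, h3⟩ := hu.2.2.2 p a ⟨q, hpq, h⟩
    have hs : s ∈ S := (hS s).2 ⟨fun l hl =>
      lt_of_lt_of_le (((hS q).1 hq).1 l hl) (h3 q hpq h),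
      fun l hl => lt_trans h1 (((hS p).1 hp).2 l hl)⟩
    exact ⟨⟨s, hs⟩, h1, h2, fun r hr => h3 r.1 hr⟩

theorem Accessible.Iio {u : GWord A} (hu : u.Accessible) (p : u.P) :
    (u.restrict {q | q < p}).Accessible :=
  hu.restrict none (some p) (by simp)

theorem Accessible.Ioi {u : GWord A} (hu : u.Accessible) (p : u.P) :
    (u.restrict {q | p < q}).Accessible :=
  hu.restrict (some p) none (by simp)

theorem Accessible.XL {u : GWord A} (hu : u.Accessible) (a : A) : (u.XL a).Accessible := by
  unfold GWord.XL; split_ifs <;> [exact hu.Iio _; exact hu]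

theorem Accessible.XR {u : GWord A} (hu : u.Accessible) (a : A) : (u.XR a).Accessible := by
  unfold GWord.XR; split_ifs <;> [exact hu.Ioi _; exact hu]

theorem Accessible.YL {u : GWord A} (hu : u.Accessible) (a : A) : (u.YL a).Accessible := by
  unfold GWord.YL; split_ifs <;> [exact hu.Iio _; exact hu]

theorem Accessible.YR {u : GWord A} (hu : u.Accessible) (a : A) : (u.YR a).Accessible := by
  unfold GWord.YR; split_ifs <;> [exact hu.Ioi _; exact hu]

theorem Accessible.Cab {u : GWord A} (hu : u.Accessible) (a b : A) : (u.Cab a b).Accessible := by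
  unfold GWord.Cab
  split_ifs with h
  · exact hu.restrict (some h.choose_spec.choose) (some h.choose) (by simp)
  · exact hu

theorem Accessible.FS {u : GWord A} (hu : u.Accessible) {a : A} (ha : a ∈ u.alph) :
    GW.FS (GW.mk u) a (GW.mk (u.XL a)) (GW.mk (u.XR a)) := by
  have h := hu.1 a ha
  rw [GWord.XL, GWord.XR, dif_pos h, dif_pos h]
  refine ⟨?_, GW.not_mem_of_isFirst h.choose_spec⟩
  conv_lhs => rw [GW.mk_eq_split u h.choose, h.choose_spec.1]

theorem Accessible.LS {u : GWord A} (hu : u.Accessible) {a : A} (ha : a ∈ u.alph) :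
    GW.LS (GW.mk u) a (GW.mk (u.YL a)) (GW.mk (u.YR a)) := by
  have h := hu.2.1 a ha
  rw [GWord.YL, GWord.YR, dif_pos h, dif_pos h]
  refine ⟨?_, GW.not_mem_of_isLast h.choose_spec⟩
  conv_lhs => rw [GW.mk_eq_split u h.choose, h.choose_spec.1]

theorem restrict_restrict (u : GWord A) (S : Set u.P) (T : Set (u.restrict S).P) (R : Set u.P)
    (hR : ∀ p, p ∈ R ↔ ∃ h : p ∈ S, (⟨p, h⟩ : (u.restrict S).P) ∈ T) :
    Iso ((u.restrict S).restrict T) (u.restrict R) :=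
  Iso.of_strictMono (fun p => ⟨p.1.1, (hR _).2 ⟨p.1.2, p.2⟩⟩) (fun _ _ h => h)
    (fun q => ⟨⟨⟨q.1, ((hR _).1 q.2).1⟩, ((hR _).1 q.2).2⟩, rfl⟩) (fun _ => rfl)

theorem CDefined.CS {u : GWord A} {a b : A} (h : u.CDefined a b) :
    GW.CS (GW.mk u) a b (GW.mk (u.Cab a b)) := by
  rw [Cab, dif_pos h]
  obtain ⟨hp, hq, hlt⟩ := h.choose_spec.choose_spec
  generalize h.choose_spec.choose = q at *
  generalize h.choose = p at *
  have hR := GW.mk_eq.2 (restrict_restrict u {r | r < p} {r | (⟨q, hlt⟩ : {r // r < p}) < r}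
    {r | q < r ∧ r < p} fun r => ⟨fun ⟨h1, h2⟩ => ⟨h2, h1⟩, fun ⟨h1, h2⟩ => ⟨h2, h1⟩⟩)
  have hs : GW.mk (u.restrict {r | r < p}) = _ * GW.letter b * GW.mk (u.restrict _) :=
    (GW.mk_eq_split (u.restrict {r | r < p}) ⟨q, hlt⟩).trans
      (congrArg₂ (· * ·) (congrArg (fun c => _ * GW.letter c) hq.1) hR)
  have hs' := GW.mk_eq_split u p
  rw [hp.1, hs] at hs'
  refine ⟨_, _, ⟨hs', ?_⟩, ⟨by rw [hs']; simp only [mul_assoc], ?_⟩⟩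
  · rw [← hs]; exact GW.not_mem_of_isFirst hp
  · have hab : a ≠ b := by
      rintro rfl
      exact absurd (hp.2 q hq.1) (not_le.2 hlt)
    simp only [GW.al_mul, GW.al_letter, Set.mem_union, Set.mem_singleton_iff, hab.symm,
      or_false]
    rintro (⟨⟨r, hr, _⟩, hr'⟩ | ⟨⟨r, hr⟩, hr'⟩)
    · exact absurd (hq.2 r hr') (not_le.2 hr)
    · exact absurd (hq.2 r hr') (not_le.2 (lt_trans hlt hr))

theorem Accessible.CDefined_iff {u : GWord A} (hu : u.Accessible) {a b : A} (ha : a ∈ u.alph)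
    (hb : b ∈ u.alph) : u.CDefined a b ↔ a ≠ b ∧ ¬ GW.Sub2 (GW.mk u) a b := by
  have key : ∀ p, u.IsFirst a p →
      (GW.Sub2 (GW.mk u) a b ↔ b ∈ GW.al (GW.mk (u.restrict {q | p < q}))) := fun p hp =>
    GW.FS.Sub2_iff ⟨hp.1 ▸ GW.mk_eq_split u p, GW.not_mem_of_isFirst hp⟩
  constructor
  · rintro ⟨p, q, hp, hq, hlt⟩
    refine ⟨?_, ?_⟩
    · rintro rfl
      exact absurd (hp.2 q hq.1) (not_le.2 hlt)
    · rw [key p hp]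
      rintro ⟨⟨r, hr⟩, hr'⟩
      exact absurd (hq.2 r hr') (not_le.2 (lt_trans hlt hr))
  · rintro ⟨hab, h⟩
    obtain ⟨p, hp⟩ := hu.1 a ha
    obtain ⟨q, hq⟩ := hu.2.1 b hb
    refine ⟨p, q, hp, hq, ?_⟩
    rw [key p hp] at h
    rcases lt_trichotomy q p with h' | h' | h'
    · exact h'
    · exact absurd (hp.1.symm.trans (h' ▸ hq.1)) hab
    · exact absurd ⟨⟨q, h'⟩, hq.1⟩ h

end GWord

namespace GW

variable {A : Type}

theorem FS.forall_iff {u v x₀ y₀ x₀' y₀' : GW A} {a : A} {p : GW A → GW A → GW A → GW A → Prop}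
    (h : FS u a x₀ y₀) (h' : FS v a x₀' y₀') :
    (∀ x y x' y', FS u a x y → FS v a x' y' → p x y x' y') ↔ p x₀ y₀ x₀' y₀' := by
  refine ⟨fun H => H _ _ _ _ h h', fun H x y x' y' h1 h2 => ?_⟩
  obtain ⟨rfl, rfl⟩ := h.unique h1
  obtain ⟨rfl, rfl⟩ := h'.unique h2
  exact H

theorem LS.forall_iff {u v x₀ y₀ x₀' y₀' : GW A} {a : A} {p : GW A → GW A → GW A → GW A → Prop}
    (h : LS u a x₀ y₀) (h' : LS v a x₀' y₀') :
    (∀ x y x' y', LS u a x y → LS v a x' y' → p x y x' y') ↔ p x₀ y₀ x₀' y₀' := by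
  refine ⟨fun H => H _ _ _ _ h h', fun H x y x' y' h1 h2 => ?_⟩
  obtain ⟨rfl, rfl⟩ := h.unique h1
  obtain ⟨rfl, rfl⟩ := h'.unique h2
  exact H

theorem CS.mem {u : GW A} {a b : A} {c : GW A} (h : CS u a b c) :
    a ∈ al u ∧ b ∈ al u ∧ a ≠ b ∧ ¬ Sub2 u a b := by
  obtain ⟨x, y, h1, h2⟩ := h
  have hab : a ≠ b := by
    rintro rfl; exact h1.2 (by simp)
  refine ⟨h1.mem, h2.mem, hab, ?_⟩
  rw [h1.Sub2_iff]
  exact fun hb => h2.2 (by simp [hb])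

theorem eqvAux_iff {n : ℕ} {k : ZK} {m : ℕ} {u v : GWord A} (hu : u.Accessible)
    (hv : v.Accessible) : eqvAux n k m u v ↔ E n k m (mk u) (mk v) := by
  induction n generalizing k m u v with
  | zero => simp [eqvAux]
  | succ n ih =>
    rcases m with _ | m
    · simp [eqvAux]
    have hF : ∀ {k k' : ZK} {m m' : ℕ}, u.alph = v.alph →
        ((∀ a ∈ u.alph, eqvAux n k m (u.XL a) (v.XL a) ∧ eqvAux n k' m' (u.XR a) (v.XR a)) ↔
        ∀ a x y x' y', FS (mk u) a x y → FS (mk v) a x' y' → E n k m x x' ∧ E n k' m' y y') := by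
      intro k k' m m' hal
      refine forall_congr' fun a => ?_
      by_cases ha : a ∈ u.alph
      · rw [FS.forall_iff (hu.FS ha) (hv.FS (hal ▸ ha)) (p := fun x y x' y' =>
          E n k m x x' ∧ E n k' m' y y'), ih (hu.XL a) (hv.XL a), ih (hu.XR a) (hv.XR a)]
        simp [ha]
      · exact ⟨fun _ _ _ _ _ h => absurd h.mem ha, fun _ h => absurd h ha⟩
    have hL : ∀ {k k' : ZK} {m m' : ℕ}, u.alph = v.alph →
        ((∀ a ∈ u.alph, eqvAux n k m (u.YL a) (v.YL a) ∧ eqvAux n k' m' (u.YR a) (v.YR a)) ↔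
        ∀ a x y x' y', LS (mk u) a x y → LS (mk v) a x' y' → E n k m x x' ∧ E n k' m' y y') := by
      intro k k' m m' hal
      refine forall_congr' fun a => ?_
      by_cases ha : a ∈ u.alph
      · rw [LS.forall_iff (hu.LS ha) (hv.LS (hal ▸ ha)) (p := fun x y x' y' =>
          E n k m x x' ∧ E n k' m' y y'), ih (hu.YL a) (hv.YL a), ih (hu.YR a) (hv.YR a)]
        simp [ha]
      · exact ⟨fun _ _ _ _ _ h => absurd h.mem ha, fun _ h => absurd h ha⟩
    cases k with
    | X => exact and_congr_right fun hal => and_congr (ih hu hv) (hF hal)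
    | Y => exact and_congr_right fun hal => and_congr (ih hu hv) (hL hal)
    | WI =>
      refine and_congr_right fun hal => ?_
      have h1 := hF (k := .WI) (k' := .WI) (m := m) (m' := m + 1) hal
      have h2 := hL (k := .WI) (k' := .WI) (m := m + 1) (m' := m) hal
      rw [← h1, ← h2]
      have hC : (∀ a ∈ u.alph, ∀ b ∈ u.alph, (u.CDefined a b ↔ v.CDefined a b) ∧
          (u.CDefined a b → v.CDefined a b → eqvAux n ZK.WI m (u.Cab a b) (v.Cab a b))) ↔
          (∀ a b, a ≠ b → (Sub2 (mk u) a b ↔ Sub2 (mk v) a b)) ∧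
          ∀ a b c c', CS (mk u) a b c → CS (mk v) a b c' → E n ZK.WI m c c' := by
        constructor
        · intro H
          refine ⟨fun a b hab => ?_, fun a b c c' hc hc' => ?_⟩
          · by_cases hm : a ∈ u.alph ∧ b ∈ u.alph
            · have := (H a hm.1 b hm.2).1
              rw [hu.CDefined_iff hm.1 hm.2, hv.CDefined_iff (hal ▸ hm.1) (hal ▸ hm.2)] at this
              tauto
            · have hn : ∀ w : GW A, al w = u.alph → ¬ Sub2 w a b := by
                rintro w hw ⟨x, y, rfl, hy⟩
                apply hm
                rw [← hw]
                simp [hy]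
              exact iff_of_false (hn _ rfl) (hn _ hal.symm)
          · have hm := hc.mem
            have hm' := hc'.mem
            have hd := (hu.CDefined_iff hm.1 hm.2.1).2 hm.2.2
            have hd' := (hv.CDefined_iff hm'.1 hm'.2.1).2 hm'.2.2
            rw [hc.unique hd.CS, hc'.unique hd'.CS, ← ih (hu.Cab a b) (hv.Cab a b)]
            exact (H a hm.1 b hm.2.1).2 hd hd'
        · rintro ⟨H1, H2⟩ a ha b hb
          refine ⟨?_, fun hd hd' => (ih (hu.Cab a b) (hv.Cab a b)).2 (H2 _ _ _ _ hd.CS hd'.CS)⟩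
          rw [hu.CDefined_iff ha hb, hv.CDefined_iff (hal ▸ ha) (hal ▸ hb)]
          have := H1 a b
          tauto
      rw [← hC]
      constructor
      · rintro ⟨H1, H2⟩
        exact ⟨fun a ha => ⟨(H1 a ha).1, (H1 a ha).2.1⟩, fun a ha => (H1 a ha).2.2, H2⟩
      · rintro ⟨H1, H2, H3⟩
        exact ⟨fun a ha => ⟨(H1 a ha).1, (H1 a ha).2, H2 a ha⟩, H3⟩

end GW

namespace GWord

variable {A : Type}

/-- A position of a power. -/
def gpos (g : GWord A) (ν : Type) [LinearOrder ν] (i : ν) (p : g.P) : (g.gpow ν).P := toLex (i, p)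

section

variable {g : GWord A} {ν : Type} [LinearOrder ν]

@[elab_as_elim]
theorem gpow_cases {motive : (g.gpow ν).P → Prop} (p : (g.gpow ν).P)
    (h : ∀ i p, motive (g.gpos ν i p)) : motive p :=
  h (ofLex p).1 (ofLex p).2

@[simp] theorem gpow_w (i : ν) (p : g.P) : (g.gpow ν).w (g.gpos ν i p) = g.w p := rfl

theorem gpos_lt {i j : ν} {p q : g.P} :
    g.gpos ν i p < g.gpos ν j q ↔ i < j ∨ i = j ∧ p < q := Prod.Lex.toLex_lt_toLex

theorem gpos_le {i j : ν} {p q : g.P} :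
    g.gpos ν i p ≤ g.gpos ν j q ↔ i < j ∨ i = j ∧ p ≤ q := Prod.Lex.toLex_le_toLex

theorem Accessible.gpow (hg : g.Accessible) {i₀ i₁ : ν} (h₀ : ∀ i, i₀ ≤ i) (h₁ : ∀ i, i ≤ i₁)
    (hs : ∀ i j : ν, i < j → ∃ s, i < s ∧ ∀ k, i < k → s ≤ k)
    (hp : ∀ i j : ν, j < i → ∃ s, s < i ∧ ∀ k, k < i → k ≤ s) : (g.gpow ν).Accessible := by
  refine ⟨?_, ?_, ?_, ?_⟩
  · rintro a ⟨p, ha⟩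
    induction p using gpow_cases with
    | h i p =>
      obtain ⟨q, hq, hq'⟩ := hg.1 a ⟨p, ha⟩
      refine ⟨gpos _ _ i₀ q, hq, fun r hr => ?_⟩
      induction r using gpow_cases with
      | h j r =>
        rw [gpos_le]
        exact (h₀ j).lt_or_eq.imp_right fun h => ⟨h, hq' r hr⟩
  · rintro a ⟨p, ha⟩
    induction p using gpow_cases with
    | h i p =>
      obtain ⟨q, hq, hq'⟩ := hg.2.1 a ⟨p, ha⟩
      refine ⟨gpos _ _ i₁ q, hq, fun r hr => ?_⟩
      induction r using gpow_cases with
      | h j r =>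
        rw [gpos_le]
        exact (h₁ j).lt_or_eq.imp_right fun h => ⟨h, hq' r hr⟩
  · rintro p a ⟨q, hpq, ha⟩
    induction p using gpow_cases with
    | h i p =>
    induction q using gpow_cases with
    | h j q =>
      rw [gpos_lt] at hpq
      by_cases h : ∃ q, p < q ∧ g.w q = a
      · obtain ⟨s, h1, h2, h3⟩ := hg.2.2.1 p a h
        refine ⟨gpos _ _ i s, gpos_lt.2 (Or.inr ⟨rfl, h1⟩), h2, fun r hr hr' => ?_⟩
        induction r using gpow_cases with
        | h k r =>
          rw [gpos_lt] at hr
          rw [gpos_le]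
          exact hr.imp_right fun h => ⟨h.1, h3 r h.2 hr'⟩
      · have hij : i < j := hpq.resolve_right fun h' => h ⟨q, h'.2, ha⟩
        obtain ⟨s, h1, h2⟩ := hs i j hij
        obtain ⟨t, h3, h4⟩ := hg.1 a ⟨q, ha⟩
        refine ⟨gpos _ _ s t, gpos_lt.2 (Or.inl h1), h3, fun r hr hr' => ?_⟩
        induction r using gpow_cases with
        | h k r =>
          rw [gpos_lt] at hr
          have hik : i < k := hr.resolve_right fun h' => h ⟨r, h'.2, hr'⟩
          rw [gpos_le]
          exact (h2 k hik).lt_or_eq.imp_right fun h => ⟨h, h4 r hr'⟩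
  · rintro p a ⟨q, hpq, ha⟩
    induction p using gpow_cases with
    | h i p =>
    induction q using gpow_cases with
    | h j q =>
      rw [gpos_lt] at hpq
      by_cases h : ∃ q, q < p ∧ g.w q = a
      · obtain ⟨s, h1, h2, h3⟩ := hg.2.2.2 p a h
        refine ⟨gpos _ _ i s, gpos_lt.2 (Or.inr ⟨rfl, h1⟩), h2, fun r hr hr' => ?_⟩
        induction r using gpow_cases with
        | h k r =>
          rw [gpos_lt] at hr
          rw [gpos_le]
          exact hr.imp_right fun h => ⟨h.1, h3 r h.2 hr'⟩
      · have hij : j < i := hpq.resolve_right fun h' => h ⟨q, h'.2, ha⟩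
        obtain ⟨s, h1, h2⟩ := hp i j hij
        obtain ⟨t, h3, h4⟩ := hg.2.1 a ⟨q, ha⟩
        refine ⟨gpos _ _ s t, gpos_lt.2 (Or.inl h1), h3, fun r hr hr' => ?_⟩
        induction r using gpow_cases with
        | h k r =>
          rw [gpos_lt] at hr
          have hik : k < i := hr.resolve_right fun h' => h ⟨r, h'.2, hr'⟩
          rw [gpos_le]
          exact (h2 k hik).lt_or_eq.imp_right fun h => ⟨h, h4 r hr'⟩

theorem append_gpow {s : ν → ν} {i₀ : ν} (hs : StrictMono s) (h₀ : ∀ i, i₀ < s i)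
    (h : ∀ j, j = i₀ ∨ ∃ i, s i = j) : Iso (g.append (g.gpow ν)) (g.gpow ν) := by
  refine Iso.of_strictMono (fun p => Sum.elim (fun p => gpos g ν i₀ p)
    (fun p : (g.gpow ν).P => gpos g ν (s (ofLex p).1) (ofLex p).2) (ofLex p)) ?_ ?_ ?_
  · intro p q
    induction p using append_cases with
    | hl p =>
      induction q using append_cases with
      | hl q => rw [inl_lt_inl]; exact fun h => gpos_lt.2 (Or.inr ⟨rfl, h⟩)
      | hr q => exact fun _ => gpos_lt.2 (Or.inl (h₀ _))
    | hr p =>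
      induction q using append_cases with
      | hl q => exact fun h => absurd h (not_inr_lt_inl _ _)
      | hr q =>
        rw [inr_lt_inr]
        induction p using gpow_cases with
        | h i p =>
        induction q using gpow_cases with
        | h j q =>
          rw [gpos_lt]
          exact fun h => gpos_lt.2 (h.imp (fun h => hs h) (fun h => ⟨congrArg s h.1, h.2⟩))
  · intro q
    induction q using gpow_cases with
    | h j q =>
      obtain rfl | ⟨i, rfl⟩ := h j
      · exact ⟨inl _ _ q, rfl⟩
      · exact ⟨inr _ _ (gpos _ _ i q), rfl⟩
  · intro p
    induction p using append_cases with
    | hl p => rfl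
    | hr p => rfl

theorem gpow_append {s : ν → ν} {i₀ : ν} (hs : StrictMono s) (h₀ : ∀ i, s i < i₀)
    (h : ∀ j, j = i₀ ∨ ∃ i, s i = j) : Iso ((g.gpow ν).append g) (g.gpow ν) := by
  refine Iso.of_strictMono (fun p => Sum.elim
    (fun p : (g.gpow ν).P => gpos g ν (s (ofLex p).1) (ofLex p).2)
    (fun p => gpos g ν i₀ p) (ofLex p)) ?_ ?_ ?_
  · intro p q
    induction p using append_cases with
    | hr p =>
      induction q using append_cases with
      | hr q => rw [inr_lt_inr]; exact fun h => gpos_lt.2 (Or.inr ⟨rfl, h⟩)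
      | hl q => exact fun h => absurd h (not_inr_lt_inl _ _)
    | hl p =>
      induction q using append_cases with
      | hr q => exact fun _ => gpos_lt.2 (Or.inl (h₀ _))
      | hl q =>
        rw [inl_lt_inl]
        induction p using gpow_cases with
        | h i p =>
        induction q using gpow_cases with
        | h j q =>
          rw [gpos_lt]
          exact fun h => gpos_lt.2 (h.imp (fun h => hs h) (fun h => ⟨congrArg s h.1, h.2⟩))
  · intro q
    induction q using gpow_cases with
    | h j q =>
      obtain rfl | ⟨i, rfl⟩ := h j
      · exact ⟨inr _ _ q, rfl⟩
      · exact ⟨inl _ _ (gpos _ _ i q), rfl⟩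
  · intro p
    induction p using append_cases with
    | hl p => rfl
    | hr p => rfl

end

theorem OO_inr_lt_inr {i j : ℕᵒᵈ} : (Sum.inrₗ i : OO) < Sum.inrₗ j ↔
    OrderDual.ofDual j < OrderDual.ofDual i := Sum.Lex.inr_lt_inr_iff

theorem OO_inr_le_inr {i j : ℕᵒᵈ} : (Sum.inrₗ i : OO) ≤ Sum.inrₗ j ↔
    OrderDual.ofDual j ≤ OrderDual.ofDual i := Sum.Lex.inr_le_inr_iff

theorem Accessible.gpow_OO {g : GWord A} (hg : g.Accessible) : (g.gpow OO).Accessible := by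
  refine hg.gpow (i₀ := Sum.inlₗ 0) (i₁ := Sum.inrₗ (OrderDual.toDual 0)) ?_ ?_ ?_ ?_
  · rintro (i | i)
    · exact Sum.Lex.inl_le_inl_iff.2 (Nat.zero_le i)
    · exact Sum.Lex.inl_le_inr _ _
  · rintro (i | i)
    · exact Sum.Lex.inl_le_inr _ _
    · exact OO_inr_le_inr.2 (Nat.zero_le _)
  · rintro (i | i) j hij
    · refine ⟨Sum.inlₗ (i + 1), Sum.Lex.inl_lt_inl_iff.2 (Nat.lt_succ_self i), ?_⟩
      rintro (k | k) hk
      · exact Sum.Lex.inl_le_inl_iff.2 (Nat.succ_le_of_lt (Sum.Lex.inl_lt_inl_iff.1 hk))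
      · exact Sum.Lex.inl_le_inr _ _
    · rcases j with j | j
      · exact absurd hij Sum.Lex.not_inr_lt_inl
      · have hij := OO_inr_lt_inr.1 hij
        refine ⟨Sum.inrₗ (OrderDual.toDual (OrderDual.ofDual i - 1)),
          OO_inr_lt_inr.2 (Nat.sub_lt (Nat.zero_lt_of_lt hij) one_pos), ?_⟩
        rintro (k | k) hk
        · exact absurd hk Sum.Lex.not_inr_lt_inl
        · exact OO_inr_le_inr.2 (Nat.le_sub_one_of_lt (OO_inr_lt_inr.1 hk))
  · rintro (i | i) j hij
    · rcases j with j | j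
      · have hij := Sum.Lex.inl_lt_inl_iff.1 hij
        refine ⟨Sum.inlₗ (i - 1), Sum.Lex.inl_lt_inl_iff.2
          (Nat.sub_lt (Nat.zero_lt_of_lt hij) one_pos), ?_⟩
        rintro (k | k) hk
        · exact Sum.Lex.inl_le_inl_iff.2 (Nat.le_sub_one_of_lt (Sum.Lex.inl_lt_inl_iff.1 hk))
        · exact absurd hk Sum.Lex.not_inr_lt_inl
      · exact absurd hij Sum.Lex.not_inr_lt_inl
    · refine ⟨Sum.inrₗ (OrderDual.toDual (OrderDual.ofDual i + 1)),
        OO_inr_lt_inr.2 (Nat.lt_succ_self _), ?_⟩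
      rintro (k | k) hk
      · exact Sum.Lex.inl_le_inr _ _
      · exact OO_inr_le_inr.2 (Nat.succ_le_of_lt (OO_inr_lt_inr.1 hk))

theorem append_gpow_OO (g : GWord A) : Iso (g.append (g.gpow OO)) (g.gpow OO) := by
  refine append_gpow (s := fun i => Sum.elim (fun n => Sum.inlₗ (n + 1)) (fun n => Sum.inrₗ n)
    (ofLex i)) (i₀ := Sum.inlₗ 0) ?_ ?_ ?_
  · rintro (i | i) (j | j) h
    · exact Sum.Lex.inl_lt_inl_iff.2 (Nat.succ_lt_succ (Sum.Lex.inl_lt_inl_iff.1 h))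
    · exact Sum.Lex.inl_lt_inr _ _
    · exact absurd h Sum.Lex.not_inr_lt_inl
    · exact h
  · rintro (i | i)
    · exact Sum.Lex.inl_lt_inl_iff.2 (Nat.succ_pos i)
    · exact Sum.Lex.inl_lt_inr _ _
  · rintro ((_ | i) | i)
    · exact Or.inl rfl
    · exact Or.inr ⟨Sum.inlₗ i, rfl⟩
    · exact Or.inr ⟨Sum.inrₗ i, rfl⟩

theorem gpow_OO_append (g : GWord A) : Iso ((g.gpow OO).append g) (g.gpow OO) := by
  refine gpow_append (s := fun i => Sum.elim (fun n => Sum.inlₗ n)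
    (fun n => Sum.inrₗ (OrderDual.toDual (OrderDual.ofDual n + 1)))
    (ofLex i)) (i₀ := Sum.inrₗ (OrderDual.toDual 0)) ?_ ?_ ?_
  · rintro (i | i) (j | j) h
    · exact h
    · exact Sum.Lex.inl_lt_inr _ _
    · exact absurd h Sum.Lex.not_inr_lt_inl
    · exact OO_inr_lt_inr.2 (Nat.succ_lt_succ (OO_inr_lt_inr.1 h))
  · rintro (i | i)
    · exact Sum.Lex.inl_lt_inr _ _
    · exact OO_inr_lt_inr.2 (Nat.succ_pos _)
  · rintro (i | (_ | i))
    · exact Or.inr ⟨Sum.inlₗ i, rfl⟩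
    · exact Or.inl rfl
    · exact Or.inr ⟨Sum.inrₗ (OrderDual.toDual i), rfl⟩

theorem alph_gpow_OO (g : GWord A) : (g.gpow OO).alph = g.alph := by
  ext a
  constructor
  · rintro ⟨p, rfl⟩
    exact ⟨(ofLex p).2, rfl⟩
  · rintro ⟨p, rfl⟩
    exact ⟨gpos _ _ (Sum.inlₗ 0) p, rfl⟩

theorem Accessible.append {u v : GWord A} (hu : u.Accessible) (hv : v.Accessible) :
    (u.append v).Accessible := by
  refine ⟨?_, ?_, ?_, ?_⟩
  · rintro a ⟨p, hp⟩
    by_cases h : ∃ p, u.w p = a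
    · obtain ⟨q, h1, h2⟩ := hu.1 a h
      refine ⟨inl _ _ q, h1, fun r hr => not_lt.1 fun hlt => ?_⟩
      induction r using append_cases with
      | hl r => exact absurd (h2 r hr) (not_le.2 ((inl_lt_inl _ _).1 hlt))
      | hr r => exact not_inr_lt_inl _ _ hlt
    · induction p using append_cases with
      | hl p => exact absurd ⟨p, hp⟩ h
      | hr p =>
        obtain ⟨q, h1, h2⟩ := hv.1 a ⟨p, hp⟩
        refine ⟨inr _ _ q, h1, fun r hr => not_lt.1 fun hlt => ?_⟩
        induction r using append_cases with
        | hl r => exact h ⟨r, hr⟩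
        | hr r => exact absurd (h2 r hr) (not_le.2 ((inr_lt_inr _ _).1 hlt))
  · rintro a ⟨p, hp⟩
    by_cases h : ∃ p, v.w p = a
    · obtain ⟨q, h1, h2⟩ := hv.2.1 a h
      refine ⟨inr _ _ q, h1, fun r hr => not_lt.1 fun hlt => ?_⟩
      induction r using append_cases with
      | hl r => exact not_inr_lt_inl _ _ hlt
      | hr r => exact absurd (h2 r hr) (not_le.2 ((inr_lt_inr _ _).1 hlt))
    · induction p using append_cases with
      | hr p => exact absurd ⟨p, hp⟩ h
      | hl p =>
        obtain ⟨q, h1, h2⟩ := hu.2.1 a ⟨p, hp⟩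
        refine ⟨inl _ _ q, h1, fun r hr => not_lt.1 fun hlt => ?_⟩
        induction r using append_cases with
        | hr r => exact h ⟨r, hr⟩
        | hl r => exact absurd (h2 r hr) (not_le.2 ((inl_lt_inl _ _).1 hlt))
  · rintro p a ⟨q, hpq, hq⟩
    induction p using append_cases with
    | hl p =>
      by_cases h : ∃ q, p < q ∧ u.w q = a
      · obtain ⟨s, h1, h2, h3⟩ := hu.2.2.1 p a h
        refine ⟨inl _ _ s, (inl_lt_inl _ _).2 h1, h2, fun r hr hr' => not_lt.1 fun hlt => ?_⟩
        induction r using append_cases with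
        | hl r => exact absurd (h3 r ((inl_lt_inl _ _).1 hr) hr') (not_le.2 ((inl_lt_inl _ _).1 hlt))
        | hr r => exact not_inr_lt_inl _ _ hlt
      · induction q using append_cases with
        | hl q => exact absurd ⟨q, (inl_lt_inl _ _).1 hpq, hq⟩ h
        | hr q =>
          obtain ⟨s, h1, h2⟩ := hv.1 a ⟨q, hq⟩
          refine ⟨inr _ _ s, inl_lt_inr _ _, h1, fun r hr hr' => not_lt.1 fun hlt => ?_⟩
          induction r using append_cases with
          | hl r => exact h ⟨r, (inl_lt_inl _ _).1 hr, hr'⟩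
          | hr r => exact absurd (h2 r hr') (not_le.2 ((inr_lt_inr _ _).1 hlt))
    | hr p =>
      induction q using append_cases with
      | hl q => exact absurd hpq (not_inr_lt_inl _ _)
      | hr q =>
        obtain ⟨s, h1, h2, h3⟩ := hv.2.2.1 p a ⟨q, (inr_lt_inr _ _).1 hpq, hq⟩
        refine ⟨inr _ _ s, (inr_lt_inr _ _).2 h1, h2, fun r hr hr' => not_lt.1 fun hlt => ?_⟩
        induction r using append_cases with
        | hl r => exact absurd hr (not_inr_lt_inl _ _)
        | hr r => exact absurd (h3 r ((inr_lt_inr _ _).1 hr) hr') (not_le.2 ((inr_lt_inr _ _).1 hlt))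
  · rintro p a ⟨q, hpq, hq⟩
    induction p using append_cases with
    | hr p =>
      by_cases h : ∃ q, q < p ∧ v.w q = a
      · obtain ⟨s, h1, h2, h3⟩ := hv.2.2.2 p a h
        refine ⟨inr _ _ s, (inr_lt_inr _ _).2 h1, h2, fun r hr hr' => not_lt.1 fun hlt => ?_⟩
        induction r using append_cases with
        | hr r => exact absurd (h3 r ((inr_lt_inr _ _).1 hr) hr') (not_le.2 ((inr_lt_inr _ _).1 hlt))
        | hl r => exact not_inr_lt_inl _ _ hlt
      · induction q using append_cases with
        | hr q => exact absurd ⟨q, (inr_lt_inr _ _).1 hpq, hq⟩ h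
        | hl q =>
          obtain ⟨s, h1, h2⟩ := hu.2.1 a ⟨q, hq⟩
          refine ⟨inl _ _ s, inl_lt_inr _ _, h1, fun r hr hr' => not_lt.1 fun hlt => ?_⟩
          induction r using append_cases with
          | hr r => exact h ⟨r, (inr_lt_inr _ _).1 hr, hr'⟩
          | hl r => exact absurd (h2 r hr') (not_le.2 ((inl_lt_inl _ _).1 hlt))
    | hl p =>
      induction q using append_cases with
      | hr q => exact absurd hpq (not_inr_lt_inl _ _)
      | hl q =>
        obtain ⟨s, h1, h2, h3⟩ := hu.2.2.2 p a ⟨q, (inl_lt_inl _ _).1 hpq, hq⟩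
        refine ⟨inl _ _ s, (inl_lt_inl _ _).2 h1, h2, fun r hr hr' => not_lt.1 fun hlt => ?_⟩
        induction r using append_cases with
        | hr r => exact absurd hr (not_inr_lt_inl _ _)
        | hl r => exact absurd (h3 r ((inl_lt_inl _ _).1 hr) hr') (not_le.2 ((inl_lt_inl _ _).1 hlt))

theorem accessible_of_finite (u : GWord A) [Finite u.P] : u.Accessible := by
  have hmin : ∀ S : Set u.P, S.Nonempty → ∃ p ∈ S, ∀ q ∈ S, p ≤ q := fun S hS =>
    S.exists_min_image id S.toFinite hS
  have hmax : ∀ S : Set u.P, S.Nonempty → ∃ p ∈ S, ∀ q ∈ S, q ≤ p := fun S hS =>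
    S.exists_max_image id S.toFinite hS
  refine ⟨fun a h => hmin {p | u.w p = a} h, fun a h => hmax {p | u.w p = a} h, ?_, ?_⟩
  · intro p a h
    obtain ⟨q, h1, h2⟩ := hmin {q | p < q ∧ u.w q = a} h
    exact ⟨q, h1.1, h1.2, fun r hr hr' => h2 r ⟨hr, hr'⟩⟩
  · intro p a h
    obtain ⟨q, h1, h2⟩ := hmax {q | q < p ∧ u.w q = a} h
    exact ⟨q, h1.1, h1.2, fun r hr hr' => h2 r ⟨hr, hr'⟩⟩

theorem accessible_ofList (l : List A) : (ofList l).Accessible :=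
  haveI : Finite (ofList l).P := inferInstanceAs (Finite (Fin l.length))
  accessible_of_finite _

end GWord

theorem PiTerm.accessible_substOO {A : Type} (α : PiTerm A) : α.substOO.Accessible := by
  induction α with
  | eps => exact GWord.accessible_ofList _
  | letter a => exact GWord.accessible_ofList _
  | mul α β h1 h2 => exact h1.append h2
  | pi γ h => exact h.gpow_OO

namespace GW

variable {A : Type}

/-- The class of a finite word. -/
def ι (l : List A) : GW A := mk (GWord.ofList l)

@[simp] theorem ι_nil : ι ([] : List A) = 1 := rfl

theorem ι_cons (a : A) (l : List A) : ι (a :: l) = letter a * ι l :=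
  (mk_eq.2 (GWord.ofList_cons a l)).symm

@[simp] theorem ι_append (l l' : List A) : ι (l ++ l') = ι l * ι l' := by
  induction l with
  | nil => simp
  | cons a l ih => rw [List.cons_append, ι_cons, ih, ι_cons, mul_assoc]

theorem ι_split (l l' : List A) (a : A) : ι (l ++ a :: l') = ι l * letter a * ι l' := by
  rw [ι_append, ι_cons, mul_assoc]

@[simp] theorem rev_ι (l : List A) : rev (ι l) = ι l.reverse := by
  induction l with
  | nil => simp
  | cons a l ih => rw [ι_cons, rev_mul, ih, List.reverse_cons, ι_append, rev_letter]; rfl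

@[simp] theorem mem_al_ι {l : List A} {a : A} : a ∈ al (ι l) ↔ a ∈ l := by
  induction l with
  | nil => simp
  | cons b l ih => rw [ι_cons, al_mul, Set.mem_union, ih]; simp

theorem ι_listNPow (l : List A) (k : ℕ) : ι (listNPow l k) = ι l ^ k := by
  induction k with
  | zero => rfl
  | succ k ih => rw [listNPow, ι_append, ih, pow_succ']

theorem al_pow (w : GW A) {k : ℕ} (hk : k ≠ 0) : al (w ^ k) = al w := by
  induction k with
  | zero => exact absurd rfl hk
  | succ k ih =>
    rcases k with _ | k
    · simp
    · rw [pow_succ, al_mul, ih (by simp), Set.union_self]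

theorem Sub2.mem {u : GW A} {a b : A} (h : Sub2 u a b) : a ∈ al u ∧ b ∈ al u := by
  obtain ⟨x, y, rfl, hb⟩ := h
  simp [hb]

theorem E_pow {n : ℕ} {k : ZK} {m : ℕ} {g P w : GW A} (hP : P = g * P) (hP' : P = P * g)
    (hal : al P = al g) {K : ℕ} (hK : n + 2 ≤ K) (h : E n k m g w) : E n k m P (w ^ K) := by
  induction n generalizing k m g P w K with
  | zero => simp
  | succ n ih =>
    obtain ⟨K, rfl⟩ : ∃ j, K = j + 1 := ⟨K - 1, by omega⟩
    rcases m with _ | m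
    · simp
    have hw : al (w ^ (K + 1)) = al w := al_pow w (by simp)
    have hX : ∀ {g P w : GW A}, P = g * P → P = P * g → al P = al g →
        E (n + 1) ZK.X (m + 1) g w → E (n + 1) ZK.X (m + 1) P (w ^ (K + 1)) := by
      intro g P w hP hP' hal h
      have hw : al (w ^ (K + 1)) = al w := al_pow w (by simp)
      refine ⟨by rw [hal, hw, h.1], ih hP hP' hal (by omega) h.2.1, fun a x y x' y' h1 h2 => ?_⟩
      have ha : a ∈ al g := hal ▸ h1.mem
      rw [hP] at h1
      rw [pow_succ'] at h2
      obtain ⟨y, h3, rfl⟩ := h1.of_mul_left ha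
      obtain ⟨y', h4, rfl⟩ := h2.of_mul_left (h.1 ▸ ha)
      obtain ⟨h5, h6⟩ := h.2.2 _ _ _ _ _ h3 h4
      exact ⟨h5, h6.mul (ih hP hP' hal (by omega) h.mono)⟩
    cases k with
    | X => exact hX hP hP' hal h
    | Y =>
      have hrev : ∀ k, rev w ^ k = rev (w ^ k) := fun k => by
        induction k with
        | zero => simp
        | succ k ih => rw [pow_succ, ih, pow_succ', rev_mul]
      have := hX (by rw [← rev_mul, ← hP']) (by rw [← rev_mul, ← hP]) (by simpa using hal) h.rev
      rw [hrev] at this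
      simpa using this.rev
    | WI =>
      have hs : ∀ a b, Sub2 P a b ↔ a ∈ al P ∧ b ∈ al P := fun a b => by
        refine ⟨fun h => h.mem, fun h => ?_⟩
        rw [hP, Sub2_mul]
        exact Or.inr (Or.inr ⟨hal ▸ h.1, h.2⟩)
      have hs' : ∀ a b, Sub2 (w ^ (K + 1)) a b ↔ a ∈ al w ∧ b ∈ al w := fun a b => by
        refine ⟨fun h => hw ▸ h.mem, fun h => ?_⟩
        rw [pow_succ', Sub2_mul, al_pow w (by omega)]
        exact Or.inr (Or.inr h)
      refine ⟨by rw [hal, hw, h.1], fun a x y x' y' h1 h2 => ?_, fun a x y x' y' h1 h2 => ?_,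
        fun a b _ => ?_, fun a b c c' h1 _ => ?_⟩
      · have ha : a ∈ al g := hal ▸ h1.mem
        rw [hP] at h1
        rw [pow_succ'] at h2
        obtain ⟨y, h3, rfl⟩ := h1.of_mul_left ha
        obtain ⟨y', h4, rfl⟩ := h2.of_mul_left (h.1 ▸ ha)
        obtain ⟨h5, h6⟩ := h.2.1 _ _ _ _ _ h3 h4
        exact ⟨h5, h6.mul (ih hP hP' hal (by omega) h.mono)⟩
      · have ha : a ∈ al g := hal ▸ h1.mem
        rw [hP'] at h1
        rw [pow_succ] at h2
        obtain ⟨y, h3, rfl⟩ := h1.of_mul_right ha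
        obtain ⟨y', h4, rfl⟩ := h2.of_mul_right (h.1 ▸ ha)
        obtain ⟨h5, h6⟩ := h.2.2.1 _ _ _ _ _ h3 h4
        exact ⟨(ih hP hP' hal (by omega) h.mono).mul h5, h6⟩
      · rw [hs, hs', hal, h.1]
      · exact absurd ((hs a b).2 ⟨h1.mem.1, h1.mem.2.1⟩) h1.mem.2.2.2

theorem E_substOO {n : ℕ} {k : ZK} {m : ℕ} {K : ℕ} (hK : n + 2 ≤ K) (α : PiTerm A) :
    E n k m (mk α.substOO) (ι (α.substNat K)) := by
  induction α with
  | eps => exact E.refl _ _ _ _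
  | letter a => exact E.refl _ _ _ _
  | mul α β h1 h2 => rw [PiTerm.substNat, ι_append]; exact h1.mul h2
  | pi γ h =>
    rw [PiTerm.substNat, ι_listNPow]
    exact E_pow (g := mk γ.substOO) (mk_eq.2 (GWord.append_gpow_OO _)).symm
      (mk_eq.2 (GWord.gpow_OO_append _)).symm (GWord.alph_gpow_OO _) hK h

end GW

theorem eqvAux.symm {A : Type} {n : ℕ} {k : ZK} {m : ℕ} {u v : GWord A} (h : eqvAux n k m u v) :
    eqvAux n k m v u := by
  induction n generalizing k m u v with
  | zero => simp [eqvAux]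
  | succ n ih =>
    rcases m with _ | m
    · simp [eqvAux]
    cases k with
    | X =>
      exact ⟨h.1.symm, ih h.2.1, fun a ha => have := h.2.2 a (h.1 ▸ ha); ⟨ih this.1, ih this.2⟩⟩
    | Y =>
      exact ⟨h.1.symm, ih h.2.1, fun a ha => have := h.2.2 a (h.1 ▸ ha); ⟨ih this.1, ih this.2⟩⟩
    | WI =>
      exact ⟨h.1.symm, fun a ha => have := h.2.1 a (h.1 ▸ ha);
        ⟨ih this.1, ih this.2.1, ih this.2.2.1, ih this.2.2.2⟩,
        fun a ha b hb => have := h.2.2 a (h.1 ▸ ha) b (h.1 ▸ hb);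
        ⟨this.1.symm, fun h1 h2 => ih (this.2 h2 h1)⟩⟩

theorem eqvAux.trans {A : Type} {n : ℕ} {k : ZK} {m : ℕ} {u v w : GWord A}
    (h : eqvAux n k m u v) (h' : eqvAux n k m v w) : eqvAux n k m u w := by
  induction n generalizing k m u v w with
  | zero => simp [eqvAux]
  | succ n ih =>
    rcases m with _ | m
    · simp [eqvAux]
    cases k with
    | X =>
      exact ⟨h.1.trans h'.1, ih h.2.1 h'.2.1, fun a ha =>
        have h1 := h.2.2 a ha
        have h2 := h'.2.2 a (h.1 ▸ ha); ⟨ih h1.1 h2.1, ih h1.2 h2.2⟩⟩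
    | Y =>
      exact ⟨h.1.trans h'.1, ih h.2.1 h'.2.1, fun a ha =>
        have h1 := h.2.2 a ha
        have h2 := h'.2.2 a (h.1 ▸ ha); ⟨ih h1.1 h2.1, ih h1.2 h2.2⟩⟩
    | WI =>
      exact ⟨h.1.trans h'.1, fun a ha =>
        have h1 := h.2.1 a ha
        have h2 := h'.2.1 a (h.1 ▸ ha)
        ⟨ih h1.1 h2.1, ih h1.2.1 h2.2.1, ih h1.2.2.1 h2.2.2.1, ih h1.2.2.2 h2.2.2.2⟩,
        fun a ha b hb =>
        have h1 := h.2.2 a ha b hb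
        have h2 := h'.2.2 a (h.1 ▸ ha) b (h.1 ▸ hb)
        ⟨h1.1.trans h2.1, fun h3 h4 => ih (h1.2 h3 (h1.1.1 h3)) (h2.2 (h1.1.1 h3) h4)⟩⟩

namespace GW

variable {A : Type}

theorem E_ι_symm {n : ℕ} {k : ZK} {m : ℕ} {u v : List A} (h : E n k m (ι u) (ι v)) :
    E n k m (ι v) (ι u) :=
  (eqvAux_iff (GWord.accessible_ofList v) (GWord.accessible_ofList u)).1
    ((eqvAux_iff (GWord.accessible_ofList u) (GWord.accessible_ofList v)).2 h).symm

theorem E_ι_trans {n : ℕ} {k : ZK} {m : ℕ} {u v w : List A} (h : E n k m (ι u) (ι v))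
    (h' : E n k m (ι v) (ι w)) : E n k m (ι u) (ι w) :=
  (eqvAux_iff (GWord.accessible_ofList u) (GWord.accessible_ofList w)).1
    (((eqvAux_iff (GWord.accessible_ofList u) (GWord.accessible_ofList v)).2 h).trans
      ((eqvAux_iff (GWord.accessible_ofList v) (GWord.accessible_ofList w)).2 h'))

theorem FS_ι {p q : List A} {a : A} (h : a ∉ p) : FS (ι (p ++ a :: q)) a (ι p) (ι q) :=
  ⟨ι_split p q a, by simpa using h⟩

theorem LS_ι {p q : List A} {a : A} (h : a ∉ q) : LS (ι (p ++ a :: q)) a (ι p) (ι q) :=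
  ⟨ι_split p q a, by simpa using h⟩

theorem CS_ι {x c y : List A} {a b : A} (ha : a ∉ x ++ b :: c)
    (hb : b ∉ c ++ a :: y) : CS (ι (x ++ b :: (c ++ a :: y))) a b (ι c) := by
  refine ⟨ι x, ι y, ?_, ?_⟩
  · have := FS_ι (q := y) ha
    rwa [List.append_assoc, List.cons_append, ι_split x c b] at this
  · have := LS_ι (p := x) hb
    rwa [ι_split c] at this

end GW

namespace List

variable {A : Type}

theorem exists_first {a : A} {l : List A} (h : a ∈ l) : ∃ p q, l = p ++ a :: q ∧ a ∉ p :=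
  eq_append_cons_of_mem h

theorem exists_last {a : A} {l : List A} (h : a ∈ l) : ∃ p q, l = p ++ a :: q ∧ a ∉ q := by
  obtain ⟨p, q, h1, h2⟩ := exists_first (mem_reverse.2 h)
  refine ⟨q.reverse, p.reverse, ?_, by simpa using h2⟩
  rw [← reverse_reverse l, h1]; simp

theorem first_unique {a : A} {p q p' q' : List A} (h : p ++ a :: q = p' ++ a :: q') (hp : a ∉ p)
    (hp' : a ∉ p') : p = p' ∧ q = q' := by
  induction p generalizing p' with
  | nil =>
    cases p' with
    | nil => simpa using h
    | cons b p' => simp at h hp'; exact absurd h.1 hp'.1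
  | cons c p ih =>
    cases p' with
    | nil => simp at h hp; exact absurd h.1.symm hp.1
    | cons b p' =>
      simp at h hp hp'
      obtain ⟨rfl, h⟩ := h
      obtain ⟨rfl, rfl⟩ := ih h hp.2 hp'.2
      exact ⟨rfl, rfl⟩

theorem last_unique {a : A} {p q p' q' : List A} (h : p ++ a :: q = p' ++ a :: q') (hq : a ∉ q)
    (hq' : a ∉ q') : p = p' ∧ q = q' := by
  have h' := congrArg reverse h
  simp only [reverse_append, reverse_cons, append_assoc, singleton_append] at h'
  obtain ⟨h1, h2⟩ := first_unique h' (by simpa using hq) (by simpa using hq')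
  exact ⟨reverse_injective h2, reverse_injective h1⟩

end List

namespace GW

variable {A : Type}

theorem E.mem_iff {n : ℕ} {k : ZK} {m : ℕ} {u v : List A} (h : E (n + 1) k (m + 1) (ι u) (ι v))
    {a : A} : a ∈ u ↔ a ∈ v := by
  rw [← mem_al_ι, ← mem_al_ι]
  have : al (ι u) = al (ι v) := by cases k <;> exact h.1
  rw [this]

theorem al_ι_eq {u v : List A} : al (ι u) = al (ι v) ↔ ∀ a, a ∈ u ↔ a ∈ v := by
  simp [Set.ext_iff]

theorem E_ι_X {n m : ℕ} {u v : List A} : E (n + 1) ZK.X (m + 1) (ι u) (ι v) ↔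
    (∀ a, a ∈ u ↔ a ∈ v) ∧ E n ZK.Y m (ι u) (ι v) ∧
      ∀ a p q p' q', u = p ++ a :: q → a ∉ p → v = p' ++ a :: q' → a ∉ p' →
        E n ZK.Y m (ι p) (ι p') ∧ E n ZK.X (m + 1) (ι q) (ι q') := by
  rw [E_X_iff, al_ι_eq]
  refine and_congr_right fun hal => and_congr_right fun _ => forall_congr' fun a => ?_
  constructor
  · rintro H p q p' q' rfl hp rfl hp'
    exact H _ _ _ _ (FS_ι hp) (FS_ι hp')
  · intro H x y x' y' h1 h2
    obtain ⟨p, q, rfl, hp⟩ := List.exists_first (mem_al_ι.1 h1.mem)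
    obtain ⟨p', q', rfl, hp'⟩ := List.exists_first (mem_al_ι.1 h2.mem)
    obtain ⟨rfl, rfl⟩ := h1.unique (FS_ι hp)
    obtain ⟨rfl, rfl⟩ := h2.unique (FS_ι hp')
    exact H _ _ _ _ rfl hp rfl hp'

theorem E_ι_X_one {n : ℕ} {u v : List A} : E n ZK.X 1 (ι u) (ι v) ↔
    ∀ l : List A, l.length ≤ n → (l.Sublist u ↔ l.Sublist v) := by
  induction n generalizing u v with
  | zero =>
    refine iff_of_true E_zero fun l hl => ?_
    rw [List.length_eq_zero_iff.1 (Nat.le_zero.1 hl)]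
    simp
  | succ n ih =>
    have key : ∀ {a : A} {l p q : List A}, a ∉ p →
        ((a :: l).Sublist (p ++ a :: q) ↔ l.Sublist q) := by
      intro a l p q hp
      induction p with
      | nil => simp
      | cons b p ihp =>
        simp only [List.mem_cons, not_or] at hp
        rw [List.cons_append, List.sublist_cons_iff, ihp hp.2]
        refine or_iff_left ?_
        rintro ⟨r, hr, -⟩
        exact hp.1 (List.cons.inj hr).1
    rw [E_ι_X]
    constructor
    · rintro ⟨h1, -, h3⟩ l hl
      cases l with
      | nil => simp
      | cons a l =>
        by_cases ha : a ∈ u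
        · obtain ⟨p, q, rfl, hp⟩ := List.exists_first ha
          obtain ⟨p', q', rfl, hp'⟩ := List.exists_first ((h1 a).1 ha)
          rw [key hp, key hp']
          exact ih.1 (h3 _ _ _ _ _ rfl hp rfl hp').2 l (by simpa using hl)
        · exact iff_of_false (fun h => ha (h.subset (by simp)))
            (fun h => ha ((h1 a).2 (h.subset (by simp))))
    · intro H
      refine ⟨fun a => ?_, by simp, ?_⟩
      · simpa using H [a] (by simp)
      · rintro a p q p' q' rfl hp rfl hp'
        refine ⟨by simp, ih.2 fun l hl => ?_⟩
        simpa only [key hp, key hp'] using H (a :: l) (by simpa using hl)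

theorem Sub2_ι {u : List A} {a b : A} : Sub2 (ι u) a b ↔ [a, b].Sublist u := by
  induction u with
  | nil =>
    refine iff_of_false (fun h => by simpa using h.mem.1) (by simp)
  | cons c u ih =>
    rw [ι_cons, Sub2_mul, ih, List.sublist_cons_iff]
    simp only [not_Sub2_letter, false_or, al_letter, Set.mem_singleton_iff, mem_al_ι]
    refine or_congr_right ⟨?_, ?_⟩
    · rintro ⟨rfl, h⟩
      exact ⟨[b], rfl, by simpa using h⟩
    · rintro ⟨r, hr, h⟩
      obtain ⟨rfl, rfl⟩ := List.cons.inj hr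
      exact ⟨rfl, by simpa using h⟩

theorem E_WI_one_of_X {n : ℕ} {u v : List A} (h : E (n + 1) ZK.X 1 (ι u) (ι v)) :
    E n ZK.WI 1 (ι u) (ι v) := by
  rw [E_ι_X_one] at h
  induction n generalizing u v with
  | zero => simp
  | succ n ih =>
    refine ⟨al_ι_eq.2 fun a => by simpa using h [a] (by simp), fun a x y x' y' h1 h2 => ?_,
      fun a x y x' y' h1 h2 => ?_, fun a b _ => ?_, fun _ _ _ _ _ _ => by simp⟩
    · obtain ⟨p, q, rfl, hp⟩ := List.exists_first (mem_al_ι.1 h1.mem)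
      obtain ⟨p', q', rfl, hp'⟩ := List.exists_first (mem_al_ι.1 h2.mem)
      obtain ⟨rfl, rfl⟩ := h1.unique (FS_ι hp)
      obtain ⟨rfl, rfl⟩ := h2.unique (FS_ι hp')
      refine ⟨by simp, ih fun l hl => ?_⟩
      have := (E_ι_X.1 (E_ι_X_one.2 h)).2.2 a p q p' q' rfl hp rfl hp'
      exact E_ι_X_one.1 this.2 l hl
    · obtain ⟨p, q, rfl, hp⟩ := List.exists_last (mem_al_ι.1 h1.mem)
      obtain ⟨p', q', rfl, hp'⟩ := List.exists_last (mem_al_ι.1 h2.mem)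
      obtain ⟨rfl, rfl⟩ := h1.unique (LS_ι hp)
      obtain ⟨rfl, rfl⟩ := h2.unique (LS_ι hp')
      refine ⟨ih fun l hl => ?_, by simp⟩
      have h' : ∀ l : List A, l.length ≤ n + 1 + 1 →
          (l.Sublist (p ++ a :: q).reverse ↔ l.Sublist (p' ++ a :: q').reverse) := fun l hl => by
        have := h l.reverse (by simpa using hl)
        rwa [← List.reverse_sublist, ← List.reverse_sublist (l₂ := p' ++ a :: q'),
          List.reverse_reverse] at this
      have := (E_ι_X.1 (E_ι_X_one.2 h')).2.2 a q.reverse p.reverse q'.reverse p'.reverse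
        (by simp) (by simpa using hp) (by simp) (by simpa using hp')
      have := E_ι_X_one.1 this.2 l.reverse (by simpa using hl)
      rwa [List.reverse_sublist, List.reverse_sublist] at this
    · rw [Sub2_ι, Sub2_ι]
      exact h _ (by simp)

end GW

theorem eqvAux_finite_index {A : Type} [Finite A] (n : ℕ) (k : ZK) (m : ℕ) :
    ∃ (D : Type) (_ : Finite D) (d : GWord A → D), ∀ u v, d u = d v → eqvAux n k m u v := by
  induction n generalizing k m with
  | zero => exact ⟨Unit, inferInstance, fun _ => (), by simp [eqvAux]⟩
  | succ n ih =>
    rcases m with _ | m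
    · exact ⟨Unit, inferInstance, fun _ => (), by simp [eqvAux]⟩
    cases k with
    | X =>
      obtain ⟨D, hD, d, h⟩ := ih .Y m
      obtain ⟨D', hD', d', h'⟩ := ih .X (m + 1)
      refine ⟨Set A × D × (A → D × D'), inferInstance,
        fun u => (u.alph, d u, fun a => (d (u.XL a), d' (u.XR a))), fun u v huv => ?_⟩
      simp only [Prod.mk.injEq, funext_iff] at huv
      exact ⟨huv.1, h _ _ huv.2.1, fun a _ => ⟨h _ _ (huv.2.2 a).1, h' _ _ (huv.2.2 a).2⟩⟩
    | Y =>
      obtain ⟨D, hD, d, h⟩ := ih .X m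
      obtain ⟨D', hD', d', h'⟩ := ih .Y (m + 1)
      refine ⟨Set A × D × (A → D' × D), inferInstance,
        fun u => (u.alph, d u, fun a => (d' (u.YL a), d (u.YR a))), fun u v huv => ?_⟩
      simp only [Prod.mk.injEq, funext_iff] at huv
      exact ⟨huv.1, h _ _ huv.2.1, fun a _ => ⟨h' _ _ (huv.2.2 a).1, h _ _ (huv.2.2 a).2⟩⟩
    | WI =>
      obtain ⟨D, hD, d, h⟩ := ih .WI m
      obtain ⟨D', hD', d', h'⟩ := ih .WI (m + 1)
      refine ⟨Set A × (A → D × D' × D' × D) × (A → A → Prop × D), inferInstance,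
        fun u => (u.alph, fun a => (d (u.XL a), d' (u.XR a), d' (u.YL a), d (u.YR a)),
          fun a b => (u.CDefined a b, d (u.Cab a b))), fun u v huv => ?_⟩
      simp only [Prod.mk.injEq, funext_iff] at huv
      refine ⟨huv.1, fun a _ => ?_, fun a _ b _ => ?_⟩
      · obtain ⟨h1, h2, h3, h4⟩ := huv.2.1 a
        exact ⟨h _ _ h1, h' _ _ h2, h' _ _ h3, h _ _ h4⟩
      · exact ⟨iff_of_eq (huv.2.2 a b).1, fun _ _ => h _ _ (huv.2.2 a b).2⟩

/-- The congruence on the free monoid given by `GW.E`. -/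
def FCon (A : Type) (k : ZK) (m n : ℕ) : Con (FreeMonoid A) where
  r u v := GW.E n k m (GW.ι u.toList) (GW.ι v.toList)
  iseqv := ⟨fun _ => GW.E.refl _ _ _ _, GW.E_ι_symm, GW.E_ι_trans⟩
  mul' h h' := by
    simp only [FreeMonoid.toList_mul, GW.ι_append]
    exact h.mul h'

instance {A : Type} [Finite A] (k : ZK) (m n : ℕ) : Finite (FCon A k m n).Quotient := by
  obtain ⟨D, hD, d, h⟩ := eqvAux_finite_index (A := A) n k m
  refine Finite.of_injective
    (fun x : (FCon A k m n).Quotient => d (GWord.ofList (Quotient.out x).toList))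
    fun x y hxy => ?_
  rw [← Quotient.out_eq x, ← Quotient.out_eq y]
  exact Quotient.sound ((GW.eqvAux_iff (GWord.accessible_ofList _)
    (GWord.accessible_ofList _)).1 (h _ _ hxy))

section FiniteMonoid

theorem exists_pow_idempotent (M : Type) [Monoid M] [Finite M] :
    ∃ n : ℕ, 1 ≤ n ∧ ∀ x : M, IsIdempotentElem (x ^ n) := by
  have h1 : ∀ x : M, ∃ n : ℕ, 1 ≤ n ∧ IsIdempotentElem (x ^ n) := by
    intro x
    obtain ⟨i, j, hij, h⟩ : ∃ i j : ℕ, i < j ∧ x ^ i = x ^ j := by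
      obtain ⟨i, j, hne, h⟩ := Finite.exists_ne_map_eq_of_infinite (fun n : ℕ => x ^ n)
      rcases lt_or_gt_of_ne hne with hlt | hlt
      · exact ⟨i, j, hlt, h⟩
      · exact ⟨j, i, hlt, h.symm⟩
    have h2 : ∀ t n : ℕ, i ≤ n → x ^ (n + t * (j - i)) = x ^ n := by
      intro t
      induction t with
      | zero => simp
      | succ t ih =>
        intro n hn
        have h3 : n + (t + 1) * (j - i) = (n + t * (j - i) - i) + j := by
          rw [add_mul]; omega
        have h4 : n + t * (j - i) - i + i = n + t * (j - i) := by omega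
        rw [h3, pow_add, ← h, ← pow_add, h4, ih n hn]
    refine ⟨(i + 1) * (j - i), Nat.mul_pos (Nat.succ_pos i) (by omega), ?_⟩
    rw [IsIdempotentElem, ← pow_add]
    exact h2 _ _ (le_trans (Nat.le_succ i) (Nat.le_mul_of_pos_right _ (by omega)))
  choose n hn hn' using h1
  have := Fintype.ofFinite M
  refine ⟨∏ x, n x, Nat.succ_le_of_lt (Finset.prod_pos fun x _ => hn x), fun x => ?_⟩
  obtain ⟨t, ht⟩ := Finset.dvd_prod_of_mem n (Finset.mem_univ x)
  rw [ht, pow_mul]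
  exact (hn' x).pow t

theorem monoidExp_spec (M : Type) [Monoid M] [Finite M] :
    1 ≤ monoidExp M ∧ ∀ x : M, IsIdempotentElem (x ^ monoidExp M) :=
  Nat.sInf_mem (s := {n : ℕ | 1 ≤ n ∧ ∀ x : M, IsIdempotentElem (x ^ n)})
    (exists_pow_idempotent M)

variable {M : Type} [Monoid M]

/-- `s * x` is Green-`R`-equivalent to `s`. -/
def RStab (s x : M) : Prop := ∃ w, s * x * w = s

/-- `x * t` is Green-`L`-equivalent to `t`. -/
def LStab (t x : M) : Prop := ∃ w, w * (x * t) = t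

theorem rGreen_mul_iff {e x : M} : rGreen (e * x) e ↔ RStab e x := by
  constructor
  · intro h
    have : e ∈ Set.range (fun z => e * x * z) := by rw [h]; exact ⟨1, mul_one e⟩
    exact this
  · rintro ⟨w, hw⟩
    ext z
    constructor
    · rintro ⟨y, rfl⟩; exact ⟨x * y, by simp only [mul_assoc]⟩
    · rintro ⟨y, rfl⟩
      refine ⟨w * y, ?_⟩
      simp only
      rw [← mul_assoc, hw]

theorem lGreen_mul_iff {e x : M} : lGreen (x * e) e ↔ LStab e x := by
  constructor
  · intro h
    have : e ∈ Set.range (fun z => z * (x * e)) := by rw [h]; exact ⟨1, one_mul e⟩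
    exact this
  · rintro ⟨w, hw⟩
    ext z
    constructor
    · rintro ⟨y, rfl⟩; exact ⟨y * x, by simp only [mul_assoc]⟩
    · rintro ⟨y, rfl⟩
      refine ⟨y * w, ?_⟩
      simp only
      rw [mul_assoc, hw]

theorem simK_iff {x y : M} : simK x y ↔
    ∀ e : M, IsIdempotentElem e → (RStab e x ∨ RStab e y) → e * x = e * y := by
  simp only [simK, rGreen_mul_iff]

theorem simD_iff {x y : M} : simD x y ↔
    ∀ e : M, IsIdempotentElem e → (LStab e x ∨ LStab e y) → x * e = y * e := by
  simp only [simD, lGreen_mul_iff]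

theorem simK.symm {x y : M} (h : simK x y) : simK y x := fun e he h' => (h e he h'.symm).symm

theorem RStab.congr {s x y : M} (h : RStab s x) (hxy : s * x = s * y) : RStab s y := by
  obtain ⟨w, hw⟩ := h
  exact ⟨w, hxy ▸ hw⟩

theorem RStab.of_mul {s x y : M} (h : RStab s (x * y)) : RStab s x := by
  obtain ⟨w, hw⟩ := h
  exact ⟨y * w, by simpa only [mul_assoc] using hw⟩

theorem simK_left {x y : M} (h : simK x y) (z : M) : simK (z * x) (z * y) := by
  have key : ∀ {x y : M}, simK x y → ∀ e : M, IsIdempotentElem e → RStab e (z * x) →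
      e * (z * x) = e * (z * y) := by
    rintro x y h e he ⟨w, hw⟩
    have hw' : e * z * x * w = e := by simpa only [mul_assoc] using hw
    have hf : IsIdempotentElem (x * w * e * z) := by
      calc x * w * e * z * (x * w * e * z) = x * w * (e * z * x * w) * e * z := by
            simp only [mul_assoc]
        _ = x * w * (e * e) * z := by rw [hw']; simp only [mul_assoc]
        _ = x * w * e * z := by rw [he.eq]
    have h1 : e * z * (x * w * e * z) = e * z := by
      calc e * z * (x * w * e * z) = e * z * x * w * e * z := by simp only [mul_assoc]
        _ = e * z := by rw [hw', he.eq]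
    have h2 := simK_iff.1 h _ hf (Or.inl ⟨w * e * z, by
      calc x * w * e * z * x * (w * e * z) = x * w * e * z * (x * w * e * z) := by
            simp only [mul_assoc]
        _ = x * w * e * z := hf⟩)
    calc e * (z * x) = e * z * (x * w * e * z) * x := by rw [h1, mul_assoc]
      _ = e * z * (x * w * e * z * y) := by rw [mul_assoc, h2]
      _ = e * z * (x * w * e * z) * y := by rw [mul_assoc (e * z)]
      _ = e * (z * y) := by rw [h1, mul_assoc]
  rw [simK_iff]
  rintro e he (h' | h')
  · exact key h e he h'
  · exact (key h.symm e he h').symm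

theorem simK_right {x y : M} (h : simK x y) (z : M) : simK (x * z) (y * z) := by
  rw [simK_iff] at h ⊢
  intro e he h'
  rw [← mul_assoc, h e he (h'.imp RStab.of_mul RStab.of_mul), mul_assoc]

/-- The relation `simK` as a congruence. -/
def simKCon (M : Type) [Monoid M] : Con M where
  r := simK
  iseqv := ⟨fun _ _ _ _ => rfl, simK.symm, fun {x y z} h h' => by
    rw [simK_iff] at *
    rintro e he (h'' | h'')
    · have := h e he (Or.inl h'')
      exact this.trans (h' e he (Or.inl (h''.congr this)))
    · have := h' e he (Or.inr h'')
      exact (h e he (Or.inr (h''.congr this.symm))).trans this⟩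
  mul' {a b c d} h h' := by
    have h1 := simK_right h c
    have h2 := simK_left h' b
    rw [simK_iff] at h1 h2 ⊢
    rintro e he (h'' | h'')
    · have := h1 e he (Or.inl h'')
      exact this.trans (h2 e he (Or.inl (h''.congr this)))
    · have := h2 e he (Or.inr h'')
      exact (h1 e he (Or.inr (h''.congr this.symm))).trans this

theorem KCon_iff {x y : M} : KCon M x y ↔ simK x y := by
  have : KCon M = simKCon M := Con.conGen_of_con (simKCon M)
  rw [this]; rfl

open MulOpposite

instance MulOpposite.instFiniteMonoid [Finite M] : Finite Mᵐᵒᵖ :=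
  Finite.of_equiv M MulOpposite.opEquiv

instance Con.instFiniteQuotient [Finite M] (c : Con M) : Finite c.Quotient :=
  Finite.of_surjective c.mk' Con.mk'_surjective

theorem RStab_op {s x : M} : RStab (op s) (op x) ↔ LStab s x := by
  constructor
  · rintro ⟨w, hw⟩
    exact ⟨w.unop, by simpa using congrArg unop hw⟩
  · rintro ⟨w, hw⟩
    exact ⟨op w, by simpa using congrArg op hw⟩

theorem simK_op {x y : M} : simK (op x) (op y) ↔ simD x y := by
  rw [simK_iff, simD_iff]
  constructor
  · intro h e he h'
    have he' : IsIdempotentElem (op e) := congrArg op he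
    have := h (op e) he' (by rwa [RStab_op, RStab_op])
    simpa using congrArg unop this
  · intro h e he h'
    induction e using MulOpposite.rec' with
    | h e =>
      rw [RStab_op, RStab_op] at h'
      have he' : IsIdempotentElem e := congrArg unop he
      exact congrArg op (h e he' h')

/-- The relation `simD` as a congruence. -/
def simDCon (M : Type) [Monoid M] : Con M where
  r := simD
  iseqv := ⟨fun _ _ _ _ => rfl, fun h => simK_op.1 (simK_op.2 h).symm, fun h h' =>
    simK_op.1 ((simKCon Mᵐᵒᵖ).trans (simK_op.2 h) (simK_op.2 h'))⟩
  mul' h h' := simK_op.1 ((simKCon Mᵐᵒᵖ).mul (simK_op.2 h') (simK_op.2 h))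

theorem DCon_iff {x y : M} : DCon M x y ↔ simD x y := by
  have : DCon M = simDCon M := Con.conGen_of_con (simDCon M)
  rw [this]; rfl

theorem exists_hom_of_ker_le {P M N : Type} [Monoid P] [Monoid M] [Monoid N] (p : P →* M)
    (q : P →* N) (hp : Function.Surjective p) (h : ∀ x y, p x = p y → q x = q y) :
    ∃ f : M →* N, ∀ x, f (p x) = q x := by
  have hker : Con.ker p ≤ Con.ker q := fun x y hxy => h x y hxy
  refine ⟨((Con.ker p).lift q hker).comp
    (Con.quotientKerEquivOfSurjective p hp).symm.toMonoidHom, fun x => ?_⟩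
  have : (Con.quotientKerEquivOfSurjective p hp).symm (p x) = ((x : P) : (Con.ker p).Quotient) := by
    rw [MulEquiv.symm_apply_eq]; rfl
  show (Con.ker p).lift q hker ((Con.quotientKerEquivOfSurjective p hp).symm (p x)) = q x
  rw [this, Con.lift_coe]

theorem simK_map [Finite M] {N : Type} [Monoid N] (f : M →* N) (hf : Function.Surjective f)
    {x y : M} (h : simK x y) : simK (f x) (f y) := by
  have key : ∀ {x y : M}, simK x y → ∀ e : N, IsIdempotentElem e → RStab e (f x) →
      e * f x = e * f y := by
    rintro x y h e he ⟨w, hw⟩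
    obtain ⟨k, hk, hidem⟩ := exists_pow_idempotent M
    have hpow : ∀ j, 1 ≤ j → e ^ j = e := fun j hj => by
      obtain ⟨j, rfl⟩ : ∃ i, j = i + 1 := ⟨j - 1, by omega⟩
      exact he.pow_succ_eq j
    obtain ⟨m, hm⟩ := hf e
    obtain ⟨w, rfl⟩ := hf w
    have h0 : f (m ^ k) = e := by rw [map_pow, hm, hpow k hk]
    have h0' := hidem m
    generalize m ^ k = e₀ at h0 h0'
    have hg : f ((e₀ * x * w * e₀) ^ k) = e := by
      rw [map_pow, map_mul, map_mul, map_mul, h0, hw, he, hpow k hk]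
    have hge : (e₀ * x * w * e₀) ^ k * e₀ = (e₀ * x * w * e₀) ^ k := by
      obtain ⟨k, rfl⟩ : ∃ j, k = j + 1 := ⟨k - 1, by omega⟩
      rw [pow_succ, mul_assoc, mul_assoc _ e₀ e₀, h0'.eq]
    have h1 := simK_iff.1 h _ (hidem (e₀ * x * w * e₀)) (Or.inl
      ⟨w * e₀ * (e₀ * x * w * e₀) ^ (k - 1), by
        calc (e₀ * x * w * e₀) ^ k * x * (w * e₀ * (e₀ * x * w * e₀) ^ (k - 1))
            = (e₀ * x * w * e₀) ^ k * e₀ * x * (w * e₀ * (e₀ * x * w * e₀) ^ (k - 1)) := by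
              rw [hge]
          _ = (e₀ * x * w * e₀) ^ k * ((e₀ * x * w * e₀) * (e₀ * x * w * e₀) ^ (k - 1)) := by
              simp only [mul_assoc]
          _ = (e₀ * x * w * e₀) ^ k := by
              rw [← pow_succ', Nat.sub_add_cancel hk, (hidem _).eq]⟩)
    have h2 := congrArg f h1
    rwa [map_mul, map_mul, hg] at h2
  rw [simK_iff]
  rintro e he (h' | h')
  · exact key h e he h'
  · exact (key h.symm e he h').symm

theorem simD_map [Finite M] {N : Type} [Monoid N] (f : M →* N) (hf : Function.Surjective f)
    {x y : M} (h : simD x y) : simD (f x) (f y) := by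
  rw [← simK_op] at h ⊢
  exact simK_map (MonoidHom.op f) (fun z => ⟨op (hf z.unop).choose, by
    simp [(hf z.unop).choose_spec]⟩) h

theorem isJTrivial_of_equations {k : ℕ} (h1 : ∀ x y : M, (x * y) ^ k * x = (x * y) ^ k)
    (h2 : ∀ x y : M, y * (x * y) ^ k = (x * y) ^ k) : IsJTrivial M := by
  intro x y h
  obtain ⟨p, q, hx⟩ : x ∈ {z | ∃ a b, z = a * y * b} := h ▸ ⟨1, 1, by simp⟩
  obtain ⟨p', q', hy⟩ : y ∈ {z | ∃ a b, z = a * x * b} := h ▸ ⟨1, 1, by simp⟩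
  have key : ∀ j : ℕ, x = (p * p') ^ j * x * (q' * q) ^ j := by
    intro j
    induction j with
    | zero => simp
    | succ j ih =>
      conv_lhs => rw [ih, hx, hy]
      rw [pow_succ, pow_succ' (q' * q)]; simp only [mul_assoc]
  have hk := key k
  conv_rhs => rw [hy, hk]
  calc x = (p * p') ^ k * x * (q' * q) ^ k := hk
    _ = p' * (p * p') ^ k * x * ((q' * q) ^ k * q') := by rw [h1, h2]
    _ = _ := by simp only [mul_assoc]

theorem IsJTrivial.mul_eq (hM : IsJTrivial M) {s x : M} (h : RStab s x) : s * x = s := by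
  obtain ⟨w, hw⟩ := h
  refine hM _ _ (Set.ext fun z => ⟨?_, ?_⟩)
  · rintro ⟨a, b, rfl⟩; exact ⟨a, x * b, by simp only [mul_assoc]⟩
  · rintro ⟨a, b, rfl⟩; exact ⟨a, w * b, (congrArg (fun z => a * z * b) hw.symm).trans (by
      simp only [mul_assoc])⟩

theorem IsJTrivial.op (hM : IsJTrivial M) : IsJTrivial Mᵐᵒᵖ := by
  intro x y h
  refine MulOpposite.unop_injective (hM _ _ (Set.ext fun z => ?_))
  have hz : MulOpposite.op z ∈ {z | ∃ a b, z = a * x * b} ↔ MulOpposite.op z ∈ {z | ∃ a b, z = a * y * b} := by rw [h]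
  have key : ∀ x : Mᵐᵒᵖ, MulOpposite.op z ∈ {z | ∃ a b, z = a * x * b} ↔
      z ∈ {z | ∃ a b, z = a * x.unop * b} := by
    intro x
    constructor
    · rintro ⟨a, b, hab⟩
      exact ⟨b.unop, a.unop, by simpa [mul_assoc] using congrArg unop hab⟩
    · rintro ⟨a, b, hab⟩
      exact ⟨MulOpposite.op b, MulOpposite.op a,
        MulOpposite.unop_injective (by simpa [mul_assoc] using hab)⟩
  rw [← key, ← key, hz]

theorem IsJTrivial.mul_eq' (hM : IsJTrivial M) {s x : M} (h : LStab s x) : x * s = s :=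
  congrArg unop (hM.op.mul_eq (RStab_op.2 h))

theorem IsJTrivial.map [Finite M] (hM : IsJTrivial M) {N : Type} [Monoid N] (f : M →* N)
    (hf : Function.Surjective f) : IsJTrivial N := by
  obtain ⟨k, hk, hidem⟩ := exists_pow_idempotent M
  obtain ⟨k, rfl⟩ : ∃ j, k = j + 1 := ⟨k - 1, by omega⟩
  refine isJTrivial_of_equations (k := k + 1) (fun x y => ?_) (fun x y => ?_)
  · obtain ⟨x, rfl⟩ := hf x
    obtain ⟨y, rfl⟩ := hf y
    simp only [← map_mul, ← map_pow]
    congr 1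
    refine hM.mul_eq ⟨y * (x * y) ^ k, ?_⟩
    calc (x * y) ^ (k + 1) * x * (y * (x * y) ^ k) = (x * y) ^ (k + 1) * ((x * y) * (x * y) ^ k) := by
          simp only [mul_assoc]
      _ = _ := by rw [← pow_succ', hidem]
  · obtain ⟨x, rfl⟩ := hf x
    obtain ⟨y, rfl⟩ := hf y
    simp only [← map_mul, ← map_pow]
    congr 1
    refine hM.mul_eq' ⟨(x * y) ^ k * x, ?_⟩
    calc (x * y) ^ k * x * (y * (x * y) ^ (k + 1)) = ((x * y) ^ k * (x * y)) * (x * y) ^ (k + 1) := by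
          simp only [mul_assoc]
      _ = _ := by rw [← pow_succ, hidem]

theorem InRLAux.map {k : ℕ} {b : Bool} {M N : Type} [i : Monoid M] [j : Monoid N] [Finite M]
    (h : InRLAux k b M i) (f : M →* N) (hf : Function.Surjective f) : InRLAux k b N j := by
  induction k generalizing b M N with
  | zero => exact IsJTrivial.map h f hf
  | succ k ih =>
    cases b with
    | true =>
      have hs : Function.Surjective ((KCon N).mk'.comp f) := Con.mk'_surjective.comp hf
      obtain ⟨g, hg⟩ := exists_hom_of_ker_le (KCon M).mk' ((KCon N).mk'.comp f)
        Con.mk'_surjective fun x y hxy => (Con.eq _).2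
          (KCon_iff.2 (simK_map f hf (KCon_iff.1 ((Con.eq _).1 hxy))))
      refine ih (M := (KCon M).Quotient) (N := (KCon N).Quotient) h g fun y => ?_
      obtain ⟨x, rfl⟩ := hs y
      exact ⟨_, hg x⟩
    | false =>
      have hs : Function.Surjective ((DCon N).mk'.comp f) := Con.mk'_surjective.comp hf
      obtain ⟨g, hg⟩ := exists_hom_of_ker_le (DCon M).mk' ((DCon N).mk'.comp f)
        Con.mk'_surjective fun x y hxy => (Con.eq _).2
          (DCon_iff.2 (simD_map f hf (DCon_iff.1 ((Con.eq _).1 hxy))))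
      refine ih (M := (DCon M).Quotient) (N := (DCon N).Quotient) h g fun y => ?_
      obtain ⟨x, rfl⟩ := hs y
      exact ⟨_, hg x⟩

theorem InRLAux.of_ker_le {k : ℕ} {b : Bool} {P M N : Type} [Monoid P] [i : Monoid M]
    [j : Monoid N] [Finite M] (h : InRLAux k b M i) (p : P →* M) (q : P →* N)
    (hp : Function.Surjective p) (hq : Function.Surjective q)
    (hpq : ∀ x y, p x = p y → q x = q y) : InRLAux k b N j := by
  obtain ⟨f, hf⟩ := exists_hom_of_ker_le p q hp hpq
  refine h.map f fun y => ?_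
  obtain ⟨x, rfl⟩ := hq y
  exact ⟨_, hf x⟩

theorem InRLAux.op {k : ℕ} {b : Bool} {M : Type} [i : Monoid M] [Finite M]
    (h : InRLAux k b M i) : InRLAux k (!b) Mᵐᵒᵖ inferInstance := by
  induction k generalizing b M with
  | zero => exact IsJTrivial.op h
  | succ k ih =>
    cases b with
    | true =>
      have hp : Function.Surjective (MonoidHom.op (KCon M).mk') := fun z =>
        ⟨MulOpposite.op (Con.mk'_surjective z.unop).choose,
          congrArg MulOpposite.op (Con.mk'_surjective z.unop).choose_spec⟩
      refine InRLAux.of_ker_le (M := (KCon M).Quotientᵐᵒᵖ) (N := (DCon Mᵐᵒᵖ).Quotient)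
        (ih (M := (KCon M).Quotient) h) (MonoidHom.op (KCon M).mk') (DCon Mᵐᵒᵖ).mk' hp
        Con.mk'_surjective fun x y hxy => (Con.eq _).2 ?_
      have h1 : KCon M x.unop y.unop := (Con.eq _).1 (congrArg unop hxy)
      rw [DCon_iff, ← simK_op]
      exact simK_map (MulEquiv.opOp M).toMonoidHom (MulEquiv.opOp M).surjective (KCon_iff.1 h1)
    | false =>
      have hp : Function.Surjective (MonoidHom.op (DCon M).mk') := fun z =>
        ⟨MulOpposite.op (Con.mk'_surjective z.unop).choose,
          congrArg MulOpposite.op (Con.mk'_surjective z.unop).choose_spec⟩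
      refine InRLAux.of_ker_le (M := (DCon M).Quotientᵐᵒᵖ) (N := (KCon Mᵐᵒᵖ).Quotient)
        (ih (M := (DCon M).Quotient) h) (MonoidHom.op (DCon M).mk') (KCon Mᵐᵒᵖ).mk' hp
        Con.mk'_surjective fun x y hxy => (Con.eq _).2 ?_
      have h1 : DCon M x.unop y.unop := (Con.eq _).1 (congrArg unop hxy)
      rw [KCon_iff]
      exact simK_op.2 (DCon_iff.1 h1)

/-- A form of membership in `DA`. -/
def IsDA (M : Type) [Monoid M] : Prop :=
  ∀ e x y z : M, IsIdempotentElem e → e = x * y * z → e * y * e = e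

theorem IsJTrivial.isDA (hM : IsJTrivial M) : IsDA M := by
  intro e x y z he h
  have h1 : e * x = e := hM.mul_eq ⟨y * z, by
    calc e * x * (y * z) = e * (x * y * z) := by simp only [mul_assoc]
      _ = e := by rw [← h, he]⟩
  have h2 : e * y = e := hM.mul_eq ⟨z, by
    calc e * y * z = e * x * y * z := by rw [h1]
      _ = e * (x * y * z) := by simp only [mul_assoc]
      _ = e := by rw [← h, he]⟩
  rw [h2, he]

theorem InRLAux.isDA {k : ℕ} {b : Bool} {M : Type} [i : Monoid M] (h : InRLAux k b M i) :
    IsDA M := by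
  induction k generalizing b M with
  | zero => exact IsJTrivial.isDA h
  | succ k ih =>
    intro e x y z he hxyz
    cases b with
    | true =>
      have h1 := ih (M := (KCon M).Quotient) h (e : (KCon M).Quotient) x y z
        (by rw [IsIdempotentElem, ← Con.coe_mul, he]) (by rw [hxyz, Con.coe_mul, Con.coe_mul])
      rw [← Con.coe_mul, ← Con.coe_mul, Con.eq, KCon_iff, simK_iff] at h1
      have h2 := h1 e he (Or.inr ⟨1, by rw [mul_one, he]⟩)
      rwa [he, ← mul_assoc, ← mul_assoc, he] at h2
    | false =>
      have h1 := ih (M := (DCon M).Quotient) h (e : (DCon M).Quotient) x y z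
        (by rw [IsIdempotentElem, ← Con.coe_mul, he]) (by rw [hxyz, Con.coe_mul, Con.coe_mul])
      rw [← Con.coe_mul, ← Con.coe_mul, Con.eq, DCon_iff, simD_iff] at h1
      have h2 := h1 e he (Or.inr ⟨1, by rw [one_mul, he]⟩)
      rwa [he, mul_assoc, he] at h2

end FiniteMonoid

namespace GW

variable {A : Type}

theorem E.split_first {n m : ℕ} {p q v : List A} {a : A}
    (h : E (n + 1) ZK.WI (m + 1) (ι (p ++ a :: q)) (ι v)) (ha : a ∉ p) :
    ∃ p' q', v = p' ++ a :: q' ∧ a ∉ p' ∧ E n ZK.WI m (ι p) (ι p') ∧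
      E n ZK.WI (m + 1) (ι q) (ι q') := by
  obtain ⟨p', q', rfl, ha'⟩ := List.exists_first (h.mem_iff.1 (show a ∈ p ++ a :: q by simp))
  exact ⟨p', q', rfl, ha', h.2.1 a _ _ _ _ (FS_ι ha) (FS_ι ha')⟩

theorem E.split_last {n m : ℕ} {p q v : List A} {a : A}
    (h : E (n + 1) ZK.WI (m + 1) (ι (p ++ a :: q)) (ι v)) (ha : a ∉ q) :
    ∃ p' q', v = p' ++ a :: q' ∧ a ∉ q' ∧ E n ZK.WI (m + 1) (ι p) (ι p') ∧
      E n ZK.WI m (ι q) (ι q') := by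
  obtain ⟨p', q', rfl, ha'⟩ := List.exists_last (h.mem_iff.1 (show a ∈ p ++ a :: q by simp))
  exact ⟨p', q', rfl, ha', h.2.2.1 a _ _ _ _ (LS_ι ha) (LS_ι ha')⟩

end GW

section Evaluation

variable {A M : Type} [Monoid M]

/-- The value of a word under a map from letters to a monoid. -/
def ev (σ : A → M) (l : List A) : M := (l.map σ).prod

@[simp] theorem ev_nil (σ : A → M) : ev σ [] = 1 := rfl

@[simp] theorem ev_cons (σ : A → M) (a : A) (l : List A) : ev σ (a :: l) = σ a * ev σ l := by
  simp [ev]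

@[simp] theorem ev_append (σ : A → M) (l l' : List A) : ev σ (l ++ l') = ev σ l * ev σ l' := by
  simp [ev]

theorem ev_op (σ : A → M) (l : List A) :
    ev (fun a => MulOpposite.op (σ a)) l = MulOpposite.op (ev σ l.reverse) := by
  induction l with
  | nil => simp
  | cons a l ih => simp [ih]

theorem ev_hom {N : Type} [Monoid N] (f : M →* N) (σ : A → M) (l : List A) :
    f (ev σ l) = ev (fun a => f (σ a)) l := by
  induction l with
  | nil => simp
  | cons a l ih => simp [ih]

theorem freeMonoid_hom_eq_ev (σ : FreeMonoid A →* M) (l : List A) :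
    σ (FreeMonoid.ofList l) = ev (fun a => σ (FreeMonoid.of a)) l := by
  induction l with
  | nil => simp
  | cons a l ih => rw [FreeMonoid.ofList_cons, map_mul, ih, ev_cons]

theorem RStab.exists_idempotent [Finite M] {s x : M} (h : RStab s x) :
    ∃ w, IsIdempotentElem (x * w) ∧ s * (x * w) = s := by
  obtain ⟨w, hw⟩ := h
  obtain ⟨k, hk, hidem⟩ := exists_pow_idempotent M
  have hpow : ∀ j, s * (x * w) ^ j = s := by
    intro j
    induction j with
    | zero => simp
    | succ j ih => rw [pow_succ, ← mul_assoc, ih, ← mul_assoc, hw]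
  obtain ⟨k, rfl⟩ : ∃ j, k = j + 1 := ⟨k - 1, by omega⟩
  refine ⟨w * (x * w) ^ k, ?_⟩
  rw [← mul_assoc, ← pow_succ']
  exact ⟨hidem _, hpow _⟩

theorem IsDA.rStab_factor [Finite M] (hM : IsDA M) {s x y z : M} (h : RStab s (x * y * z)) :
    RStab s y := by
  obtain ⟨w, h1, h2⟩ := h.exists_idempotent
  have h3 := hM (x * y * z * w) x y (z * w) h1 (by simp only [mul_assoc])
  generalize x * y * z * w = e at h2 h3
  refine ⟨e, ?_⟩
  calc s * y * e = s * e * y * e := by rw [h2]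
    _ = s * (e * y * e) := by simp only [mul_assoc]
    _ = s := by rw [h3, h2]

theorem IsDA.op (hM : IsDA M) : IsDA Mᵐᵒᵖ := by
  intro e x y z he h
  have := hM e.unop z.unop y.unop x.unop (congrArg MulOpposite.unop he)
    (by rw [h]; simp [mul_assoc])
  exact MulOpposite.unop_injective (by simpa [mul_assoc] using this)

/-- A word either stabilizes `s` up to Green's relation `R`, or has a first letter which does
not; this letter did not occur before. -/
theorem IsDA.rStab_or_drop [Finite M] (hM : IsDA M) (σ : A → M) (s : M) (u : List A) :
    RStab s (ev σ u) ∨ ∃ p a q, u = p ++ a :: q ∧ RStab s (ev σ p) ∧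
      ¬ RStab (s * ev σ p) (σ a) ∧ a ∉ p := by
  induction u using List.reverseRecOn with
  | nil => exact Or.inl ⟨1, by simp⟩
  | append_singleton u b ih =>
    rcases ih with ih | ⟨p, a, q, rfl, h1, h2, h3⟩
    · by_cases hb : RStab (s * ev σ u) (σ b)
      · left
        obtain ⟨w, hw⟩ := ih
        obtain ⟨w', hw'⟩ := hb
        refine ⟨w' * w, ?_⟩
        calc s * ev σ (u ++ [b]) * (w' * w) = s * ev σ u * σ b * w' * w := by
              simp [mul_assoc]
          _ = s := by rw [hw', hw]
      · refine Or.inr ⟨u, b, [], rfl, ih, hb, fun hmem => hb ?_⟩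
        obtain ⟨p, q, rfl⟩ := List.append_of_mem hmem
        obtain ⟨w, hw⟩ := ih
        refine hM.rStab_factor (x := w * ev σ p) (z := ev σ q) ⟨1, ?_⟩
        calc s * ev σ (p ++ b :: q) * (w * ev σ p * σ b * ev σ q) * 1
            = s * ev σ (p ++ b :: q) * w * ev σ (p ++ b :: q) := by simp [mul_assoc]
          _ = s * ev σ (p ++ b :: q) := by rw [hw]
    · exact Or.inr ⟨p, a, q ++ [b], by simp, h1, h2, h3⟩

theorem IsDA.lStab_or_drop [Finite M] (hM : IsDA M) (σ : A → M) (t : M) (v : List A) :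
    LStab t (ev σ v) ∨ ∃ p b q, v = p ++ b :: q ∧ LStab t (ev σ q) ∧
      ¬ LStab (ev σ q * t) (σ b) ∧ b ∉ q := by
  rcases hM.op.rStab_or_drop (fun a => MulOpposite.op (σ a)) (MulOpposite.op t) v.reverse with
    h | ⟨p, a, q, hv, h1, h2, h3⟩
  · rw [ev_op, List.reverse_reverse, RStab_op] at h
    exact Or.inl h
  · rw [ev_op, RStab_op] at h1
    rw [ev_op, ← MulOpposite.op_mul, RStab_op] at h2
    refine Or.inr ⟨q.reverse, a, p.reverse, ?_, h1, h2, by simpa using h3⟩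
    rw [← List.reverse_reverse v, hv]; simp

/-- The size of the right ideal generated by an element. -/
noncomputable def rHeight (s : M) : ℕ := (Set.range fun z => s * z).ncard

/-- The size of the left ideal generated by an element. -/
noncomputable def lHeight (s : M) : ℕ := rHeight (MulOpposite.op s)

theorem rHeight_lt [Finite M] (s : M) : rHeight s < Nat.card M + 1 :=
  Nat.lt_succ_of_le ((Set.ncard_le_ncard (Set.subset_univ _)).trans (Set.ncard_univ M).le)

theorem lHeight_lt [Finite M] (s : M) : lHeight s < Nat.card M + 1 := by
  have := rHeight_lt (MulOpposite.op s)
  rwa [Nat.card_congr MulOpposite.opEquiv.symm] at this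

theorem rHeight_mul_le [Finite M] (s z : M) : rHeight (s * z) ≤ rHeight s := by
  refine Set.ncard_le_ncard ?_
  rintro _ ⟨y, rfl⟩
  exact ⟨z * y, by simp only [mul_assoc]⟩

theorem rHeight_mul_lt [Finite M] {s z : M} (h : ¬ RStab s z) : rHeight (s * z) < rHeight s := by
  refine Set.ncard_lt_ncard ⟨?_, fun hsub => h ?_⟩
  · rintro _ ⟨y, rfl⟩
    exact ⟨z * y, by simp only [mul_assoc]⟩
  · exact hsub ⟨1, mul_one s⟩

theorem lHeight_mul_le [Finite M] (t z : M) : lHeight (z * t) ≤ lHeight t :=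
  rHeight_mul_le (MulOpposite.op t) (MulOpposite.op z)

theorem lHeight_mul_lt [Finite M] {t z : M} (h : ¬ LStab t z) : lHeight (z * t) < lHeight t :=
  rHeight_mul_lt (s := MulOpposite.op t) (z := MulOpposite.op z) (fun h' => h (RStab_op.1 h'))

theorem LStab.left_of_mul {t x y : M} (h : LStab t (x * y)) : LStab (y * t) x := by
  obtain ⟨w, hw⟩ := h
  refine ⟨y * w, ?_⟩
  calc y * w * (x * (y * t)) = y * (w * (x * y * t)) := by simp only [mul_assoc]
    _ = y * t := by rw [hw]

theorem LStab.of_mul {t x y : M} (h : LStab t (x * y)) : LStab t y := by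
  obtain ⟨w, hw⟩ := h
  exact ⟨w * x, by simpa only [mul_assoc] using hw⟩

/-- Words related by `≡^{WI}_{m,n}` can be exchanged between stabilized contexts. -/
def Exchange (σ : A → M) (m n : ℕ) : Prop :=
  ∀ (x y : List A) (s t : M), GW.E n ZK.WI m (GW.ι x) (GW.ι y) → RStab s (ev σ x) →
    LStab t (ev σ y) → s * ev σ x * t = s * ev σ y * t

variable [Finite M]

theorem Exchange.left {σ : A → M} {m n : ℕ} (hM : IsDA M) (H : Exchange σ m n) {N : ℕ}
    {s t : M} {u v : List A} (hs : rHeight s < N)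
    (h : GW.E (n + N) ZK.WI (m + 1) (GW.ι u) (GW.ι v)) (ht : LStab t (ev σ v)) :
    s * ev σ u * t = s * ev σ v * t := by
  induction N generalizing s u v with
  | zero => omega
  | succ N ih =>
    rcases hM.rStab_or_drop σ s u with h1 | ⟨p, a, q, rfl, h1, h2, h3⟩
    · exact H u v s t (h.pred.mono_le (by omega)) h1 ht
    · obtain ⟨p', q', rfl, -, hp, hq⟩ := h.split_first (n := n + N) h3
      have h4 := rHeight_mul_lt h2
      have h5 := rHeight_mul_le s (ev σ p)
      have ht' : LStab t (ev σ p' * (σ a * ev σ q')) := by simpa using ht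
      have e1 := ih (s := s * ev σ p * σ a) (by omega) hq (by
        rw [← mul_assoc] at ht'; exact ht'.of_mul)
      have e2 := H p p' s (σ a * ev σ q' * t) (hp.mono_le (by omega)) h1 ht'.left_of_mul
      simp only [ev_append, ev_cons, mul_assoc] at e1 e2 ⊢
      rw [e1, e2]

theorem Exchange.last_letter {σ : A → M} {m n : ℕ} (hM : IsDA M) (H : Exchange σ m n) {N : ℕ}
    {s t : M} {x y x' y' : List A} {b : A} (hs : rHeight s < N) (hb : b ∉ y) (hb' : b ∉ y')
    (h : GW.E (n + (Nat.card M + 1) + N) ZK.WI (m + 1) (GW.ι (x ++ b :: y)) (GW.ι (x' ++ b :: y')))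
    (ht : LStab t (ev σ y')) :
    s * ev σ x * σ b * ev σ y * t = s * ev σ x * σ b * ev σ y' * t := by
  induction N generalizing s x x' with
  | zero => omega
  | succ N ih =>
    rcases hM.rStab_or_drop σ s (x ++ b :: y) with h1 | ⟨p, a, q, hu, h1, h2, h3⟩
    · have hy := ((GW.E_WI_iff (n := n + (Nat.card M + 1) + N)).1 h).2.2.1 b _ _ _ _
        (GW.LS_ι hb) (GW.LS_ι hb') |>.2
      refine H y y' (s * ev σ x * σ b) t (hy.mono_le (by omega)) ?_ ht
      obtain ⟨w, hw⟩ := h1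
      refine ⟨w * (ev σ x * σ b), ?_⟩
      calc s * ev σ x * σ b * ev σ y * (w * (ev σ x * σ b))
          = s * ev σ (x ++ b :: y) * w * ev σ x * σ b := by simp [mul_assoc]
        _ = _ := by rw [hw]
    · have h4 := rHeight_mul_lt h2
      have h5 := rHeight_mul_le s (ev σ p)
      rw [hu] at h
      obtain ⟨p', q', hv, h3', hp, hq⟩ := h.split_first (n := n + (Nat.card M + 1) + N) h3
      have hmem := hq.mono_le (n := n + Nat.card M + 1) (by omega)
      by_cases hbq : b ∈ q
      · obtain ⟨q₁, q₂, rfl, hb1⟩ := List.exists_last hbq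
        obtain ⟨q₁', q₂', rfl, hb1'⟩ := List.exists_last (hmem.mem_iff.1 hbq)
        obtain ⟨rfl, rfl⟩ := List.last_unique
          (p' := p ++ a :: q₁) (q' := q₂) (by rw [hu]; simp) hb hb1
        obtain ⟨rfl, rfl⟩ := List.last_unique
          (p' := p' ++ a :: q₁') (q' := q₂') (by rw [hv]; simp) hb' hb1'
        have e1 := ih (s := s * ev σ p * σ a) (x := q₁) (x' := q₁') (by omega) hq
        simpa [mul_assoc] using e1
      · have hbq' : b ∉ q' := fun hb => hbq (hmem.mem_iff.2 hb)
        by_cases hab : a = b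
        · subst hab
          obtain ⟨rfl, rfl⟩ := List.last_unique hu hb hbq
          obtain ⟨rfl, rfl⟩ := List.last_unique hv hb' hbq'
          exact H.left hM (rHeight_lt _) (hq.mono_le (by omega)) ht
        · have hbp : b ∈ p := by
            have : b ∈ p ++ a :: q := by rw [← hu]; simp
            simpa [hbq, Ne.symm hab] using this
          have hbp' : b ∈ p' := by
            have : b ∈ p' ++ a :: q' := by rw [← hv]; simp
            simpa [hbq', Ne.symm hab] using this
          obtain ⟨x₁, c, rfl, hc⟩ := List.exists_last hbp
          obtain ⟨x₁', c', rfl, hc'⟩ := List.exists_last hbp'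
          have hcq : b ∉ c ++ a :: q := by simp [hc, hbq, Ne.symm hab]
          have hcq' : b ∉ c' ++ a :: q' := by simp [hc', hbq', Ne.symm hab]
          obtain ⟨rfl, rfl⟩ := List.last_unique
            (p' := x₁) (q' := c ++ a :: q) (by rw [hu]; simp) hb hcq
          obtain ⟨rfl, rfl⟩ := List.last_unique
            (p' := x₁') (q' := c' ++ a :: q') (by rw [hv]; simp) hb' hcq'
          rw [← hu, hv, List.append_assoc, List.cons_append] at h
          have hcc := ((GW.E_WI_iff (n := n + (Nat.card M + 1) + N)).1 h).2.2.2.2 a b _ _ 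
            (GW.CS_ι h3 hcq) (GW.CS_ι h3' hcq')
          have ht' : LStab t (ev σ c' * (σ a * ev σ q')) := by simpa using ht
          have e1 := H.left hM (s := s * ev σ x * σ b * ev σ c * σ a) (t := t)
            (rHeight_lt _) (hq.mono_le (by omega)) (by
              rw [← mul_assoc] at ht'; exact ht'.of_mul)
          have e2 := H c c' (s * ev σ x * σ b) (σ a * ev σ q' * t) (hcc.mono_le (by omega)) (by
            obtain ⟨w, hw⟩ := h1
            refine ⟨w * (ev σ x * σ b), ?_⟩
            calc s * ev σ x * σ b * ev σ c * (w * (ev σ x * σ b))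
                = s * ev σ (x ++ b :: c) * w * ev σ x * σ b := by simp [mul_assoc]
              _ = _ := by rw [hw]) ht'.left_of_mul
          simp only [ev_append, ev_cons, mul_assoc] at e1 e2 ⊢
          rw [e1, e2]

theorem Exchange.all {σ : A → M} {m n : ℕ} (hM : IsDA M) (H : Exchange σ m n) {N : ℕ}
    {s t : M} {u v : List A} (ht : lHeight t < N)
    (h : GW.E (n + (Nat.card M + 1) + (Nat.card M + 1) + N) ZK.WI (m + 1) (GW.ι u) (GW.ι v)) :
    s * ev σ u * t = s * ev σ v * t := by
  induction N generalizing t u v with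
  | zero => omega
  | succ N ih =>
    rcases hM.lStab_or_drop σ t v with h1 | ⟨v', b, y', rfl, h1, h2, h3⟩
    · exact H.left hM (rHeight_lt s) (h.mono_le (by omega)) h1
    · have h4 := lHeight_mul_lt h2
      have h5 := lHeight_mul_le t (ev σ y')
      obtain ⟨u', y, rfl, h3', hu, -⟩ := (GW.E_ι_symm h).split_last h3
      have e1 := ih (t := σ b * (ev σ y' * t)) (by omega) (GW.E_ι_symm hu)
      have e2 := H.last_letter hM (rHeight_lt s) h3' h3 (h.mono_le (by omega)) h1
      simp only [ev_append, ev_cons, mul_assoc] at e1 e2 ⊢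
      rw [e2, e1]

theorem Exchange.ev_eq {σ : A → M} {m n : ℕ} (hM : IsDA M) (H : Exchange σ m n)
    {u v : List A} (h : GW.E (n + (Nat.card M + 1) + (Nat.card M + 1) + (Nat.card M + 1))
      ZK.WI (m + 1) (GW.ι u) (GW.ι v)) :
    ev σ u = ev σ v := by
  simpa using H.all hM (s := 1) (lHeight_lt 1) h

end Evaluation

section Soundness

variable {A M : Type} [Monoid M]

/-- The join of the congruences `simK` and `simD`. -/
def simKDCon (M : Type) [Monoid M] : Con M where
  r := Relation.EqvGen fun x y => simK x y ∨ simD x y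
  iseqv := Relation.EqvGen.is_equivalence _
  mul' {a b c d} h h' := by
    have h1 : Relation.EqvGen (fun x y => simK x y ∨ simD x y) (a * c) (b * c) := by
      induction h with
      | rel x y h => exact .rel _ _ (h.imp (fun h => (simKCon M).mul h ((simKCon M).refl c))
          fun h => (simDCon M).mul h ((simDCon M).refl c))
      | refl x => exact .refl _
      | symm x y _ ih => exact .symm _ _ ih
      | trans x y z _ _ ih ih' => exact .trans _ _ _ ih ih'
    have h2 : Relation.EqvGen (fun x y => simK x y ∨ simD x y) (b * c) (b * d) := by
      clear h h1
      induction h' with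
      | rel x y h => exact .rel _ _ (h.imp (fun h => (simKCon M).mul ((simKCon M).refl b) h)
          fun h => (simDCon M).mul ((simDCon M).refl b) h)
      | refl x => exact .refl _
      | symm x y _ ih => exact .symm _ _ ih
      | trans x y z _ _ ih ih' => exact .trans _ _ _ ih ih'
    exact h1.trans _ _ _ h2

theorem simKDCon.sandwich {x y : M} (h : simKDCon M x y) {e f : M} (he : IsIdempotentElem e)
    (hf : IsIdempotentElem f) :
    (e * x * e = e ↔ e * y * e = e) ∧ (f * x * f = f ↔ f * y * f = f) ∧
      (e * x * e = e → f * x * f = f → e * x * f = e * y * f) := by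
  have hiff : ∀ {x y : M}, simK x y ∨ simD x y → ∀ e : M, IsIdempotentElem e →
      e * x * e = e → e * y * e = e := by
    rintro x y (h | h) e he hx
    · rwa [← simK_iff.1 h e he (Or.inl ⟨e, hx⟩)]
    · rwa [mul_assoc, ← simD_iff.1 h e he (Or.inl ⟨e, by rwa [← mul_assoc]⟩), ← mul_assoc]
  have hiff' : ∀ {x y : M}, simK x y ∨ simD x y → ∀ e : M, IsIdempotentElem e →
      (e * x * e = e ↔ e * y * e = e) := fun h e he => ⟨hiff h e he, hiff (h.imp simK.symm
        fun h => (simDCon _).symm h) e he⟩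
  induction h with
  | rel x y h =>
    refine ⟨hiff' h e he, hiff' h f hf, fun h1 h2 => ?_⟩
    rcases h with h | h
    · rw [simK_iff.1 h e he (Or.inl ⟨e, h1⟩)]
    · rw [mul_assoc, simD_iff.1 h f hf (Or.inl ⟨f, by rwa [← mul_assoc]⟩), ← mul_assoc]
  | refl x => exact ⟨Iff.rfl, Iff.rfl, fun _ _ => rfl⟩
  | symm x y _ ih => exact ⟨ih.1.symm, ih.2.1.symm, fun h1 h2 =>
      (ih.2.2 (ih.1.2 h1) (ih.2.1.2 h2)).symm⟩
  | trans x y z _ _ ih ih' => exact ⟨ih.1.trans ih'.1, ih.2.1.trans ih'.2.1, fun h1 h2 =>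
      (ih.2.2 h1 h2).trans (ih'.2.2 (ih.1.1 h1) (ih.2.1.1 h2))⟩

variable [Finite M]

theorem LStab.exists_idempotent {t x : M} (h : LStab t x) :
    ∃ w, IsIdempotentElem (w * x) ∧ w * x * t = t := by
  obtain ⟨w, h1, h2⟩ := (RStab_op.2 h).exists_idempotent
  exact ⟨w.unop, congrArg MulOpposite.unop h1, by simpa using congrArg MulOpposite.unop h2⟩

theorem mul_eq_of_simK {s x y : M} (hs : RStab s x) (h : simK x y) : s * x = s * y := by
  obtain ⟨w, h1, h2⟩ := hs.exists_idempotent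
  have h3 := simK_iff.1 h _ h1 (Or.inl ⟨w, by rw [mul_assoc, h1.eq]⟩)
  rw [← h2, mul_assoc, h3, ← mul_assoc]

theorem mul_eq_of_isJTrivial_KCon (h : IsJTrivial (KCon M).Quotient) {s x : M}
    (hs : RStab s x) : s * x = s := by
  obtain ⟨w, h1, h2⟩ := hs.exists_idempotent
  have h3 := h.mul_eq (s := ((x * w : M) : (KCon M).Quotient)) (x := x)
    ⟨w, by rw [← Con.coe_mul, ← Con.coe_mul, mul_assoc, h1.eq]⟩
  rw [← Con.coe_mul, Con.eq, KCon_iff] at h3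
  have h4 := simK_iff.1 h3 _ h1 (Or.inr ⟨1, by rw [mul_one, h1.eq]⟩)
  rw [h1.eq, ← mul_assoc, h1.eq] at h4
  rw [← h2, mul_assoc, h4]

theorem mul_eq_of_isJTrivial_DCon (h : IsJTrivial (DCon M).Quotient) {t x : M}
    (ht : LStab t x) : x * t = t := by
  obtain ⟨w, h1, h2⟩ := ht.exists_idempotent
  have h3 := h.mul_eq' (s := ((w * x : M) : (DCon M).Quotient)) (x := x)
    ⟨w, by rw [← Con.coe_mul, ← Con.coe_mul, ← mul_assoc, h1.eq]⟩
  rw [← Con.coe_mul, Con.eq, DCon_iff] at h3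
  have h4 := simD_iff.1 h3 _ h1 (Or.inr ⟨1, by rw [one_mul, h1.eq]⟩)
  rw [h1.eq, mul_assoc, h1.eq] at h4
  conv_lhs => rw [← h2]
  rw [← mul_assoc, h4, h2]

theorem ev_eq_of_E_WI {m : ℕ} (hR : InRLAux (m + 1) true M inferInstance)
    (hL : InRLAux (m + 1) false M inferInstance) (σ : A → M) :
    ∃ n, ∀ u v : List A, GW.E n ZK.WI (m + 1) (GW.ι u) (GW.ι v) → ev σ u = ev σ v := by
  have hM : IsDA M := hR.isDA
  suffices ∃ n, Exchange σ m n from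
    let ⟨_, hn⟩ := this
    ⟨_, fun u v h => hn.ev_eq hM h⟩
  induction m generalizing M with
  | zero =>
    refine ⟨0, fun x y s t _ hs ht => ?_⟩
    rw [mul_eq_of_isJTrivial_KCon hR hs, mul_assoc, mul_eq_of_isJTrivial_DCon hL ht]
  | succ m ih =>
    have hN1 : InRLAux (m + 1) true (simKDCon M).Quotient inferInstance :=
      InRLAux.of_ker_le (M := (DCon M).Quotient) hL (DCon M).mk' (simKDCon M).mk'
        Con.mk'_surjective Con.mk'_surjective fun x y h => (Con.eq _).2
          (.rel _ _ (Or.inr (DCon_iff.1 ((Con.eq _).1 h))))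
    have hN2 : InRLAux (m + 1) false (simKDCon M).Quotient inferInstance :=
      InRLAux.of_ker_le (M := (KCon M).Quotient) hR (KCon M).mk' (simKDCon M).mk'
        Con.mk'_surjective Con.mk'_surjective fun x y h => (Con.eq _).2
          (.rel _ _ (Or.inl (KCon_iff.1 ((Con.eq _).1 h))))
    obtain ⟨n, hn⟩ := ih hN1 hN2 (fun a => (σ a : (simKDCon M).Quotient)) hN1.isDA
    refine ⟨n + (Nat.card (simKDCon M).Quotient + 1) + (Nat.card (simKDCon M).Quotient + 1) +
      (Nat.card (simKDCon M).Quotient + 1), fun x y s t h hs ht => ?_⟩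
    have h1 := hn.ev_eq hN1.isDA h
    have h2 : simKDCon M (ev σ x) (ev σ y) := by
      rw [← Con.eq]
      exact (ev_hom (simKDCon M).mk' σ x).trans (h1.trans (ev_hom (simKDCon M).mk' σ y).symm)
    obtain ⟨w, he, hse⟩ := hs.exists_idempotent
    obtain ⟨w', hf, hft⟩ := ht.exists_idempotent
    have h3 := hM _ 1 (ev σ x) w he (by rw [one_mul])
    have h4 := hM _ w' (ev σ y) 1 hf (by rw [mul_one])
    obtain ⟨-, h5, h6⟩ := simKDCon.sandwich h2 he hf
    have h7 := h6 h3 (h5.2 h4)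
    generalize ev σ x * w = e at *
    generalize w' * ev σ y = f at *
    calc s * ev σ x * t = s * (e * ev σ x * f) * t := by
          conv_lhs => rw [← hse, ← hft]
          simp only [mul_assoc]
      _ = s * e * ev σ y * (f * t) := by rw [h7]; simp only [mul_assoc]
      _ = _ := by rw [hse, hft]

theorem mul_ev_eq_of_E_X {σ : A → M} {n k : ℕ}
    (H : ∀ u v : List A, GW.E n ZK.Y k (GW.ι u) (GW.ι v) → simK (ev σ u) (ev σ v)) {N : ℕ}
    (hM : IsDA M) {s : M} (hs : rHeight s < N) {u v : List A}
    (h : GW.E (n + N) ZK.X (k + 1) (GW.ι u) (GW.ι v)) : s * ev σ u = s * ev σ v := by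
  induction N generalizing s u v with
  | zero => omega
  | succ N ih =>
    obtain ⟨h0, h1, h2⟩ := (GW.E_ι_X (n := n + N)).1 h
    rcases hM.rStab_or_drop σ s u with h3 | ⟨p, a, q, rfl, h3, h4, h5⟩
    · exact mul_eq_of_simK h3 (H u v (h1.mono_le (by omega)))
    · obtain ⟨p', q', rfl, ha'⟩ := List.exists_first ((h0 a).1 (by simp))
      obtain ⟨hp, hq⟩ := h2 a p q p' q' rfl h5 rfl ha'
      have e1 := mul_eq_of_simK h3 (H p p' (hp.mono_le (by omega)))
      have h6 := rHeight_mul_lt h4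
      have h7 := rHeight_mul_le s (ev σ p)
      have e2 := ih (s := s * ev σ p * σ a) (by omega) hq
      simp only [ev_append, ev_cons, ← mul_assoc] at e1 e2 ⊢
      rw [e2, e1]

theorem ev_eq_of_E_Y_of_X {k : ℕ} (h : InRLAux k false M inferInstance)
    (H : ∀ (M : Type) [Monoid M] [Finite M] (σ : A → M), InRLAux k true M inferInstance →
      ∃ n, ∀ u v : List A, GW.E n ZK.X (k + 1) (GW.ι u) (GW.ι v) → ev σ u = ev σ v) (σ : A → M) :
    ∃ n, ∀ u v : List A, GW.E n ZK.Y (k + 1) (GW.ι u) (GW.ι v) → ev σ u = ev σ v := by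
  obtain ⟨n, hn⟩ := H Mᵐᵒᵖ (fun a => MulOpposite.op (σ a)) h.op
  refine ⟨n, fun u v huv => ?_⟩
  have := hn u.reverse v.reverse (by
    rw [← GW.rev_ι, ← GW.rev_ι, GW.E_rev_iff]; exact huv)
  rw [ev_op, ev_op, List.reverse_reverse, List.reverse_reverse] at this
  exact MulOpposite.op_injective this

theorem ev_eq_of_E_X {k : ℕ} (h : InRLAux k true M inferInstance) (σ : A → M) :
    ∃ n, ∀ u v : List A, GW.E n ZK.X (k + 1) (GW.ι u) (GW.ι v) → ev σ u = ev σ v := by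
  induction k generalizing M with
  | zero =>
    have hJ : IsJTrivial M := h
    have hE : Exchange σ 0 0 := fun x y s t _ hs ht => by
      rw [hJ.mul_eq hs, mul_assoc, hJ.mul_eq' ht]
    exact ⟨_, fun u v huv => hE.ev_eq hJ.isDA (GW.E_WI_one_of_X huv)⟩
  | succ k ih =>
    obtain ⟨n, hn⟩ := ev_eq_of_E_Y_of_X (M := (KCon M).Quotient) h (fun M _ _ σ hM => ih hM σ)
      (fun a => (σ a : (KCon M).Quotient))
    refine ⟨n + (Nat.card M + 1), fun u v huv => ?_⟩
    have := mul_ev_eq_of_E_X (σ := σ) (fun u v huv => ?_) h.isDA (rHeight_lt 1) huv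
    · simpa using this
    · rw [← KCon_iff, ← Con.eq]
      exact (ev_hom (KCon M).mk' σ u).trans ((hn u v huv).trans (ev_hom (KCon M).mk' σ v).symm)

theorem ev_eq_of_E_Y {k : ℕ} (h : InRLAux k false M inferInstance) (σ : A → M) :
    ∃ n, ∀ u v : List A, GW.E n ZK.Y (k + 1) (GW.ι u) (GW.ι v) → ev σ u = ev σ v :=
  ev_eq_of_E_Y_of_X h (fun _ _ _ σ hM => ev_eq_of_E_X hM σ) σ

end Soundness

namespace GW

variable {A : Type}

theorem E_X_iff_E_Y_one {n : ℕ} {u v : List A} :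
    E n ZK.X 1 (ι u) (ι v) ↔ E n ZK.Y 1 (ι u) (ι v) := by
  have : E n ZK.Y 1 (ι u) (ι v) ↔ E n ZK.X 1 (ι u.reverse) (ι v.reverse) := by
    rw [← rev_ι, ← rev_ι, E_rev_iff]; rfl
  rw [this, E_ι_X_one, E_ι_X_one]
  constructor
  · intro h l hl
    rw [← List.reverse_sublist, List.reverse_reverse, ← List.reverse_sublist (l₂ := v.reverse),
      List.reverse_reverse]
    exact h _ (by simpa using hl)
  · intro h l hl
    rw [← List.reverse_sublist, ← List.reverse_sublist (l₂ := v)]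
    exact h _ (by simpa using hl)

theorem E_X_pow_mul {n m : ℕ} {w : List A} {u v : GW A} (hu : al u ⊆ al (ι w))
    (hv : al v ⊆ al (ι w)) (h : E n ZK.Y m u v) :
    E n ZK.X (m + 1) (ι w ^ n * u) (ι w ^ n * v) := by
  induction n with
  | zero => simp
  | succ n ih =>
    have hal : ∀ {u : GW A}, al u ⊆ al (ι w) → al (ι w ^ (n + 1) * u) = al (ι w) := by
      intro u hu
      rw [al_mul, al_pow _ (Nat.succ_ne_zero n), Set.union_eq_left.2 hu]
    refine ⟨(hal hu).trans (hal hv).symm, (E.refl _ _ _ _).mul h.mono,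
      fun a x y x' y' h1 h2 => ?_⟩
    have ha : a ∈ w := by
      have := h1.mem
      rwa [hal hu, mem_al_ι] at this
    obtain ⟨p, q, hw, hp⟩ := List.exists_first ha
    have key : ∀ u : GW A, FS (ι w ^ (n + 1) * u) a (ι p) (ι q * (ι w ^ n * u)) := fun u => by
      refine ⟨?_, by simpa using hp⟩
      rw [pow_succ', mul_assoc]
      have h3 : ι w = ι p * letter a * ι q := by rw [hw, ι_split]
      conv_lhs => enter [1]; rw [h3]
      simp only [mul_assoc]
    obtain ⟨rfl, rfl⟩ := h1.unique (key u)
    obtain ⟨rfl, rfl⟩ := h2.unique (key v)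
    exact ⟨E.refl _ _ _ _, (E.refl _ _ _ _).mul (ih h.mono)⟩

theorem Sub2_iff_of_E_X {n m : ℕ} {u v : List A} (h : E (n + 2) ZK.X (m + 1) (ι u) (ι v))
    (a b : A) : Sub2 (ι u) a b ↔ Sub2 (ι v) a b := by
  obtain ⟨h0, -, h2⟩ := (E_ι_X (n := n + 1)).1 h
  by_cases ha : a ∈ u
  · obtain ⟨p, q, rfl, hp⟩ := List.exists_first ha
    obtain ⟨p', q', rfl, hp'⟩ := List.exists_first ((h0 a).1 ha)
    rw [(FS_ι hp).Sub2_iff, (FS_ι hp').Sub2_iff, mem_al_ι, mem_al_ι]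
    exact (h2 a p q p' q' rfl hp rfl hp').2.mem_iff
  · have ha' : a ∉ v := fun h => ha ((h0 a).2 h)
    exact iff_of_false (fun h => ha (mem_al_ι.1 h.mem.1)) (fun h => ha' (mem_al_ι.1 h.mem.1))

theorem LS.Sub2_iff_mem_left {u : GW A} {a c : A} {x y : GW A} (h : LS u a x y) :
    Sub2 u c a ↔ c ∈ al x := by
  rw [← Sub2_rev, (LS_iff_rev.1 h).Sub2_iff, al_rev]

theorem E_X_left_of_last {n m : ℕ} {a : A} {x y x' y' : List A}
    (h : E (n + 1) ZK.X m (ι (x ++ a :: y)) (ι (x' ++ a :: y'))) (hy : a ∉ y) (hy' : a ∉ y') :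
    E n ZK.X m (ι x) (ι x') := by
  rcases m with _ | m
  · simp
  induction n generalizing x x' with
  | zero => simp
  | succ n ih =>
    have hS := Sub2_iff_of_E_X h
    obtain ⟨-, h1, h2⟩ := (E_ι_X (n := n + 1)).1 h
    refine E_ι_X.2 ⟨fun c => ?_, ?_, fun c p q p' q' hx hp hx' hp' => ?_⟩
    · have := hS c a
      rwa [(LS_ι hy).Sub2_iff_mem_left, (LS_ι hy').Sub2_iff_mem_left, mem_al_ι, mem_al_ι] at this
    · rcases m with _ | m
      · simp
      · exact (h1.2.2 a _ _ _ _ (LS_ι hy) (LS_ι hy')).1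
    · subst hx hx'
      obtain ⟨h3, h4⟩ := h2 c p (q ++ a :: y) p' (q' ++ a :: y') (by simp) hp (by simp) hp'
      exact ⟨h3.mono, ih h4⟩

theorem E_X_left_of_first {n m : ℕ} {a : A} {x y x' y' : List A}
    (h : E (n + 1) ZK.X (m + 2) (ι (x ++ a :: y)) (ι (x' ++ a :: y'))) (hx : a ∉ x)
    (hx' : a ∉ x') : E n ZK.X (m + 2) (ι x) (ι x') := by
  induction n generalizing x x' with
  | zero => simp
  | succ n ih =>
    obtain ⟨-, -, h2⟩ := (E_ι_X (n := n + 1)).1 h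
    have h3 := (h2 a _ _ _ _ rfl hx rfl hx').1
    refine E_ι_X.2 ⟨fun c => h3.mem_iff, h3.mono, fun c p q p' q' hpq hp hpq' hp' => ?_⟩
    subst hpq hpq'
    obtain ⟨h3, h4⟩ := h2 c p (q ++ a :: y) p' (q' ++ a :: y') (by simp) hp (by simp) hp'
    exact ⟨h3.mono, ih h4 (fun h => hx (by simp [h])) (fun h => hx' (by simp [h]))⟩

theorem E_ι_reverse_iff {n : ℕ} {k : ZK} {m : ℕ} {u v : List A} :
    E n k m (ι u.reverse) (ι v.reverse) ↔ E n k.dual m (ι u) (ι v) := by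
  rw [← rev_ι, ← rev_ι, E_rev_iff]

theorem E_Y_right_of_last {n m : ℕ} {a : A} {x y x' y' : List A}
    (h : E (n + 1) ZK.Y (m + 2) (ι (x ++ a :: y)) (ι (x' ++ a :: y'))) (hy : a ∉ y)
    (hy' : a ∉ y') : E n ZK.Y (m + 2) (ι y) (ι y') := by
  have h1 : E (n + 1) ZK.X (m + 2) (ι (x ++ a :: y).reverse) (ι (x' ++ a :: y').reverse) :=
    E_ι_reverse_iff.2 h
  simp only [List.reverse_append, List.reverse_cons, List.append_assoc,
    List.singleton_append] at h1
  exact E_ι_reverse_iff.1 (E_X_left_of_first h1 (by simpa using hy) (by simpa using hy'))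

theorem CS.exists_ι {u : List A} {a b : A} {c : GW A} (h : CS (ι u) a b c) :
    ∃ x d y, u = (x ++ b :: d) ++ a :: y ∧ a ∉ x ++ b :: d ∧ b ∉ d ∧ c = ι d := by
  obtain ⟨x, y, h1, h2⟩ := h
  obtain ⟨p, q, rfl, hp⟩ := List.exists_first (mem_al_ι.1 h1.mem)
  obtain ⟨h3, -⟩ := h1.unique (FS_ι hp)
  have h4 : LS (ι p) b x c := ⟨h3.symm, fun hb => h2.2 (by simp [hb])⟩
  obtain ⟨x, d, rfl, hd⟩ := List.exists_last (mem_al_ι.1 h4.mem)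
  exact ⟨x, d, q, rfl, hp, hd, (h4.unique (LS_ι hd)).2⟩

theorem E_WI_of_E_X {n m : ℕ} {u v : List A} (h : E (2 * n) ZK.X (m + 1) (ι u) (ι v)) :
    E n ZK.WI m (ι u) (ι v) := by
  induction n generalizing m u v with
  | zero => simp
  | succ n ih =>
    have ihY : ∀ {m : ℕ} {u v : List A}, E (2 * n) ZK.Y (m + 1) (ι u) (ι v) →
        E n ZK.WI m (ι u) (ι v) := fun h => E_ι_reverse_iff.1 (ih (E_ι_reverse_iff.2 h))
    rcases m with _ | m
    · simp
    rw [mul_add, mul_one] at h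
    have hS := Sub2_iff_of_E_X h
    obtain ⟨h0, h1, h2⟩ := (E_ι_X (n := 2 * n + 1)).1 h
    refine ⟨al_ι_eq.2 h0, fun a x y x' y' hx hx' => ?_, fun a x y x' y' hx hx' => ?_,
      fun a b _ => hS a b, fun a b c c' hc hc' => ?_⟩
    · obtain ⟨p, q, rfl, hp⟩ := List.exists_first (mem_al_ι.1 hx.mem)
      obtain ⟨p', q', rfl, hp'⟩ := List.exists_first (mem_al_ι.1 hx'.mem)
      obtain ⟨rfl, rfl⟩ := hx.unique (FS_ι hp)
      obtain ⟨rfl, rfl⟩ := hx'.unique (FS_ι hp')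
      obtain ⟨h3, h4⟩ := h2 a p q p' q' rfl hp rfl hp'
      exact ⟨ihY h3.mono, ih h4.mono⟩
    · obtain ⟨p, q, rfl, hq⟩ := List.exists_last (mem_al_ι.1 hx.mem)
      obtain ⟨p', q', rfl, hq'⟩ := List.exists_last (mem_al_ι.1 hx'.mem)
      obtain ⟨rfl, rfl⟩ := hx.unique (LS_ι hq)
      obtain ⟨rfl, rfl⟩ := hx'.unique (LS_ι hq')
      refine ⟨ih (E_X_left_of_last h hq hq').mono, ?_⟩
      rcases m with _ | m
      · simp
      · exact ihY (E_Y_right_of_last h1 hq hq')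
    · obtain ⟨x, d, y, rfl, ha, hb, rfl⟩ := hc.exists_ι
      obtain ⟨x', d', y', rfl, ha', hb', rfl⟩ := hc'.exists_ι
      rcases m with _ | m
      · simp
      · exact ihY (E_Y_right_of_last (h2 a _ _ _ _ rfl ha rfl ha').1 hb hb')

theorem E_WI_of_E_Y {n m : ℕ} {u v : List A} (h : E (2 * n) ZK.Y (m + 1) (ι u) (ι v)) :
    E n ZK.WI m (ι u) (ι v) :=
  E_ι_reverse_iff.1 (E_WI_of_E_X (E_ι_reverse_iff.2 h))

theorem rev_pow (u : GW A) (n : ℕ) : rev (u ^ n) = rev u ^ n := by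
  induction n with
  | zero => simp
  | succ n ih => rw [pow_succ, rev_mul, ih, pow_succ']

theorem ι_toList_pow (w : FreeMonoid A) (n : ℕ) : ι (w ^ n).toList = ι w.toList ^ n := by
  induction n with
  | zero => simp
  | succ n ih => rw [pow_succ, FreeMonoid.toList_mul, ι_append, ih, pow_succ]

end GW

section Completeness

variable {A : Type}

theorem FCon_iff {k : ZK} {m n : ℕ} {u v : FreeMonoid A} :
    FCon A k m n u v ↔ GW.E n k m (GW.ι u.toList) (GW.ι v.toList) := Iff.rfl

theorem isJTrivial_FCon_X_one (n : ℕ) : IsJTrivial (FCon A ZK.X 1 n).Quotient := by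
  have hX : ∀ x y : FreeMonoid A, FCon A ZK.X 1 n ((x * y) ^ n * x) ((x * y) ^ n) := by
    intro x y
    have := GW.E_X_pow_mul (n := n) (m := 0) (w := (x * y).toList) (u := GW.ι x.toList) (v := 1)
      (by simp) (by simp) (by simp)
    rw [FCon_iff, FreeMonoid.toList_mul, GW.ι_append, GW.ι_toList_pow]
    simpa using this
  have hY : ∀ x y : FreeMonoid A, FCon A ZK.X 1 n (y * (x * y) ^ n) ((x * y) ^ n) := by
    intro x y
    have := GW.E_X_pow_mul (n := n) (m := 0) (w := (x * y).toList.reverse)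
      (u := GW.ι y.toList.reverse) (v := 1)
      (by simp) (by simp) (by simp)
    rw [FCon_iff, GW.E_X_iff_E_Y_one, FreeMonoid.toList_mul, GW.ι_append, GW.ι_toList_pow]
    refine (GW.E_rev_iff (k := ZK.X)).1 ?_
    rw [GW.rev_mul, GW.rev_pow, GW.rev_ι, GW.rev_ι]
    rwa [mul_one] at this
  refine isJTrivial_of_equations (k := n) (fun x y => ?_) (fun x y => ?_)
  · induction x using Con.induction_on with | H x => ?_
    induction y using Con.induction_on with | H y => ?_
    exact (Con.eq _).2 (hX x y)
  · induction x using Con.induction_on with | H x => ?_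
    induction y using Con.induction_on with | H y => ?_
    exact (Con.eq _).2 (hY x y)

theorem simK_FCon {n m : ℕ} {u v : FreeMonoid A} (h : FCon A ZK.Y (m + 1) n u v) :
    simK (u : (FCon A ZK.X (m + 2) n).Quotient) v := by
  have key : ∀ {u v : FreeMonoid A}, FCon A ZK.Y (m + 1) n u v →
      ∀ e : (FCon A ZK.X (m + 2) n).Quotient, IsIdempotentElem e → RStab e u →
        e * u = e * v := by
    rintro u v h e he ⟨z, hz⟩
    induction e using Con.induction_on with | H w => ?_
    induction z using Con.induction_on with | H z => ?_
    rw [← Con.coe_mul, ← Con.coe_mul, Con.eq, FCon_iff] at hz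
    rcases n with _ | n
    · exact (Con.eq _).2 GW.E_zero
    have hu : ∀ a, a ∈ u.toList → a ∈ w.toList := fun a ha => by
      rw [← hz.mem_iff]; simp [ha]
    have hv : ∀ a, a ∈ v.toList → a ∈ w.toList := fun a ha =>
      hu a ((FCon_iff.1 h).mem_iff.2 ha)
    have h1 := GW.E_X_pow_mul (w := w.toList) (fun a ha => GW.mem_al_ι.2 (hu a (GW.mem_al_ι.1 ha)))
      (fun a ha => GW.mem_al_ι.2 (hv a (GW.mem_al_ι.1 ha))) h
    have h2 : (((w ^ (n + 1) * u : FreeMonoid A)) : (FCon A ZK.X (m + 2) (n + 1)).Quotient) =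
        (w ^ (n + 1) * v : FreeMonoid A) := by
      rw [Con.eq, FCon_iff, FreeMonoid.toList_mul, FreeMonoid.toList_mul, GW.ι_append,
        GW.ι_append, GW.ι_toList_pow]
      exact h1
    have h3 : ((w ^ (n + 1) : FreeMonoid A) : (FCon A ZK.X (m + 2) (n + 1)).Quotient) = w :=
      (map_pow (FCon A ZK.X (m + 2) (n + 1)).mk' w (n + 1)).trans (he.pow_succ_eq n)
    rwa [Con.coe_mul, Con.coe_mul, h3] at h2
  rw [simK_iff]
  rintro e he (h' | h')
  · exact key h e he h'
  · exact (key ((FCon A _ _ _).symm h) e he h').symm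

/-- Reversal of words, as a homomorphism to the opposite of a quotient of the free monoid. -/
def reverseHom (c : Con (FreeMonoid A)) : FreeMonoid A →* c.Quotientᵐᵒᵖ where
  toFun w := MulOpposite.op ((FreeMonoid.ofList w.toList.reverse : FreeMonoid A) : c.Quotient)
  map_one' := rfl
  map_mul' u v := by simp [← MulOpposite.op_mul, FreeMonoid.ofList_append]

theorem reverseHom_surjective (c : Con (FreeMonoid A)) : Function.Surjective (reverseHom c) := by
  intro x
  obtain ⟨w, hw⟩ := Con.mk'_surjective (c := c) x.unop
  refine ⟨FreeMonoid.ofList w.toList.reverse, MulOpposite.unop_injective ?_⟩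
  rw [← hw]
  show ((FreeMonoid.ofList (w.toList.reverse).reverse : FreeMonoid A) : c.Quotient) = w
  rw [List.reverse_reverse, FreeMonoid.ofList_toList]

theorem InRLAux_FCon_Y_of_X [Finite A] {k n : ℕ}
    (h : InRLAux k true (FCon A ZK.X (k + 1) n).Quotient inferInstance) :
    InRLAux k false (FCon A ZK.Y (k + 1) n).Quotient inferInstance := by
  refine InRLAux.of_ker_le (M := (FCon A ZK.X (k + 1) n).Quotientᵐᵒᵖ) h.op (reverseHom _)
    (FCon A ZK.Y (k + 1) n).mk' (reverseHom_surjective _) Con.mk'_surjective fun x y hxy => ?_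
  have h1 := (Con.eq _).1 (MulOpposite.op_injective hxy)
  exact (Con.eq _).2 (GW.E_ι_reverse_iff.1 h1)

theorem InRLAux_FCon_X [Finite A] (k n : ℕ) :
    InRLAux k true (FCon A ZK.X (k + 1) n).Quotient inferInstance := by
  induction k with
  | zero => exact isJTrivial_FCon_X_one n
  | succ k ih =>
    refine InRLAux.of_ker_le (M := (FCon A ZK.Y (k + 1) n).Quotient)
      (N := (KCon (FCon A ZK.X (k + 2) n).Quotient).Quotient) (InRLAux_FCon_Y_of_X ih)
      (FCon A ZK.Y (k + 1) n).mk' ((KCon _).mk'.comp (FCon A ZK.X (k + 2) n).mk')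
      Con.mk'_surjective (Con.mk'_surjective.comp Con.mk'_surjective) fun x y hxy => ?_
    exact (Con.eq _).2 (KCon_iff.2 (simK_FCon ((Con.eq _).1 hxy)))

theorem InRLAux_FCon_Y [Finite A] (k n : ℕ) :
    InRLAux k false (FCon A ZK.Y (k + 1) n).Quotient inferInstance :=
  InRLAux_FCon_Y_of_X (InRLAux_FCon_X k n)

theorem InRLAux_FCon_WI_true [Finite A] (k n : ℕ) :
    InRLAux k true (FCon A ZK.WI k n).Quotient inferInstance :=
  InRLAux.of_ker_le (InRLAux_FCon_X k (2 * n)) (FCon A ZK.X (k + 1) (2 * n)).mk'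
    (FCon A ZK.WI k n).mk' Con.mk'_surjective Con.mk'_surjective fun _ _ hxy =>
    (Con.eq _).2 (GW.E_WI_of_E_X ((Con.eq _).1 hxy))

theorem InRLAux_FCon_WI_false [Finite A] (k n : ℕ) :
    InRLAux k false (FCon A ZK.WI k n).Quotient inferInstance :=
  InRLAux.of_ker_le (InRLAux_FCon_Y k (2 * n)) (FCon A ZK.Y (k + 1) (2 * n)).mk'
    (FCon A ZK.WI k n).mk' Con.mk'_surjective Con.mk'_surjective fun _ _ hxy =>
    (Con.eq _).2 (GW.E_WI_of_E_Y ((Con.eq _).1 hxy))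

end Completeness

section Equations

variable {A : Type}

theorem ev_listNPow {M : Type} [Monoid M] (σ : A → M) (l : List A) (k : ℕ) :
    ev σ (listNPow l k) = ev σ l ^ k := by
  induction k with
  | zero => simp [listNPow]
  | succ k ih => rw [listNPow, ev_append, ih, pow_succ']

theorem ev_substNat_monoidExp_mul {M : Type} [Monoid M] [Finite M] (σ : A → M) (c : ℕ)
    (α : PiTerm A) :
    ev σ (α.substNat (monoidExp M * (c + 1))) = ev σ (α.substNat (monoidExp M)) := by
  induction α with
  | eps => rfl
  | letter a => rfl
  | mul α β h1 h2 => rw [PiTerm.substNat, PiTerm.substNat, ev_append, ev_append, h1, h2]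
  | pi γ h =>
    rw [PiTerm.substNat, PiTerm.substNat, ev_listNPow, ev_listNPow, h, pow_mul]
    exact ((monoidExp_spec M).2 _).pow_succ_eq c

theorem le_monoidExp_mul (M : Type) [Monoid M] [Finite M] (c : ℕ) : c ≤ monoidExp M * c :=
  Nat.le_mul_of_pos_left c (monoidExp_spec M).1

theorem eqvAux_substOO_iff {n : ℕ} {k : ZK} {m K : ℕ} (hK : n + 2 ≤ K) (α β : PiTerm A) :
    eqvAux n k m α.substOO β.substOO ↔
      GW.E n k m (GW.ι (α.substNat K)) (GW.ι (β.substNat K)) := by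
  have h (γ : PiTerm A) : eqvAux n k m γ.substOO (GWord.ofList (γ.substNat K)) :=
    (GW.eqvAux_iff γ.accessible_substOO (GWord.accessible_ofList _)).2 (GW.E_substOO hK γ)
  refine Iff.trans ?_ (GW.eqvAux_iff (GWord.accessible_ofList _) (GWord.accessible_ofList _))
  exact ⟨fun H => ((h α).symm.trans H).trans (h β), fun H => ((h α).trans H).trans (h β).symm⟩

theorem eqHoldsIn_iff_substNat_mul (α β : PiTerm A) (M : Type) [Monoid M] [Finite M] (c : ℕ) :
    EqHoldsIn α β M ↔ ∀ σ : FreeMonoid A →* M,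
      σ (FreeMonoid.ofList (α.substNat (monoidExp M * (c + 1)))) =
        σ (FreeMonoid.ofList (β.substNat (monoidExp M * (c + 1)))) := by
  simp only [EqHoldsIn, freeMonoid_hom_eq_ev, ev_substNat_monoidExp_mul]

theorem eqHoldsIn_of_eqvAux {k : ZK} {m : ℕ} {α β : PiTerm A}
    (h : ∀ n, eqvAux n k m α.substOO β.substOO) {M : Type} [Monoid M] [Finite M]
    (H : ∀ σ : A → M, ∃ n, ∀ u v : List A, GW.E n k m (GW.ι u) (GW.ι v) → ev σ u = ev σ v) :
    EqHoldsIn α β M := by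
  intro σ
  rw [freeMonoid_hom_eq_ev, freeMonoid_hom_eq_ev]
  obtain ⟨n, hn⟩ := H fun a => σ (FreeMonoid.of a)
  have := hn _ _ ((eqvAux_substOO_iff (le_monoidExp_mul M (n + 2)) α β).1 (h n))
  rwa [ev_substNat_monoidExp_mul, ev_substNat_monoidExp_mul] at this

theorem eqvAux_of_eqHoldsIn [Finite A] {k : ZK} {m n : ℕ} {α β : PiTerm A}
    (h : EqHoldsIn α β (FCon A k m n).Quotient) : eqvAux n k m α.substOO β.substOO :=
  (eqvAux_substOO_iff (le_monoidExp_mul (FCon A k m n).Quotient (n + 2)) α β).2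
    ((Con.eq _).1 ((eqHoldsIn_iff_substNat_mul α β _ (n + 1)).1 h (FCon A k m n).mk'))

theorem eqvAux_X_iff [Finite A] (α β : PiTerm A) {m : ℕ} (hm : 1 ≤ m) :
    (∀ n : ℕ, eqvAux n ZK.X m α.substOO β.substOO) ↔
      ∀ (M : Type) [Monoid M] [Finite M], InRm m M → EqHoldsIn α β M := by
  obtain ⟨m, rfl⟩ := Nat.exists_eq_add_of_le' hm
  exact ⟨fun h M _ _ hM => eqHoldsIn_of_eqvAux h (ev_eq_of_E_X hM),
    fun h n => eqvAux_of_eqHoldsIn (h _ (InRLAux_FCon_X m n))⟩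

theorem eqvAux_Y_iff [Finite A] (α β : PiTerm A) {m : ℕ} (hm : 1 ≤ m) :
    (∀ n : ℕ, eqvAux n ZK.Y m α.substOO β.substOO) ↔
      ∀ (M : Type) [Monoid M] [Finite M], InLm m M → EqHoldsIn α β M := by
  obtain ⟨m, rfl⟩ := Nat.exists_eq_add_of_le' hm
  exact ⟨fun h M _ _ hM => eqHoldsIn_of_eqvAux h (ev_eq_of_E_Y hM),
    fun h n => eqvAux_of_eqHoldsIn (h _ (InRLAux_FCon_Y m n))⟩

theorem eqvAux_WI_iff [Finite A] (α β : PiTerm A) {m : ℕ} (hm : 1 ≤ m) :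
    (∀ n : ℕ, eqvAux n ZK.WI m α.substOO β.substOO) ↔
      ∀ (M : Type) [Monoid M] [Finite M],
        InRm (m + 1) M ∧ InLm (m + 1) M → EqHoldsIn α β M := by
  obtain ⟨m, rfl⟩ := Nat.exists_eq_add_of_le' hm
  exact ⟨fun h M _ _ hM => eqHoldsIn_of_eqvAux h (ev_eq_of_E_WI hM.1 hM.2),
    fun h n => eqvAux_of_eqHoldsIn
      (h _ ⟨InRLAux_FCon_WI_true (m + 1) n, InRLAux_FCon_WI_false (m + 1) n⟩)⟩

end Equations

/-- Theorem: the infinite relations characterize validity of π-term equations. -/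
theorem relations_and_equations (A : Type) [Fintype A] (α β : PiTerm A) (m : ℕ)
    (hm : 1 ≤ m) :
    ((∀ n : ℕ, wEquiv ZKind.X m n α.substOO β.substOO) ↔
      ∀ (M : Type) [Monoid M] [Finite M], InRm m M → EqHoldsIn α β M) ∧
    ((∀ n : ℕ, wEquiv ZKind.Y m n α.substOO β.substOO) ↔
      ∀ (M : Type) [Monoid M] [Finite M], InLm m M → EqHoldsIn α β M) ∧
    ((∀ n : ℕ, wEquiv ZKind.XY m n α.substOO β.substOO) ↔
      ((∀ (M : Type) [Monoid M] [Finite M], InRm m M → EqHoldsIn α β M) ∧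
        (∀ (M : Type) [Monoid M] [Finite M], InLm m M → EqHoldsIn α β M))) ∧
    ((∀ n : ℕ, wEquiv ZKind.WI m n α.substOO β.substOO) ↔
      ∀ (M : Type) [Monoid M] [Finite M],
        InRm (m + 1) M ∧ InLm (m + 1) M → EqHoldsIn α β M) := by
  refine ⟨eqvAux_X_iff α β hm, eqvAux_Y_iff α β hm, ?_, eqvAux_WI_iff α β hm⟩
  rw [← eqvAux_X_iff α β hm, ← eqvAux_Y_iff α β hm, ← forall_and]
  rfl
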